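/- There exist constants ε₀, ν₀ ∈ (0,1) and C > 0, independent of ν, k, λ and ε, such that for every 0 < ν ≤ ν₀, every 0 ≤ ε ≤ ε₀, every k = (k₁,k₃) ∈ ℤ² with |k₁| ≥ 1, every λ of the form λ = λ_r − i ε ν^{1/2}|k₁|^{−1/2} with λ_r ∈ ℝ, every F ∈ L²(I), and every solution w ∈ H²(I) of the Orr–Sommerfeld problem with Navier-slip boundary conditions and right-hand side F, one has ν^{1/6}|k₁|^{5/6}( |λ−1|^{1/2} + |ν/k₁|^{1/4} )^{1/3} ‖u‖_{L²} ≤ C ‖F‖_{L²}, where |λ−1| denotes the modulus of the complex number λ−1. -/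

import Mathlib

open Real MeasureTheory

noncomputable section

/-- `|k| = sqrt (k₁² + k₃²)` for `k = (k₁,k₃) ∈ ℤ²`. -/
def kabs (k₁ k₃ : ℤ) : ℝ := Real.sqrt ((k₁ : ℝ) ^ 2 + (k₃ : ℝ) ^ 2)

/-- The `L²` norm on the interval `(-1,1)`. -/
def l2 (f : ℝ → ℂ) : ℝ := Real.sqrt (∫ y in (-1:ℝ)..1, ‖f y‖ ^ 2)

/-- `‖(∂_y,|k|)f‖_{L²} = (‖f'‖² + |k|²‖f‖²)^{1/2}`. -/
def hk (k₁ k₃ : ℤ) (f : ℝ → ℂ) : ℝ :=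
  Real.sqrt ((∫ y in (-1:ℝ)..1, ‖deriv f y‖ ^ 2) +
    (kabs k₁ k₃) ^ 2 * ∫ y in (-1:ℝ)..1, ‖f y‖ ^ 2)

/-- The Orr–Sommerfeld problem with Navier-slip boundary conditions and a
(possibly complex) spectral parameter `λ`:
`-ν(∂_y² - |k|²)w + ik₁[(1-y²-λ)w + 2φ] = F` on `[-1,1]`, where
`(∂_y² - |k|²)φ = w`, `φ(±1) = φ''(±1) = 0`. -/
def OSslip (ν : ℝ) (k₁ k₃ : ℤ) (lam : ℂ) (w φ F : ℝ → ℂ) : Prop :=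
  ContDiff ℝ 2 w ∧ ContDiff ℝ 2 φ ∧
  (∀ y ∈ Set.Icc (-1:ℝ) 1,
    -(ν : ℂ) * (deriv (deriv w) y - ((kabs k₁ k₃ : ℝ) : ℂ) ^ 2 * w y) +
      Complex.I * (k₁ : ℂ) * ((1 - (y : ℂ) ^ 2 - lam) * w y + 2 * φ y) = F y) ∧
  (∀ y ∈ Set.Icc (-1:ℝ) 1,
    deriv (deriv φ) y - ((kabs k₁ k₃ : ℝ) : ℂ) ^ 2 * φ y = w y) ∧
  φ (-1) = 0 ∧ φ 1 = 0 ∧ deriv (deriv φ) (-1) = 0 ∧ deriv (deriv φ) 1 = 0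

set_option linter.all false
lemma cs_int {a b : ℝ} (hab : a ≤ b) {f g : ℝ → ℝ} (hf : ContinuousOn f (Set.Icc a b))
    (hg : ContinuousOn g (Set.Icc a b)) :
    |∫ y in a..b, f y * g y| ≤ √(∫ y in a..b, f y ^ 2) * √(∫ y in a..b, g y ^ 2) := by
  have hf2 : IntervalIntegrable (fun y => f y ^ 2) volume a b :=
    ContinuousOn.intervalIntegrable_of_Icc hab (hf.pow 2)
  have hg2 : IntervalIntegrable (fun y => g y ^ 2) volume a b :=
    ContinuousOn.intervalIntegrable_of_Icc hab (hg.pow 2)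
  have hfg : IntervalIntegrable (fun y => f y * g y) volume a b :=
    ContinuousOn.intervalIntegrable_of_Icc hab (hf.mul hg)
  have key : ∀ x : ℝ, 0 ≤ (∫ y in a..b, f y ^ 2) * (x * x) + (2 * ∫ y in a..b, f y * g y) * x
      + ∫ y in a..b, g y ^ 2 := by
    intro x
    have h0 : 0 ≤ ∫ y in a..b, (x * f y + g y) ^ 2 :=
      intervalIntegral.integral_nonneg hab (fun y _ => sq_nonneg _)
    have h1 : ∫ y in a..b, (x * f y + g y) ^ 2 =
        ∫ y in a..b, ((x * x) * f y ^ 2 + (2 * x) * (f y * g y)) + g y ^ 2 := by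
      congr 1; ext y; ring
    rw [h1, intervalIntegral.integral_add ((hf2.const_mul _).add (hfg.const_mul _)) hg2,
      intervalIntegral.integral_add (hf2.const_mul _) (hfg.const_mul _),
      intervalIntegral.integral_const_mul, intervalIntegral.integral_const_mul] at h0
    linarith
  have hd := discrim_le_zero key
  unfold discrim at hd
  have hF : 0 ≤ ∫ y in a..b, f y ^ 2 := intervalIntegral.integral_nonneg hab (fun y _ => sq_nonneg _)
  rw [← Real.sqrt_mul hF]
  apply Real.abs_le_sqrt
  nlinarith

lemma sq_int_nonneg {a b : ℝ} (hab : a ≤ b) (f : ℝ → ℝ) : 0 ≤ ∫ y in a..b, f y ^ 2 :=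
  intervalIntegral.integral_nonneg hab (fun y _ => sq_nonneg _)

/-- integrals over subintervals of nonneg functions -/
lemma sub_int_le {a b c d : ℝ} (hac : a ≤ c) (hcd : c ≤ d) (hdb : d ≤ b) {f : ℝ → ℝ}
    (hf : ContinuousOn f (Set.Icc a b)) (h0 : ∀ y ∈ Set.Icc a b, 0 ≤ f y) :
    ∫ y in c..d, f y ≤ ∫ y in a..b, f y := by
  apply intervalIntegral.integral_mono_interval hac hcd hdb
  · filter_upwards [ae_restrict_mem measurableSet_Ioc] with y hy
    exact h0 y ⟨hy.1.le, hy.2⟩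
  · exact ContinuousOn.intervalIntegrable_of_Icc (hac.trans (hcd.trans hdb)) hf

lemma holder_half {a b : ℝ} {f f' : ℝ → ℝ} (hf : ∀ y, HasDerivAt f (f' y) y)
    (hc : Continuous f') {x y : ℝ} (hx : x ∈ Set.Icc a b) (hy : y ∈ Set.Icc a b) :
    (f y - f x) ^ 2 ≤ |y - x| * ∫ z in a..b, f' z ^ 2 := by
  wlog hxy : x ≤ y generalizing x y
  · have := this hy hx (le_of_not_ge hxy)
    rw [abs_sub_comm]; linarith [sub_sq_comm (f x) (f y)]
  have h1 : ∫ z in x..y, f' z = f y - f x :=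
    intervalIntegral.integral_eq_sub_of_hasDerivAt (fun z _ => hf z) (hc.intervalIntegrable _ _)
  have h2 := cs_int hxy (f := fun _ => (1:ℝ)) (g := f') continuousOn_const hc.continuousOn
  simp only [one_mul, one_pow, intervalIntegral.integral_const, smul_eq_mul, mul_one] at h2
  rw [h1] at h2
  have h3 := sub_int_le hx.1 hxy hy.2 (f := fun z => f' z ^ 2) (hc.pow 2).continuousOn
    (fun z _ => sq_nonneg _)
  have h4 : (f y - f x) ^ 2 ≤ (y - x) * ∫ z in x..y, f' z ^ 2 := by
    have h5 : 0 ≤ y - x := sub_nonneg.2 hxy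
    have h6 := sq_int_nonneg hxy f'
    rw [← sq_abs, ← Real.sqrt_le_sqrt_iff (mul_nonneg h5 h6), Real.sqrt_sq (abs_nonneg _),
      Real.sqrt_mul h5]
    exact h2
  rw [abs_of_nonneg (sub_nonneg.2 hxy)]
  exact h4.trans (mul_le_mul_of_nonneg_left h3 (sub_nonneg.2 hxy))

/-- singular integral bound -/
lemma sing_right {c e K : ℝ} (hce : c ≤ e) {h : ℝ → ℝ} (hc : ContinuousOn h (Set.Icc c e))
    (hb : ∀ y ∈ Set.Ioc c e, |h y| * √(y - c) ≤ K) :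
    |∫ y in c..e, h y| ≤ 2 * K * √(e - c) := by
  have hint : IntervalIntegrable (fun y => K * (y - c) ^ (-(1/2) : ℝ)) volume c e := by
    apply IntervalIntegrable.const_mul
    have := (intervalIntegral.intervalIntegrable_rpow' (a := 0) (b := e - c)
      (r := -(1/2)) (by norm_num)).comp_sub_right c
    simpa using this
  have h1 : ‖∫ y in c..e, h y‖ ≤ ∫ y in c..e, K * (y - c) ^ (-(1/2) : ℝ) := by
    apply intervalIntegral.norm_integral_le_of_norm_le hce _ hint
    filter_upwards with y hy
    have hpos : 0 < y - c := by linarith [hy.1]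
    have hs : 0 < √(y - c) := Real.sqrt_pos.2 hpos
    rw [Real.rpow_neg hpos.le, ← Real.sqrt_eq_rpow, Real.norm_eq_abs, ← div_eq_mul_inv,
      le_div_iff₀ hs]
    exact hb y hy
  rw [Real.norm_eq_abs] at h1
  refine h1.trans (le_of_eq ?_)
  rw [intervalIntegral.integral_const_mul,
    intervalIntegral.integral_comp_sub_right (fun x => x ^ (-(1/2) : ℝ)) c,
    integral_rpow (Or.inl (by norm_num))]
  rw [sub_self, Real.sqrt_eq_rpow]
  norm_num
  ring

lemma sing_left {c e K : ℝ} (hce : e ≤ c) {h : ℝ → ℝ} (hc : ContinuousOn h (Set.Icc e c))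
    (hb : ∀ y ∈ Set.Ico e c, |h y| * √(c - y) ≤ K) :
    |∫ y in e..c, h y| ≤ 2 * K * √(c - e) := by
  have h1 := sing_right (c := -c) (e := -e) (K := K) (by linarith) (h := fun y => h (-y))
    (by
      apply hc.comp continuousOn_neg
      intro y hy; exact ⟨by linarith [hy.2], by linarith [hy.1]⟩)
    (by
      intro y hy
      have := hb (-y) ⟨by linarith [hy.2], by linarith [hy.1]⟩
      rwa [show c - -y = y - -c by ring] at this)
  rw [intervalIntegral.integral_comp_neg] at h1
  simpa [neg_neg, sub_eq_add_neg, add_comm] using h1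

/-- bound for `∫ 1/((y-c)^2+t^2)` -/
lemma int_lorentz (a b c t : ℝ) (hab : a ≤ b) (ht : 0 < t) :
    ∫ y in a..b, 1 / ((y - c) ^ 2 + t ^ 2) ≤ 4 / t := by
  have hd : ∀ y ∈ Set.uIcc a b, HasDerivAt (fun y => arctan ((y - c) / t) / t)
      (1 / ((y - c) ^ 2 + t ^ 2)) y := by
    intro y _
    have h1 : HasDerivAt (fun y : ℝ => (y - c) / t) (1 / t) y :=
      ((hasDerivAt_id y).sub_const c).div_const t
    have h2 := (h1.arctan).div_const t
    have ht' : t ≠ 0 := ht.ne'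
    have e : 1 / ((y - c) ^ 2 + t ^ 2) = 1 / (1 + ((y - c) / t) ^ 2) * (1 / t) / t := by
      have h3 : (y - c) ^ 2 + t ^ 2 ≠ 0 := by positivity
      rw [show 1 + ((y - c) / t) ^ 2 = ((y - c) ^ 2 + t ^ 2) / t ^ 2 by field_simp; ring]
      field_simp
    rw [e]; exact h2
  rw [intervalIntegral.integral_eq_sub_of_hasDerivAt hd]
  · have h1 := arctan_lt_pi_div_two ((b - c) / t)
    have h2 := neg_pi_div_two_lt_arctan ((a - c) / t)
    rw [← sub_div]
    apply div_le_div_of_nonneg_right _ ht.le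
    linarith [Real.pi_lt_four]
  · apply Continuous.intervalIntegrable
    apply Continuous.div continuous_const (by fun_prop)
    intro y; positivity

lemma iadd {a b : ℝ} {f g : ℝ → ℝ} (hf : Continuous f) (hg : Continuous g) :
    ∫ y in a..b, (f y + g y) = (∫ y in a..b, f y) + ∫ y in a..b, g y :=
  intervalIntegral.integral_add (hf.intervalIntegrable _ _) (hg.intervalIntegrable _ _)

lemma isub {a b : ℝ} {f g : ℝ → ℝ} (hf : Continuous f) (hg : Continuous g) :
    ∫ y in a..b, (f y - g y) = (∫ y in a..b, f y) - ∫ y in a..b, g y :=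
  intervalIntegral.integral_sub (hf.intervalIntegrable _ _) (hg.intervalIntegrable _ _)

lemma icm {a b : ℝ} (c : ℝ) (f : ℝ → ℝ) :
    ∫ y in a..b, c * f y = c * ∫ y in a..b, f y :=
  intervalIntegral.integral_const_mul _ _

lemma imono {a b : ℝ} (hab : a ≤ b) {f g : ℝ → ℝ} (hf : Continuous f) (hg : Continuous g)
    (h : ∀ y ∈ Set.Icc a b, f y ≤ g y) : ∫ y in a..b, f y ≤ ∫ y in a..b, g y :=
  intervalIntegral.integral_mono_on hab (hf.intervalIntegrable _ _) (hg.intervalIntegrable _ _) h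


/-- data of the inviscid problem -/
structure InvS where
  L : ℝ
  κ : ℝ
  φ : ℝ → ℝ
  φ1 : ℝ → ℝ
  φ2 : ℝ → ℝ
  hL : 0 < L
  hκ : 0 < κ
  hκL : 1 ≤ κ * L
  d1 : ∀ y, HasDerivAt φ (φ1 y) y
  d2 : ∀ y, HasDerivAt φ1 (φ2 y) y
  c2 : Continuous φ2
  bm : φ (-L) = 0
  bp : φ L = 0

namespace InvS
variable (S : InvS)

def w (y : ℝ) : ℝ := S.φ2 y - S.κ ^ 2 * S.φ y
def G (y : ℝ) : ℝ := (1 - y ^ 2) * S.w y + 2 * S.φ y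
def N2 : ℝ := ∫ y in (-S.L)..S.L, S.w y ^ 2
def G2 : ℝ := ∫ y in (-S.L)..S.L, S.G y ^ 2
def V2 : ℝ := ∫ y in (-S.L)..S.L, S.φ1 y ^ 2
def Q2 : ℝ := ∫ y in (-S.L)..S.L, S.φ y ^ 2
def U : ℝ := S.V2 + S.κ ^ 2 * S.Q2

lemma LL : -S.L ≤ S.L := by linarith [S.hL]
lemma cφ : Continuous S.φ := continuous_iff_continuousAt.2 fun y => (S.d1 y).continuousAt
lemma c1 : Continuous S.φ1 := continuous_iff_continuousAt.2 fun y => (S.d2 y).continuousAt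
lemma cw : Continuous S.w := by
  have := S.c2; have := S.cφ; unfold w; fun_prop
lemma cG : Continuous S.G := by
  have := S.cw; have := S.cφ; unfold G; fun_prop
lemma N2_nn : 0 ≤ S.N2 := sq_int_nonneg S.LL _
lemma G2_nn : 0 ≤ S.G2 := sq_int_nonneg S.LL _
lemma V2_nn : 0 ≤ S.V2 := sq_int_nonneg S.LL _
lemma Q2_nn : 0 ≤ S.Q2 := sq_int_nonneg S.LL _
lemma U_nn : 0 ≤ S.U := by
  have := S.V2_nn; have := S.Q2_nn; unfold U; positivity
lemma V2_le : S.V2 ≤ S.U := by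
  have := S.Q2_nn; have : 0 ≤ S.κ ^ 2 * S.Q2 := by positivity
  unfold U; linarith
lemma Q2_le : S.κ ^ 2 * S.Q2 ≤ S.U := by
  have := S.V2_nn; unfold U; linarith

/-- reflection -/
def refl : InvS where
  L := S.L
  κ := S.κ
  φ := fun y => S.φ (-y)
  φ1 := fun y => -S.φ1 (-y)
  φ2 := fun y => S.φ2 (-y)
  hL := S.hL
  hκ := S.hκ
  hκL := S.hκL
  d1 := fun y => by
    have := (S.d1 (-y)).scomp y (hasDerivAt_neg y)
    simpa [Function.comp_def] using this
  d2 := fun y => by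
    have := ((S.d2 (-y)).scomp y (hasDerivAt_neg y)).fun_neg
    simpa [Function.comp_def] using this
  c2 := S.c2.comp continuous_neg
  bm := by simpa using S.bp
  bp := S.bm

lemma int_refl (f : ℝ → ℝ) (L : ℝ) : ∫ y in (-L)..L, f (-y) = ∫ y in (-L)..L, f y := by
  rw [intervalIntegral.integral_comp_neg]; simp

lemma refl_w (y : ℝ) : S.refl.w y = S.w (-y) := rfl
lemma refl_G (y : ℝ) : S.refl.G y = S.G (-y) := by
  unfold G; rw [refl_w]; simp [refl]
lemma refl_N2 : S.refl.N2 = S.N2 := int_refl (fun y => S.w y ^ 2) S.L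
lemma refl_G2 : S.refl.G2 = S.G2 := by
  unfold G2; simp only [refl_G]; exact int_refl (fun y => S.G y ^ 2) S.L
lemma refl_V2 : S.refl.V2 = S.V2 := by
  have : S.refl.V2 = ∫ y in (-S.L)..S.L, S.φ1 (-y) ^ 2 := by
    simp [V2, refl]
  rw [this]; exact int_refl (fun y => S.φ1 y ^ 2) S.L
lemma refl_Q2 : S.refl.Q2 = S.Q2 := int_refl (fun y => S.φ y ^ 2) S.L
lemma refl_U : S.refl.U = S.U := by unfold U; rw [refl_V2, refl_Q2]; rfl

end InvS

lemma Wt_pos {t : ℝ} (ht : 0 < t) (y : ℝ) : 0 < (1 - y ^ 2) ^ 2 + t ^ 2 := by positivity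

lemma Xf {L t A V : ℝ} (hL : 0 < L) (ht : 0 < t) (ht1 : t ≤ 1) {f : ℝ → ℝ}
    (hf : Continuous f)
    (hb : ∀ y ∈ Set.Icc (-L) L, f y ^ 2 ≤ 2 * A + 2 * |(|y| - 1)| * V) (hA : 0 ≤ A) (hV : 0 ≤ V) :
    ∫ y in (-L)..L, f y ^ 2 / ((1 - y ^ 2) ^ 2 + t ^ 2) ≤ 40 * (A + V) / t := by
  have hLL : -L ≤ L := by linarith
  have hc : ∀ (c s : ℝ), 0 < s → Continuous (fun y : ℝ => 1 / ((y - c) ^ 2 + s ^ 2)) := by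
    intro c s hs
    apply Continuous.div continuous_const (by fun_prop)
    intro y; positivity
  have h1 : ∫ y in (-L)..L, f y ^ 2 / ((1 - y ^ 2) ^ 2 + t ^ 2) ≤
      ∫ y in (-L)..L, (2 * A * (1 / ((y - 1) ^ 2 + t ^ 2)) + 2 * A * (1 / ((y - (-1)) ^ 2 + t ^ 2)))
        + 10 * V / t * (1 / ((y - 0) ^ 2 + 1 ^ 2)) := by
    apply intervalIntegral.integral_mono_on hLL
    · apply Continuous.intervalIntegrable
      apply Continuous.div (by fun_prop) (by fun_prop)
      intro y; exact (Wt_pos ht y).ne'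
    · apply Continuous.intervalIntegrable
      exact ((continuous_const.mul (hc _ _ ht)).add (continuous_const.mul (hc _ _ ht))).add
        (continuous_const.mul (hc _ _ one_pos))
    intro y hy
    have hp := Wt_pos ht y
    have e1 : 1 / ((1 - y ^ 2) ^ 2 + t ^ 2) ≤ 1 / ((y - 1) ^ 2 + t ^ 2) + 1 / ((y - (-1)) ^ 2 + t ^ 2) := by
      rcases le_total 0 y with h | h
      · have : 1 / ((1 - y ^ 2) ^ 2 + t ^ 2) ≤ 1 / ((y - 1) ^ 2 + t ^ 2) := by
          apply one_div_le_one_div_of_le (by positivity)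
          nlinarith [mul_nonneg (sq_nonneg (y - 1)) h, mul_nonneg (sq_nonneg (y-1)) (sq_nonneg y)]
        have : 0 ≤ 1 / ((y - (-1)) ^ 2 + t ^ 2) := by positivity
        linarith
      · have : 1 / ((1 - y ^ 2) ^ 2 + t ^ 2) ≤ 1 / ((y - (-1)) ^ 2 + t ^ 2) := by
          apply one_div_le_one_div_of_le (by positivity)
          nlinarith [mul_nonneg (sq_nonneg (y + 1)) (neg_nonneg.2 h),
            mul_nonneg (sq_nonneg (y+1)) (sq_nonneg y)]
        have : 0 ≤ 1 / ((y - 1) ^ 2 + t ^ 2) := by positivity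
        linarith
    have e2 : |(|y| - 1)| * (1 / ((1 - y ^ 2) ^ 2 + t ^ 2)) ≤ 5 / t * (1 / ((y - 0) ^ 2 + 1 ^ 2)) := by
      rw [mul_one_div, ← div_eq_mul_one_div, div_div, div_le_div_iff₀ hp (by positivity)]
      have hy2 : y ^ 2 = |y| ^ 2 := (sq_abs y).symm
      rw [sub_zero, hy2]
      set m := |y| with hm
      have hm0 : 0 ≤ m := abs_nonneg _
      set x := |m - 1| with hx
      have hx0 : 0 ≤ x := abs_nonneg _
      have hxx : (1 - m ^ 2) ^ 2 = x ^ 2 * (m + 1) ^ 2 := by 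
        have : x ^ 2 = (m - 1) ^ 2 := sq_abs _
        rw [this]; ring
      rw [hxx]
      have k1 : x * (t * (m ^ 2 + 1 ^ 2)) ≤ x * t * (m + 1) ^ 2 := by
        have : 0 ≤ x * t * m := by positivity
        nlinarith
      refine k1.trans ?_
      rcases le_total m 2 with h | h
      · have : x * t * (m + 1) ^ 2 ≤ 3 * (x * t * (m + 1)) := by
          have : 0 ≤ x * t * (m + 1) := by positivity
          nlinarith
        nlinarith [sq_nonneg (x * (m + 1) - t), sq_nonneg (x * (m+1)), sq_nonneg t]
      · have hx1 : 1 ≤ x := by rw [hx]; exact le_trans (by linarith) (le_abs_self _)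
        have : x * t * (m + 1) ^ 2 ≤ x * x * (m + 1) ^ 2 := by
          apply mul_le_mul_of_nonneg_right _ (sq_nonneg _)
          exact mul_le_mul_of_nonneg_left (by linarith) hx0
        nlinarith [sq_nonneg (x * (m+1)), sq_nonneg t]
    have e0 : 0 ≤ 1 / ((1 - y ^ 2) ^ 2 + t ^ 2) := by positivity
    have e3 : f y ^ 2 / ((1 - y ^ 2) ^ 2 + t ^ 2) ≤
        (2 * A + 2 * |(|y| - 1)| * V) * (1 / ((1 - y ^ 2) ^ 2 + t ^ 2)) := by
      rw [div_eq_mul_one_div]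
      exact mul_le_mul_of_nonneg_right (hb y hy) e0
    have e4 := mul_le_mul_of_nonneg_left e1 (by positivity : 0 ≤ 2 * A)
    have e5 := mul_le_mul_of_nonneg_left e2 (by positivity : 0 ≤ 2 * V)
    have e6 : 10 * V / t * (1 / ((y - 0) ^ 2 + 1 ^ 2)) = 2 * V * (5 / t * (1 / ((y - 0) ^ 2 + 1 ^ 2))) := by
      ring
    rw [e6]
    linarith
  have i1 := int_lorentz (-L) L 1 t hLL ht
  have i2 := int_lorentz (-L) L (-1) t hLL ht
  have i3 := int_lorentz (-L) L 0 1 hLL one_pos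
  have hc1 := hc 1 t ht
  have hc2 := hc (-1) t ht
  have hc3 := hc 0 1 one_pos
  rw [iadd, iadd, icm, icm, icm] at h1
  rotate_left
  · exact continuous_const.mul hc1
  · exact continuous_const.mul hc2
  · exact (continuous_const.mul hc1).add (continuous_const.mul hc2)
  · exact continuous_const.mul hc3
  have j1 := mul_le_mul_of_nonneg_left i1 (by positivity : 0 ≤ 2 * A)
  have j2 := mul_le_mul_of_nonneg_left i2 (by positivity : 0 ≤ 2 * A)
  have j3 := mul_le_mul_of_nonneg_left i3 (by positivity : 0 ≤ 10 * V / t)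
  refine (h1.trans (add_le_add (add_le_add j1 j2) j3)).trans ?_
  have : 0 ≤ A / t := by positivity
  have e : 40 * (A + V) / t = 2 * A * (4 / t) + 2 * A * (4 / t) + 10 * V / t * (4 / 1) + 24 * (A / t) := by
    ring
  linarith

/-- the regularised `1/W` -/
def qf (t y : ℝ) : ℝ := (1 - y ^ 2) / ((1 - y ^ 2) ^ 2 + t ^ 2)

lemma cqf {t : ℝ} (ht : 0 < t) : Continuous (qf t) := by
  unfold qf
  apply Continuous.div (by fun_prop) (by fun_prop)
  intro y; exact (Wt_pos ht y).ne'

lemma qf_neg (t y : ℝ) : qf t (-y) = qf t y := by simp [qf]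

namespace InvS
variable (S : InvS)

lemma parts {f f1 : ℝ → ℝ} (hf : ∀ y, HasDerivAt f (f1 y) y) (hc : Continuous f1)
    (h0 : f (-S.L) = 0) (h1 : f S.L = 0) :
    ∫ y in (-S.L)..S.L, f y * S.w y =
      -((∫ y in (-S.L)..S.L, f1 y * S.φ1 y) + S.κ ^ 2 * ∫ y in (-S.L)..S.L, f y * S.φ y) := by
  have hcf : Continuous f := continuous_iff_continuousAt.2 fun y => (hf y).continuousAt
  have e := intervalIntegral.integral_mul_deriv_eq_deriv_mul (a := -S.L) (b := S.L)
    (fun y _ => hf y) (fun y _ => S.d2 y) (hc.intervalIntegrable _ _) (S.c2.intervalIntegrable _ _)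
  have e2 : ∫ y in (-S.L)..S.L, f y * S.w y = (∫ y in (-S.L)..S.L, f y * S.φ2 y) -
      S.κ ^ 2 * ∫ y in (-S.L)..S.L, f y * S.φ y := by
    have := S.c2
    have := S.cφ
    rw [← icm, ← isub (by fun_prop) (by fun_prop)]
    congr 1; ext y; unfold w; ring
  rw [e2, e, h0, h1]; ring

/-- test-function form -/
def M (t : ℝ) (f f1 : ℝ → ℝ) : ℝ := (∫ y in (-S.L)..S.L, f1 y * S.φ1 y) +
  S.κ ^ 2 * (∫ y in (-S.L)..S.L, f y * S.φ y) - 2 * ∫ y in (-S.L)..S.L, qf t y * (f y * S.φ y)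

lemma Tf0 {t : ℝ} (ht : 0 < t) {f f1 : ℝ → ℝ} (hf : ∀ y, HasDerivAt f (f1 y) y)
    (hc : Continuous f1) (h0 : f (-S.L) = 0) (h1 : f S.L = 0) :
    S.M t f f1 ^ 2 ≤ (∫ y in (-S.L)..S.L, f y ^ 2 / ((1 - y ^ 2) ^ 2 + t ^ 2)) *
      (S.G2 + t ^ 2 * S.N2) := by
  have hcf : Continuous f := continuous_iff_continuousAt.2 fun y => (hf y).continuousAt
  have hcw := S.cw
  have hcφ := S.cφ
  have hcG := S.cG
  have hcq := cqf ht
  have hcs : Continuous (fun y : ℝ => √((1 - y ^ 2) ^ 2 + t ^ 2)) := by fun_prop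
  have hs : ∀ y : ℝ, √((1 - y ^ 2) ^ 2 + t ^ 2) ≠ 0 := fun y => (Real.sqrt_pos.2 (Wt_pos ht y)).ne'
  have hp := S.parts hf hc h0 h1
  have e1 : S.M t f f1 = ∫ y in (-S.L)..S.L,
      -((f y / √((1 - y ^ 2) ^ 2 + t ^ 2)) *
        (((1 - y ^ 2) * S.G y + t ^ 2 * S.w y) / √((1 - y ^ 2) ^ 2 + t ^ 2))) := by
    have : S.M t f f1 = -(∫ y in (-S.L)..S.L, f y * S.w y) -
      2 * ∫ y in (-S.L)..S.L, qf t y * (f y * S.φ y) := by rw [hp]; unfold M; ring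
    rw [this, ← intervalIntegral.integral_const_mul, ← intervalIntegral.integral_neg,
      ← intervalIntegral.integral_sub]
    · congr 1; ext y
      have h2 := Real.mul_self_sqrt (Wt_pos ht y).le
      have h3 := (Wt_pos ht y).ne'
      rw [div_mul_div_comm, h2]
      unfold qf G
      field_simp
      ring
    · exact ((hcf.mul hcw).neg).intervalIntegrable _ _
    · exact (continuous_const.mul (hcq.mul (hcf.mul hcφ))).intervalIntegrable _ _
  rw [intervalIntegral.integral_neg] at e1
  have e2 := cs_int S.LL (f := fun y => f y / √((1 - y ^ 2) ^ 2 + t ^ 2))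
    (g := fun y => ((1 - y ^ 2) * S.G y + t ^ 2 * S.w y) / √((1 - y ^ 2) ^ 2 + t ^ 2))
    (hcf.div hcs hs).continuousOn (Continuous.div (by fun_prop) hcs hs).continuousOn
  have hX0 : 0 ≤ ∫ y in (-S.L)..S.L, f y ^ 2 / ((1 - y ^ 2) ^ 2 + t ^ 2) :=
    intervalIntegral.integral_nonneg S.LL fun y _ => div_nonneg (sq_nonneg _) (Wt_pos ht y).le
  have e3 : ∫ y in (-S.L)..S.L, (f y / √((1 - y ^ 2) ^ 2 + t ^ 2)) ^ 2 =
      ∫ y in (-S.L)..S.L, f y ^ 2 / ((1 - y ^ 2) ^ 2 + t ^ 2) := by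
    congr 1; ext y; rw [div_pow, Real.sq_sqrt (Wt_pos ht y).le]
  have e4 : ∫ y in (-S.L)..S.L,
      (((1 - y ^ 2) * S.G y + t ^ 2 * S.w y) / √((1 - y ^ 2) ^ 2 + t ^ 2)) ^ 2 ≤
      S.G2 + t ^ 2 * S.N2 := by
    unfold G2 N2
    rw [← icm, ← iadd (by fun_prop) (by fun_prop)]
    apply intervalIntegral.integral_mono_on S.LL
    · exact ((Continuous.div (by fun_prop) hcs hs).pow 2).intervalIntegrable _ _
    · exact ((hcG.pow 2).add (continuous_const.mul (hcw.pow 2))).intervalIntegrable _ _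
    intro y _
    rw [div_pow, Real.sq_sqrt (Wt_pos ht y).le, div_le_iff₀ (Wt_pos ht y)]
    nlinarith [sq_nonneg (t * S.G y - t * (1 - y ^ 2) * S.w y)]
  rw [e3] at e2
  have hT0 := sq_int_nonneg S.LL
    (fun y => ((1 - y ^ 2) * S.G y + t ^ 2 * S.w y) / √((1 - y ^ 2) ^ 2 + t ^ 2))
  rw [e1, neg_sq, ← sq_abs]
  calc _ ≤ _ := pow_le_pow_left₀ (abs_nonneg _) e2 2
    _ = _ := by rw [mul_pow, Real.sq_sqrt hX0, Real.sq_sqrt hT0]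
    _ ≤ _ := mul_le_mul_of_nonneg_left e4 hX0

lemma Tf {t A V : ℝ} (ht : 0 < t) (ht1 : t ≤ 1) (hG : S.G2 ≤ t ^ 2 * S.N2)
    {f f1 : ℝ → ℝ} (hf : ∀ y, HasDerivAt f (f1 y) y)
    (hc : Continuous f1) (h0 : f (-S.L) = 0) (h1 : f S.L = 0) (hA : 0 ≤ A) (hV : 0 ≤ V)
    (hb : ∀ y ∈ Set.Icc (-S.L) S.L, f y ^ 2 ≤ 2 * A + 2 * |(|y| - 1)| * V) :
    S.M t f f1 ^ 2 ≤ 80 * (t * S.N2) * (A + V) := by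
  have hcf : Continuous f := continuous_iff_continuousAt.2 fun y => (hf y).continuousAt
  have h2 := S.Tf0 ht hf hc h0 h1
  have h3 := Xf S.hL ht ht1 hcf hb hA hV
  have hX0 : 0 ≤ ∫ y in (-S.L)..S.L, f y ^ 2 / ((1 - y ^ 2) ^ 2 + t ^ 2) :=
    intervalIntegral.integral_nonneg S.LL fun y _ => div_nonneg (sq_nonneg _) (Wt_pos ht y).le
  have hN := S.N2_nn
  have hG0 := S.G2_nn
  calc _ ≤ _ := h2
    _ ≤ (40 * (A + V) / t) * (2 * (t ^ 2 * S.N2)) := by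
        apply mul_le_mul h3 (by linarith) (by positivity) (by positivity)
    _ = _ := by field_simp; ring

end InvS



lemma sup_sq {a b : ℝ} {f f1 : ℝ → ℝ} (hf : ∀ y, HasDerivAt f (f1 y) y)
    (hc : Continuous f1) (h0 : f a = 0) {y : ℝ} (hy : y ∈ Set.Icc a b) :
    f y ^ 2 ≤ 2 * (√(∫ y in a..b, f y ^ 2) * √(∫ y in a..b, f1 y ^ 2)) := by
  have hcf : Continuous f := continuous_iff_continuousAt.2 fun y => (hf y).continuousAt
  have e : ∫ z in a..y, 2 * (f z * f1 z) = f y ^ 2 - f a ^ 2 := by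
    apply intervalIntegral.integral_eq_sub_of_hasDerivAt
    · intro z _
      have := (hf z).fun_pow 2
      refine this.congr_deriv ?_
      norm_num; ring
    · exact (Continuous.intervalIntegrable (by fun_prop) _ _)
  rw [icm, h0] at e
  have h1 := cs_int hy.1 hcf.continuousOn hc.continuousOn
  have h2 := sub_int_le le_rfl hy.1 hy.2 (f := fun z => f z ^ 2) (hcf.pow 2).continuousOn
    (fun z _ => sq_nonneg _)
  have h3 := sub_int_le le_rfl hy.1 hy.2 (f := fun z => f1 z ^ 2) (hc.pow 2).continuousOn
    (fun z _ => sq_nonneg _)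
  have h4 := mul_le_mul (Real.sqrt_le_sqrt h2) (Real.sqrt_le_sqrt h3) (Real.sqrt_nonneg _) (Real.sqrt_nonneg _)
  have h5 := le_abs_self (∫ z in a..y, f z * f1 z)
  linarith

lemma abs_qf_le {t y : ℝ} (ht : 0 < t) (hy : 0 ≤ y) : |qf t y| * |y - 1| ≤ 1 := by
  unfold qf
  rw [abs_div, abs_of_pos (Wt_pos ht y), div_mul_eq_mul_div, div_le_one (Wt_pos ht y)]
  have e : |1 - y ^ 2| = |y - 1| * (y + 1) := by
    rw [show 1 - y ^ 2 = -((y - 1) * (y + 1)) by ring, abs_neg, abs_mul,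
      abs_of_nonneg (by linarith : 0 ≤ y + 1)]
  have e2 : (1 - y ^ 2) ^ 2 = (|y - 1| * (y + 1)) ^ 2 := by rw [← e, sq_abs]
  rw [e, e2]
  have := abs_nonneg (y - 1)
  nlinarith [mul_nonneg (mul_nonneg (sq_nonneg (|y - 1|)) hy) (by linarith : 0 ≤ y + 1), sq_nonneg t]

lemma qf_nonpos {t y : ℝ} (ht : 0 < t) (hy : 1 ≤ y ^ 2) : qf t y ≤ 0 := by
  unfold qf
  exact div_nonpos_of_nonpos_of_nonneg (by linarith) (Wt_pos ht y).le

lemma qf_nonneg {t y : ℝ} (ht : 0 < t) (hy : y ^ 2 ≤ 1) : 0 ≤ qf t y := by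
  unfold qf
  exact div_nonneg (by linarith) (Wt_pos ht y).le

lemma qf_sym {t x : ℝ} (ht : 0 < t) (hx : 0 ≤ x) (hx1 : x ≤ 1/2) :
    |qf t (1 - x) + qf t (1 + x)| ≤ 1 := by
  set p := x * (2 - x) with hp
  set m := x * (2 + x) with hm
  have e1 : qf t (1 - x) = p / (p ^ 2 + t ^ 2) := by
    unfold qf; rw [show 1 - (1 - x) ^ 2 = p by rw [hp]; ring]
  have e2 : qf t (1 + x) = -(m / (m ^ 2 + t ^ 2)) := by
    unfold qf; rw [show 1 - (1 + x) ^ 2 = -m by rw [hm]; ring, neg_sq, neg_div]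
  have hp0 : 0 ≤ p := mul_nonneg hx (by linarith)
  have hm0 : 0 ≤ m := by positivity
  have hP : 0 < p ^ 2 + t ^ 2 := by positivity
  have hM : 0 < m ^ 2 + t ^ 2 := by positivity
  have hmp : m - p = 2 * x ^ 2 := by rw [hm, hp]; ring
  have k1 : 2 * x ^ 2 ≤ p * m := by
    rw [hm, hp]; nlinarith [sq_nonneg x, mul_nonneg (sq_nonneg x) hx,
      mul_nonneg (sq_nonneg x) (sub_nonneg.2 (show x * x ≤ 2 by nlinarith))]
  have k2 : 2 * x ^ 2 ≤ m ^ 2 := by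
    rw [hm]; nlinarith [sq_nonneg x, mul_nonneg (sq_nonneg x) hx, mul_nonneg (sq_nonneg x) (sq_nonneg x)]
  have e : qf t (1 - x) + qf t (1 + x) = (2 * x ^ 2) * (p * m - t ^ 2) / ((p ^ 2 + t ^ 2) * (m ^ 2 + t ^ 2)) := by
    rw [e1, e2, ← hmp]; field_simp; ring
  rw [e, abs_le]
  constructor
  · rw [le_div_iff₀ (by positivity)]
    nlinarith [mul_nonneg (sq_nonneg t) (sub_nonneg.2 k2), mul_nonneg (sq_nonneg p) (sq_nonneg m),
      mul_nonneg (sq_nonneg p) (sq_nonneg t), sq_nonneg (t^2), mul_nonneg (sq_nonneg x) (mul_nonneg hp0 hm0)]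
  · rw [div_le_one (by positivity)]
    nlinarith [mul_nonneg (mul_nonneg hp0 hm0) (sub_nonneg.2 k1), mul_nonneg (sq_nonneg x) (sq_nonneg t),
      mul_nonneg (sq_nonneg p) (sq_nonneg t), sq_nonneg (t^2), mul_nonneg (sq_nonneg m) (sq_nonneg t)]

lemma qf_sym_int {t d : ℝ} (ht : 0 < t) (hd : 0 ≤ d) (hd1 : d ≤ 1/2) :
    |∫ y in (1 - d)..(1 + d), qf t y| ≤ d := by
  have hc := cqf ht
  have e1 : ∫ y in (1 - d)..1, qf t y = ∫ x in (0:ℝ)..d, qf t (1 - x) := by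
    rw [intervalIntegral.integral_comp_sub_left (fun x => qf t x)]; simp
  have e2 : ∫ y in (1:ℝ)..(1 + d), qf t y = ∫ x in (0:ℝ)..d, qf t (1 + x) := by
    rw [intervalIntegral.integral_comp_add_left (fun x => qf t x)]; simp
  have e3 := intervalIntegral.integral_add_adjacent_intervals (hc.intervalIntegrable (μ := volume) (1 - d) 1)
    (hc.intervalIntegrable (μ := volume) 1 (1 + d))
  rw [← e3, e1, e2, ← iadd (by fun_prop) (by fun_prop)]
  have := intervalIntegral.norm_integral_le_of_norm_le_const (a := 0) (b := d) (C := 1)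
    (f := fun x => qf t (1 - x) + qf t (1 + x)) (by
      intro x hx
      rw [Set.uIoc_of_le hd] at hx
      exact qf_sym ht hx.1.le (hx.2.trans hd1))
  simpa [abs_of_nonneg hd] using this

/-- absolute bound of a symmetric principal value -/
lemma pv_mid {t d E : ℝ} (ht : 0 < t) (hd : 0 ≤ d) (hd1 : d ≤ 1/2) {g : ℝ → ℝ}
    (hg : Continuous g) (hE : ∀ y ∈ Set.Icc (1 - d) (1 + d), |g y - g 1| ≤ E * √|y - 1|) :
    |∫ y in (1 - d)..(1 + d), qf t y * g y| ≤ 4 * E * √d + |g 1| * d := by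
  have hc := cqf ht
  have h1 : |∫ y in (1 - d)..1, qf t y * (g y - g 1)| ≤ 2 * E * √(1 - (1 - d)) := by
    apply sing_left (by linarith) (by exact (hc.mul (hg.sub continuous_const)).continuousOn)
    intro y hy
    have h2 := hE y ⟨hy.1, by linarith [hy.2]⟩
    have h3 := abs_qf_le ht (by linarith [hy.1] : 0 ≤ y)
    have h4 : |y - 1| = 1 - y := by rw [abs_sub_comm, abs_of_nonneg]; linarith [hy.2]
    rw [h4] at h2 h3
    have h5 : 0 < √(1 - y) := Real.sqrt_pos.2 (by linarith [hy.2])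
    have h6 : √(1 - y) * √(1 - y) = 1 - y := Real.mul_self_sqrt (by linarith [hy.2])
    have hE0 : 0 ≤ E := by
      by_contra h
      have := abs_nonneg (g y - g 1)
      nlinarith
    rw [abs_mul]
    calc |qf t y| * |g y - g 1| * √(1 - y) ≤ |qf t y| * (E * √(1 - y)) * √(1 - y) := by gcongr
      _ = E * (|qf t y| * (√(1 - y) * √(1 - y))) := by ring
      _ = E * (|qf t y| * (1 - y)) := by rw [h6]
      _ ≤ E * 1 := by gcongr
      _ = E := mul_one _
  have h1' : |∫ y in (1:ℝ)..(1 + d), qf t y * (g y - g 1)| ≤ 2 * E * √((1 + d) - 1) := by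
    apply sing_right (by linarith) (by exact (hc.mul (hg.sub continuous_const)).continuousOn)
    intro y hy
    have h2 := hE y ⟨by linarith [hy.1], hy.2⟩
    have h3 := abs_qf_le ht (by linarith [hy.1] : 0 ≤ y)
    have h4 : |y - 1| = y - 1 := by rw [abs_of_nonneg]; linarith [hy.1]
    rw [h4] at h2 h3
    have h5 : 0 < √(y - 1) := Real.sqrt_pos.2 (by linarith [hy.1])
    have h6 : √(y - 1) * √(y - 1) = y - 1 := Real.mul_self_sqrt (by linarith [hy.1])
    have hE0 : 0 ≤ E := by
      by_contra h
      have := abs_nonneg (g y - g 1)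
      nlinarith
    rw [abs_mul]
    calc |qf t y| * |g y - g 1| * √(y - 1) ≤ |qf t y| * (E * √(y - 1)) * √(y - 1) := by gcongr
      _ = E * (|qf t y| * (√(y - 1) * √(y - 1))) := by ring
      _ = E * (|qf t y| * (y - 1)) := by rw [h6]
      _ ≤ E * 1 := by gcongr
      _ = E := mul_one _
  have h7 := qf_sym_int ht hd hd1
  have e : ∫ y in (1 - d)..(1 + d), qf t y * g y = (∫ y in (1 - d)..1, qf t y * (g y - g 1)) +
      (∫ y in (1:ℝ)..(1 + d), qf t y * (g y - g 1)) + g 1 * ∫ y in (1 - d)..(1 + d), qf t y := by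
    rw [intervalIntegral.integral_add_adjacent_intervals
      (Continuous.intervalIntegrable (by fun_prop) _ _) (Continuous.intervalIntegrable (by fun_prop) _ _),
      ← icm, ← iadd (by fun_prop) (by fun_prop)]
    congr 1; ext y; ring
  rw [e]
  have h8 : |g 1 * ∫ y in (1 - d)..(1 + d), qf t y| ≤ |g 1| * d := by
    rw [abs_mul]; gcongr
  rw [show 1 - (1 - d) = d by ring] at h1
  rw [show (1 + d) - 1 = d by ring] at h1'
  refine (abs_add_three _ _ _).trans ?_
  linarith

lemma pv {L t r E B : ℝ} (hL : 1 < L) (hr : 0 < r) (hr1 : r ≤ 1/2) (ht : 0 < t) {g : ℝ → ℝ}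
    (hg : Continuous g) (hE : ∀ y ∈ Set.Icc (1 - r) L, ∀ z ∈ Set.Icc (1 - r) L,
      |g y - g z| ≤ E * √|y - z|) (hE0 : 0 ≤ E)
    (hg0 : ∀ y, 0 ≤ g y) (hB : g 1 ≤ B) (hgL : g L = 0) :
    ∫ y in (1 - r)..L, qf t y * g y ≤ 8 * E * √r + r * B := by
  have hc := cqf ht
  set d := min (L - 1) r with hd
  have hd0 : 0 ≤ d := le_min (by linarith) hr.le
  have hdr : d ≤ r := min_le_right _ _
  have hdL : d ≤ L - 1 := min_le_left _ _
  have hi : ∀ a b, IntervalIntegrable (fun y => qf t y * g y) volume a b := fun a b =>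
    Continuous.intervalIntegrable ((cqf ht).mul hg) _ _
  have h1 : ∫ y in (1 + d)..L, qf t y * g y ≤ 0 := by
    have : 0 ≤ ∫ y in (1 + d)..L, -(qf t y * g y) := by
      apply intervalIntegral.integral_nonneg (by linarith)
      intro y hy
      have := qf_nonpos ht (y := y) (by nlinarith [hy.1])
      nlinarith [hg0 y]
    rw [intervalIntegral.integral_neg] at this
    linarith
  have h2 := pv_mid ht hd0 (hdr.trans hr1) hg (E := E) (fun y hy => hE y
    ⟨by linarith [hy.1], by linarith [hy.2]⟩ 1 ⟨by linarith, hL.le⟩)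
  have h3 : |∫ y in (1 - r)..(1 - d), qf t y * g y| ≤ 2 * (2 * E) * √((1 - d) - (1 - r)) := by
    apply sing_left (by linarith) (by exact ((cqf ht).mul hg).continuousOn)
    intro y hy
    have hdlt : d < r := by linarith [hy.1, hy.2]
    have hdeq : d = L - 1 := by
      rcases min_choice (L - 1) r with h | h
      · exact h
      · exact absurd (hd.trans h) hdlt.ne
    have h4 := hE y ⟨hy.1, by linarith [hy.2]⟩ L ⟨by linarith, le_rfl⟩
    rw [hgL, sub_zero, abs_sub_comm y L, abs_of_nonneg (by linarith [hy.2] : 0 ≤ L - y)] at h4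
    have h5 := abs_qf_le ht (by linarith [hy.1] : 0 ≤ y)
    rw [abs_sub_comm, abs_of_nonneg (by linarith [hy.2] : 0 ≤ 1 - y)] at h5
    have h6 : √(L - y) ≤ 2 * √(1 - y) := by
      rw [show (2:ℝ) = √4 by rw [show (4:ℝ) = 2 ^ 2 by norm_num, Real.sqrt_sq]; norm_num,
        ← Real.sqrt_mul (by norm_num)]
      apply Real.sqrt_le_sqrt
      linarith [hy.2]
    have h7 : √(1 - d - y) ≤ √(1 - y) := Real.sqrt_le_sqrt (by linarith)
    have h8 : √(1 - y) * √(1 - y) = 1 - y := Real.mul_self_sqrt (by linarith [hy.2])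
    rw [abs_mul]
    calc |qf t y| * |g y| * √(1 - d - y) ≤ |qf t y| * (E * (2 * √(1 - y))) * √(1 - y) := by
          gcongr
          exact h4.trans (by gcongr)
      _ = 2 * E * (|qf t y| * (√(1 - y) * √(1 - y))) := by ring
      _ = 2 * E * (|qf t y| * (1 - y)) := by rw [h8]
      _ ≤ 2 * E * 1 := by gcongr
      _ = 2 * E := mul_one _
  have h4 : √((1 - d) - (1 - r)) ≤ √r := Real.sqrt_le_sqrt (by linarith)
  have h5 : √d ≤ √r := Real.sqrt_le_sqrt hdr
  have e := intervalIntegral.integral_add_adjacent_intervals (hi (1 - r) (1 - d)) (hi (1 - d) (1 + d))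
  have e' := intervalIntegral.integral_add_adjacent_intervals (hi (1 - r) (1 + d)) (hi (1 + d) L)
  rw [← e', ← e]
  rw [abs_of_nonneg (hg0 1)] at h2
  have h6 : g 1 * d ≤ B * r := mul_le_mul hB hdr hd0 ((hg0 1).trans hB)
  have h7 : 4 * E * √d ≤ 4 * E * √r := by gcongr
  have h8 : 2 * (2 * E) * √((1 - d) - (1 - r)) ≤ 2 * (2 * E) * √r := by gcongr
  linarith [le_abs_self (∫ y in (1 - r)..(1 - d), qf t y * g y),
    le_abs_self (∫ y in (1 - d)..(1 + d), qf t y * g y)]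

namespace InvS
variable (S : InvS)

lemma mem0 : -S.L ∈ Set.Icc (-S.L) S.L := ⟨le_rfl, S.LL⟩
lemma memL : S.L ∈ Set.Icc (-S.L) S.L := ⟨S.LL, le_rfl⟩

lemma hold {x y : ℝ} (hx : x ∈ Set.Icc (-S.L) S.L) (hy : y ∈ Set.Icc (-S.L) S.L) :
    (S.φ y - S.φ x) ^ 2 ≤ |y - x| * S.V2 := holder_half S.d1 S.c1 hx hy

lemma sup_phi {y : ℝ} (hy : y ∈ Set.Icc (-S.L) S.L) : S.φ y ^ 2 ≤ S.U / S.κ := by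
  have h := sup_sq S.d1 S.c1 S.bm hy
  refine h.trans ?_
  rw [le_div_iff₀ S.hκ]
  change 2 * (√S.Q2 * √S.V2) * S.κ ≤ _
  have h1 := Real.sq_sqrt S.Q2_nn
  have h2 := Real.sq_sqrt S.V2_nn
  unfold U
  nlinarith [sq_nonneg (S.κ * √S.Q2 - √S.V2)]

lemma abs_hold {y : ℝ} (hy : y ∈ Set.Icc (-S.L) S.L) : S.φ y ^ 2 ≤ (S.L - |y|) * S.V2 := by
  rcases le_total 0 y with h | h
  · have := S.hold hy S.memL (y := S.L)
    rw [S.bp, abs_of_nonneg (by linarith [hy.2])] at this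
    rw [abs_of_nonneg h]; simpa using this
  · have := S.hold S.mem0 hy (x := -S.L)
    rw [S.bm, abs_of_nonneg (by linarith [hy.1])] at this
    rw [abs_of_nonpos h]
    calc _ = (S.φ y - 0) ^ 2 := by ring
      _ ≤ _ := this
      _ = _ := by ring

/-- principal-value bound near the right critical point -/
lemma pv1 {t r B : ℝ} (hL : 1 < S.L) (hr : 0 < r) (hr1 : r ≤ 1/2) (ht : 0 < t) (hB0 : 0 ≤ B)
    (hB : ∀ y ∈ Set.Icc (1 - r) S.L, S.φ y ^ 2 ≤ B) :
    ∫ y in (1 - r)..S.L, qf t y * S.φ y ^ 2 ≤ 16 * √(B * S.V2) * √r + r * B := by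
  have hc := S.cφ
  have := pv hL hr hr1 ht (g := fun y => S.φ y ^ 2) (E := 2 * √(B * S.V2)) (B := B) (hc.pow 2)
    (by
      intro y hy z hz
      have h1 := S.hold (x := z) (y := y) ⟨by linarith [hz.1], hz.2⟩ ⟨by linarith [hy.1], hy.2⟩
      have h2 := Real.abs_le_sqrt (hB y hy)
      have h3 := Real.abs_le_sqrt (hB z hz)
      have h4 := Real.abs_le_sqrt h1
      rw [Real.sqrt_mul (abs_nonneg _)] at h4
      rw [Real.sqrt_mul hB0]
      calc |S.φ y ^ 2 - S.φ z ^ 2| = |S.φ y + S.φ z| * |S.φ y - S.φ z| := by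
            rw [← abs_mul]; congr 1; ring
        _ ≤ (√B + √B) * (√|y - z| * √S.V2) := by
            gcongr
            exact (abs_add_le _ _).trans (add_le_add h2 h3)
        _ = _ := by ring)
    (by positivity) (fun y => sq_nonneg _) (hB 1 ⟨by linarith, hL.le⟩) (by simp [S.bp])
  linarith

/-- both sides -/
lemma pv2 {t r B : ℝ} (hL : 1 < S.L) (hr : 0 < r) (hr1 : r ≤ 1/2) (ht : 0 < t) (hB0 : 0 ≤ B)
    (hB : ∀ y ∈ Set.Icc (-S.L) S.L, 1 - r ≤ |y| → S.φ y ^ 2 ≤ B) :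
    ∫ y in (-S.L)..S.L, qf t y * S.φ y ^ 2 ≤ 32 * √(B * S.V2) * √r + 2 * r * B +
      ∫ y in (-(1 - r))..(1 - r), qf t y * S.φ y ^ 2 := by
  have h1 := S.pv1 hL hr hr1 ht hB0 (fun y hy => hB y ⟨by linarith [hy.1], hy.2⟩
    (hy.1.trans (le_abs_self _)))
  have h2 := S.refl.pv1 (B := B) hL hr hr1 ht hB0 (fun y hy => by
    have hy2 : y ≤ S.L := hy.2
    exact hB (-y) ⟨by linarith [hy.1], by linarith [hy.1]⟩ (by rw [abs_neg]; exact hy.1.trans (le_abs_self _)))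
  rw [refl_V2] at h2
  have e : ∫ y in (1 - r)..S.refl.L, qf t y * S.refl.φ y ^ 2 =
      ∫ y in (-S.L)..(-(1 - r)), qf t y * S.φ y ^ 2 := by
    have := intervalIntegral.integral_comp_neg (a := 1 - r) (b := S.L) (fun y => qf t y * S.φ y ^ 2)
    simp only [qf_neg] at this
    exact this
  rw [e] at h2
  have hc := S.cφ
  have hq := cqf ht
  have hi : ∀ a b, IntervalIntegrable (fun y => qf t y * S.φ y ^ 2) volume a b := fun a b =>
    Continuous.intervalIntegrable (hq.mul (hc.pow 2)) _ _
  have e1 := intervalIntegral.integral_add_adjacent_intervals (hi (-S.L) (-(1 - r))) (hi (-(1 - r)) (1 - r))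
  have e2 := intervalIntegral.integral_add_adjacent_intervals (hi (-S.L) (1 - r)) (hi (1 - r) S.L)
  linarith

lemma M_phi (t : ℝ) : S.M t S.φ S.φ1 = S.U - 2 * ∫ y in (-S.L)..S.L, qf t y * S.φ y ^ 2 := by
  simp only [M, U, V2, Q2, sq]

lemma regR {t : ℝ} (ht : 0 < t) (ht1 : t ≤ 1) (hG : S.G2 ≤ t ^ 2 * S.N2) (hL : 1 < S.L)
    (hκ : 200 ≤ S.κ) : S.U ≤ 640 * (t * S.N2) := by
  have hU := S.U_nn
  have hκ0 := S.hκ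
  have hB0 : 0 ≤ S.U / S.κ := by positivity
  have hc := S.cφ
  have hq := cqf ht
  have hT := S.Tf ht ht1 hG S.d1 S.c1 S.bm S.bp hB0 hU (fun y hy => by
    have := S.sup_phi hy
    have : 0 ≤ 2 * |(|y| - 1)| * S.U := by positivity
    linarith)
  have hr : 0 < 1 / S.κ := by positivity
  have hr1 : 1 / S.κ ≤ 1 / 2 := by
    apply one_div_le_one_div_of_le <;> linarith
  have hp := S.pv2 hL hr hr1 ht hB0 (fun y hy _ => S.sup_phi hy)
  have h1 : √(S.U / S.κ * S.V2) * √(1 / S.κ) ≤ S.U / S.κ := by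
    rw [← Real.sqrt_mul (by have := S.V2_nn; positivity)]
    apply Real.sqrt_le_iff.2 ⟨hB0, _⟩
    have : S.U / S.κ * S.V2 * (1 / S.κ) = S.U * S.V2 * (1 / S.κ) ^ 2 := by ring
    rw [this, show (S.U / S.κ) ^ 2 = S.U * S.U * (1 / S.κ) ^ 2 by ring]
    have := S.V2_le
    gcongr
  have h2 : 1 / S.κ * (S.U / S.κ) ≤ 1 * (S.U / S.κ) := by gcongr; linarith
  have h3 : ∫ y in (-(1 - 1 / S.κ))..(1 - 1 / S.κ), qf t y * S.φ y ^ 2 ≤ S.κ * S.Q2 := by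
    have k1 : ∫ y in (-(1 - 1 / S.κ))..(1 - 1 / S.κ), qf t y * S.φ y ^ 2 ≤
        ∫ y in (-(1 - 1 / S.κ))..(1 - 1 / S.κ), S.κ * S.φ y ^ 2 := by
      apply imono (by linarith) (by fun_prop) (by fun_prop)
      intro y hy
      apply mul_le_mul_of_nonneg_right _ (sq_nonneg _)
      have hy1 : |y| ≤ 1 - 1 / S.κ := abs_le.2 hy
      have hW : 1 / S.κ ≤ 1 - y ^ 2 := by
        rw [← sq_abs]; nlinarith [abs_nonneg y]
      have hW0 : 0 < 1 - y ^ 2 := by linarith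
      unfold qf
      rw [div_le_iff₀ (Wt_pos ht y)]
      rw [div_le_iff₀ hκ0] at hW
      nlinarith [mul_pos hκ0 (sq_pos_of_pos ht), mul_le_mul_of_nonneg_left hW hW0.le]
    rw [icm] at k1
    refine k1.trans (mul_le_mul_of_nonneg_left ?_ hκ0.le)
    exact sub_int_le (by linarith) (by linarith) (by linarith) (f := fun y => S.φ y ^ 2)
      (by fun_prop) (fun y _ => sq_nonneg _)
  have h4 : S.κ * S.Q2 ≤ S.U / S.κ := by
    rw [le_div_iff₀ hκ0]; nlinarith [S.Q2_le]
  have h5 : S.U / S.κ ≤ S.U / 200 := by gcongr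
  have h6 : S.U / 2 ≤ S.M t S.φ S.φ1 := by
    rw [M_phi]; linarith
  have h7 : (S.U / 2) ^ 2 ≤ 80 * (t * S.N2) * (S.U / S.κ + S.U) :=
    (pow_le_pow_left₀ (by positivity) h6 2).trans hT
  have hN := S.N2_nn
  have h8 : 80 * (t * S.N2) * (S.U / S.κ + S.U) ≤ 80 * (t * S.N2) * (2 * S.U) := by
    gcongr; linarith
  rcases hU.eq_or_lt with h | h
  · rw [← h]; positivity
  · have h9 : S.U * S.U ≤ 640 * (t * S.N2) * S.U := by nlinarith
    exact le_of_mul_le_mul_right h9 h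

/-- Hardy inequality -/
lemma hardy {z : ℝ} (hz : S.L ^ 2 < z) :
    2 * ∫ y in (-S.L)..S.L, (1 / max (z - y ^ 2) (z - S.L ^ 2)) * S.φ y ^ 2 ≤ 8 / 9 * S.U := by
  set e := z - S.L ^ 2 with he
  have he0 : 0 < e := by linarith
  have hL := S.hL
  have hZ : ∀ y ∈ Set.Icc (-S.L) S.L, e ≤ z - y ^ 2 := fun y hy => by
    have := abs_le.2 hy
    have : y ^ 2 ≤ S.L ^ 2 := sq_le_sq.2 (by rwa [abs_of_pos hL])
    linarith
  have hZ0 : ∀ y ∈ Set.Icc (-S.L) S.L, z - y ^ 2 ≠ 0 := fun y hy => by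
    have := hZ y hy; linarith
  have hc := S.cφ
  have hc1 := S.c1
  have e0 : ∫ y in (-S.L)..S.L, (1 / max (z - y ^ 2) e) * S.φ y ^ 2 =
      ∫ y in (-S.L)..S.L, (1 / (z - y ^ 2)) * S.φ y ^ 2 := by
    apply intervalIntegral.integral_congr
    intro y hy
    rw [Set.uIcc_of_le S.LL] at hy
    simp only [max_eq_left (hZ y hy)]
  rw [e0]
  have hcd : ContinuousOn (fun y => (3 * (y / (z - y ^ 2)) * (S.φ y * S.φ1 y) +
      3 / 2 * ((1 / (z - y ^ 2) + 2 * y ^ 2 / (z - y ^ 2) ^ 2) * S.φ y ^ 2))) (Set.Icc (-S.L) S.L) := by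
    have : ∀ y ∈ Set.Icc (-S.L) S.L, (z - y ^ 2) ^ 2 ≠ 0 := fun y hy => pow_ne_zero 2 (hZ0 y hy)
    have hzc : Continuous fun y : ℝ => z - y ^ 2 := continuous_const.sub (continuous_id.pow 2)
    have hzo := hzc.continuousOn (s := Set.Icc (-S.L) S.L)
    have g1 : ContinuousOn (fun y => y / (z - y ^ 2)) (Set.Icc (-S.L) S.L) := continuousOn_id.div hzo hZ0
    have g2 : ContinuousOn (fun y => 1 / (z - y ^ 2)) (Set.Icc (-S.L) S.L) := continuousOn_const.div hzo hZ0
    have g3 : ContinuousOn (fun y => 2 * y ^ 2 / (z - y ^ 2) ^ 2) (Set.Icc (-S.L) S.L) :=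
      (continuousOn_const.mul (continuousOn_id.pow 2)).div (hzo.pow 2) this
    exact ((continuousOn_const.mul g1).mul (hc.mul hc1).continuousOn).add
      (continuousOn_const.mul ((g2.add g3).mul (hc.pow 2).continuousOn))
  have h1 : ∫ y in (-S.L)..S.L, (3 * (y / (z - y ^ 2)) * (S.φ y * S.φ1 y) +
      3 / 2 * ((1 / (z - y ^ 2) + 2 * y ^ 2 / (z - y ^ 2) ^ 2) * S.φ y ^ 2)) = 0 := by
    rw [intervalIntegral.integral_eq_sub_of_hasDerivAt (f := fun y => 3 / 2 * (y / (z - y ^ 2) * S.φ y ^ 2))]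
    · simp [S.bp, S.bm]
    · intro y hy
      rw [Set.uIcc_of_le S.LL] at hy
      have hy0 := hZ0 y hy
      have d1 : HasDerivAt (fun y => z - y ^ 2) (-(2 * y)) y := by
        simpa using (hasDerivAt_pow 2 y).const_sub z
      have d2 := (hasDerivAt_id y).fun_div d1 hy0
      have d3 := ((d2.fun_mul ((S.d1 y).fun_pow 2)).const_mul (3 / 2 : ℝ))
      refine d3.congr_deriv ?_
      norm_num
      field_simp
      ring
    · exact hcd.intervalIntegrable_of_Icc S.LL
  have h2 : ∫ y in (-S.L)..S.L, (9 / 4 * ((1 / (z - y ^ 2)) * S.φ y ^ 2)) ≤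
      ∫ y in (-S.L)..S.L, ((S.φ1 y ^ 2 + 3 / 4 * (1 / z) * S.φ y ^ 2) +
        (3 * (y / (z - y ^ 2)) * (S.φ y * S.φ1 y) +
      3 / 2 * ((1 / (z - y ^ 2) + 2 * y ^ 2 / (z - y ^ 2) ^ 2) * S.φ y ^ 2))) := by
    apply intervalIntegral.integral_mono_on S.LL
    · exact ContinuousOn.intervalIntegrable_of_Icc S.LL (continuousOn_const.mul
        ((continuousOn_const.div (continuous_const.sub (continuous_id.pow 2)).continuousOn hZ0).mul (hc.pow 2).continuousOn))
    · apply ContinuousOn.intervalIntegrable_of_Icc S.LL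
      exact ContinuousOn.add (by fun_prop) hcd
    · intro y hy
      have hy0 : 0 < z - y ^ 2 := lt_of_lt_of_le he0 (hZ y hy)
      have hz0 : 0 < z := by nlinarith
      have key : S.φ1 y ^ 2 + 3 / 4 * (1 / z) * S.φ y ^ 2 +
        (3 * (y / (z - y ^ 2)) * (S.φ y * S.φ1 y) +
        3 / 2 * ((1 / (z - y ^ 2) + 2 * y ^ 2 / (z - y ^ 2) ^ 2) * S.φ y ^ 2)) -
        9 / 4 * ((1 / (z - y ^ 2)) * S.φ y ^ 2) =
        (S.φ1 y + 3 / 2 * (y / (z - y ^ 2)) * S.φ y) ^ 2 +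
          3 / 4 * (y ^ 4 / (z * (z - y ^ 2) ^ 2)) * S.φ y ^ 2 := by
        field_simp
        ring
      have : 0 ≤ (S.φ1 y + 3 / 2 * (y / (z - y ^ 2)) * S.φ y) ^ 2 +
          3 / 4 * (y ^ 4 / (z * (z - y ^ 2) ^ 2)) * S.φ y ^ 2 := by positivity
      linarith
  rw [intervalIntegral.integral_add (Continuous.intervalIntegrable (by fun_prop) _ _)
    (hcd.intervalIntegrable_of_Icc S.LL), h1, iadd (by fun_prop) (by fun_prop), icm, icm] at h2
  change _ ≤ S.V2 + 3 / 4 * (1 / z) * S.Q2 + 0 at h2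
  have h3 : 1 / z ≤ S.κ ^ 2 := by
    rw [div_le_iff₀ (by nlinarith)]
    have h4 := S.hκL
    have : 1 ≤ S.κ ^ 2 * S.L ^ 2 := by nlinarith
    nlinarith [sq_pos_of_pos S.hκ]
  have h4 := mul_le_mul_of_nonneg_right h3 S.Q2_nn
  have h5 : 0 ≤ S.κ ^ 2 * S.Q2 := by have := S.Q2_nn; positivity
  unfold U
  linarith

lemma regR3a {t : ℝ} (ht : 0 < t) (ht1 : t ≤ 1) (hG : S.G2 ≤ t ^ 2 * S.N2) (hL : S.L ≤ 1) :
    S.U ≤ 6480 * (t * S.N2) := by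
  have hU := S.U_nn
  have hc := S.cφ
  have hq := cqf ht
  have hL0 := S.hL
  have hT := S.Tf ht ht1 hG S.d1 S.c1 S.bm S.bp le_rfl hU (fun y hy => by
    have h1 := S.abs_hold hy
    have h2 : S.L - |y| ≤ |(|y| - 1)| := by
      rw [abs_sub_comm]; exact le_trans (by linarith) (le_abs_self _)
    have h3 := mul_le_mul h2 S.V2_le S.V2_nn (abs_nonneg _)
    have h4 : 0 ≤ |(|y| - 1)| * S.U := by positivity
    linarith)
  have hz : S.L ^ 2 < 1 + t ^ 2 := by nlinarith
  have hH := S.hardy hz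
  have h1 : ∫ y in (-S.L)..S.L, qf t y * S.φ y ^ 2 ≤
      ∫ y in (-S.L)..S.L, (1 / max (1 + t ^ 2 - y ^ 2) (1 + t ^ 2 - S.L ^ 2)) * S.φ y ^ 2 := by
    apply imono S.LL (by fun_prop)
    · apply Continuous.mul _ (by fun_prop)
      apply Continuous.div continuous_const (by fun_prop)
      intro y
      exact (lt_of_lt_of_le (by linarith) (le_max_right _ _)).ne'
    intro y hy
    apply mul_le_mul_of_nonneg_right _ (sq_nonneg _)
    have h2 : y ^ 2 ≤ S.L ^ 2 := sq_le_sq.2 (by rw [abs_of_pos hL0]; exact abs_le.2 hy)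
    rw [max_eq_left (by linarith)]
    have h3 : 0 ≤ 1 - y ^ 2 := by nlinarith
    unfold qf
    rw [div_le_div_iff₀ (Wt_pos ht y) (by linarith)]
    nlinarith [sq_nonneg (t * y)]
  have h6 : S.U / 9 ≤ S.M t S.φ S.φ1 := by
    rw [M_phi]; linarith
  have h7 : (S.U / 9) ^ 2 ≤ 80 * (t * S.N2) * (0 + S.U) :=
    (pow_le_pow_left₀ (by positivity) h6 2).trans hT
  have hN := S.N2_nn
  rcases hU.eq_or_lt with h | h
  · rw [← h]; positivity
  · have h9 : S.U * S.U ≤ 6480 * (t * S.N2) * S.U := by nlinarith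
    exact le_of_mul_le_mul_right h9 h

lemma regR3b {t : ℝ} (ht : 0 < t) (ht1 : t ≤ 1) (hG : S.G2 ≤ t ^ 2 * S.N2) (hL : 1 < S.L)
    (hL1 : S.L ≤ 1 + 1 / 1600000) :
    S.U ≤ 64000 * (t * S.N2) := by
  have hU := S.U_nn
  have hc := S.cφ
  have hq := cqf ht
  have hL0 := S.hL
  have hVU := S.V2_le
  have hV := S.V2_nn
  have hT := S.Tf ht ht1 hG S.d1 S.c1 S.bm S.bp hU hU (fun y hy => by
    have h1 := S.abs_hold hy
    have h2 : S.L - |y| ≤ 1 + |(|y| - 1)| := by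
      rw [abs_sub_comm]; linarith [le_abs_self (1 - |y|)]
    have h3 := mul_le_mul h2 S.V2_le S.V2_nn (by positivity)
    have h4 : 0 ≤ |(|y| - 1)| * S.U := by positivity
    linarith)
  have hB : ∀ y ∈ Set.Icc (-S.L) S.L, 1 - 1 / 2000 ≤ |y| → S.φ y ^ 2 ≤ 1 / 1000 * S.U := by
    intro y hy h
    have h1 := S.abs_hold hy
    have h2 : S.L - |y| ≤ 1 / 1000 := by linarith
    exact h1.trans (mul_le_mul h2 hVU hV (by norm_num))
  have hp := S.pv2 (r := 1 / 2000) hL (by norm_num) (by norm_num) ht (by positivity) hB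
  have h1 : √(1 / 1000 * S.U * S.V2) * √(1 / 2000) ≤ 1 / 1400 * S.U := by
    rw [← Real.sqrt_mul (by positivity)]
    apply Real.sqrt_le_iff.2 ⟨by positivity, _⟩
    have : S.U * S.V2 ≤ S.U * S.U := by gcongr
    nlinarith
  have hz : S.L ^ 2 < S.L ^ 2 + 1 / 1600000 := by linarith
  have hH := S.hardy hz
  have hcm : Continuous fun y => (1 / max (S.L ^ 2 + 1 / 1600000 - y ^ 2)
      (S.L ^ 2 + 1 / 1600000 - S.L ^ 2)) * S.φ y ^ 2 := by
    apply Continuous.mul _ (by fun_prop)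
    apply Continuous.div continuous_const (by fun_prop)
    intro y
    exact (lt_of_lt_of_le (by linarith) (le_max_right _ _)).ne'
  have h2 : ∫ y in (-(1 - 1 / 2000 : ℝ))..(1 - 1 / 2000), qf t y * S.φ y ^ 2 ≤
      ∫ y in (-(1 - 1 / 2000 : ℝ))..(1 - 1 / 2000), (1 + 1 / 200) * ((1 / max (S.L ^ 2 + 1 / 1600000 - y ^ 2)
      (S.L ^ 2 + 1 / 1600000 - S.L ^ 2)) * S.φ y ^ 2) := by
    apply imono (by norm_num) (by fun_prop) (continuous_const.mul hcm)
    intro y hy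
    change _ ≤ (1 + 1 / 200) * ((1 / max (S.L ^ 2 + 1 / 1600000 - y ^ 2)
      (S.L ^ 2 + 1 / 1600000 - S.L ^ 2)) * S.φ y ^ 2)
    rw [← mul_assoc]
    apply mul_le_mul_of_nonneg_right _ (sq_nonneg _)
    have hy1 : |y| ≤ 1 - 1 / 2000 := abs_le.2 hy
    have h3 : 1 / 2000 ≤ 1 - y ^ 2 := by
      rw [← sq_abs]; nlinarith [abs_nonneg y]
    rw [max_eq_left (by nlinarith)]
    unfold qf
    rw [mul_one_div, div_le_div_iff₀ (Wt_pos ht y) (by nlinarith)]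
    have h4 : S.L ^ 2 + 1 / 1600000 - y ^ 2 ≤ (1 + 1 / 200) * (1 - y ^ 2) := by nlinarith
    have h5 : 0 ≤ 1 - y ^ 2 := by linarith
    nlinarith [mul_le_mul_of_nonneg_left h4 h5, sq_nonneg t]
  rw [icm] at h2
  have h3 := sub_int_le (a := -S.L) (b := S.L) (c := -(1 - 1 / 2000 : ℝ)) (d := 1 - 1 / 2000) (by linarith)
    (by norm_num) (by linarith) hcm.continuousOn (by
      intro y hy
      have : 0 < max (S.L ^ 2 + 1 / 1600000 - y ^ 2) (S.L ^ 2 + 1 / 1600000 - S.L ^ 2) :=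
        lt_of_lt_of_le (by linarith) (le_max_right _ _)
      positivity)
  have h6 : S.U / 20 ≤ S.M t S.φ S.φ1 := by
    rw [M_phi]; linarith
  have h7 : (S.U / 20) ^ 2 ≤ 80 * (t * S.N2) * (S.U + S.U) :=
    (pow_le_pow_left₀ (by positivity) h6 2).trans hT
  have hN := S.N2_nn
  rcases hU.eq_or_lt with h | h
  · rw [← h]; positivity
  · have h9 : S.U * S.U ≤ 64000 * (t * S.N2) * S.U := by nlinarith
    exact le_of_mul_le_mul_right h9 h

end InvS



lemma sing_half {L K : ℝ} (hL : 1 ≤ L) {h : ℝ → ℝ} (hc : ContinuousOn h (Set.Icc 0 L))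
    (hK : 0 ≤ K) (hb : ∀ y ∈ Set.Icc 0 L, |h y| * √|y - 1| ≤ K)
    (h0 : ∀ y ∈ Set.Icc 0 L, 2 ≤ y → h y = 0) : |∫ y in (0:ℝ)..L, h y| ≤ 4 * K := by
  set m := min L 2 with hm
  have hm1 : 1 ≤ m := le_min hL (by norm_num)
  have hm2 : m ≤ 2 := min_le_right _ _
  have hmL : m ≤ L := min_le_left _ _
  have i1 : IntervalIntegrable h volume 0 1 :=
    (hc.mono (Set.Icc_subset_Icc le_rfl hL)).intervalIntegrable_of_Icc (by norm_num)
  have i2 : IntervalIntegrable h volume 1 m :=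
    (hc.mono (Set.Icc_subset_Icc (by norm_num) hmL)).intervalIntegrable_of_Icc hm1
  have i3 : IntervalIntegrable h volume m L :=
    (hc.mono (Set.Icc_subset_Icc (by linarith) le_rfl)).intervalIntegrable_of_Icc hmL
  have h1 : |∫ y in (0:ℝ)..1, h y| ≤ 2 * K * √(1 - 0) := by
    apply sing_left (by norm_num) (hc.mono (Set.Icc_subset_Icc le_rfl hL))
    intro y hy
    have := hb y ⟨hy.1, by linarith [hy.2]⟩
    rwa [abs_sub_comm, abs_of_nonneg (by linarith [hy.2] : 0 ≤ 1 - y)] at this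
  have h2 : |∫ y in (1:ℝ)..m, h y| ≤ 2 * K * √(m - 1) := by
    apply sing_right hm1 (hc.mono (Set.Icc_subset_Icc (by norm_num) hmL))
    intro y hy
    have := hb y ⟨by linarith [hy.1], by linarith [hy.2]⟩
    rwa [abs_of_nonneg (by linarith [hy.1] : 0 ≤ y - 1)] at this
  have h3 : ∫ y in m..L, h y = 0 := by
    rcases le_total L 2 with hl | hl
    · rw [hm, min_eq_left hl]; simp
    · have : ∫ y in m..L, h y = ∫ y in m..L, (0:ℝ) := by
        apply intervalIntegral.integral_congr
        intro y hy
        rw [Set.uIcc_of_le hmL, hm, min_eq_right hl] at hy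
        exact h0 y ⟨by linarith [hy.1], hy.2⟩ hy.1
      rw [this]; simp
  have e1 := intervalIntegral.integral_add_adjacent_intervals i1 i2
  have e2 := intervalIntegral.integral_add_adjacent_intervals (i1.trans i2) i3
  rw [← e2, ← e1, h3, add_zero]
  have h4 : √(m - 1) ≤ 1 := Real.sqrt_le_one.2 (by linarith)
  have h5 : 2 * K * √(m - 1) ≤ 2 * K * 1 := by gcongr
  simp only [sub_zero, Real.sqrt_one] at h1
  refine (abs_add_le _ _).trans (by linarith)

lemma sing_all {L K : ℝ} (hL : 1 ≤ L) {h : ℝ → ℝ} (hc : ContinuousOn h (Set.Icc (-L) L))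
    (hK : 0 ≤ K) (hb : ∀ y ∈ Set.Icc (-L) L, |h y| * √|(|y| - 1)| ≤ K)
    (h0 : ∀ y ∈ Set.Icc (-L) L, 2 ≤ |y| → h y = 0) : |∫ y in (-L)..L, h y| ≤ 8 * K := by
  have h1 := sing_half hL (hc.mono (Set.Icc_subset_Icc (by linarith) le_rfl)) hK
    (fun y hy => by
      have := hb y ⟨by linarith [hy.1], hy.2⟩
      rwa [abs_of_nonneg hy.1] at this)
    (fun y hy h2 => h0 y ⟨by linarith [hy.1], hy.2⟩ (h2.trans (le_abs_self _)))
  have h2 := sing_half hL (h := fun y => h (-y)) (hc.comp continuousOn_neg (by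
      intro y hy; exact ⟨by linarith [hy.2], by linarith [hy.1]⟩)) hK
    (fun y hy => by
      have := hb (-y) ⟨by linarith [hy.2], by linarith [hy.1]⟩
      rwa [abs_neg, abs_of_nonneg hy.1] at this)
    (fun y hy h2 => h0 (-y) ⟨by linarith [hy.2], by linarith [hy.1]⟩
      (by rw [abs_neg]; exact h2.trans (le_abs_self _)))
  rw [intervalIntegral.integral_comp_neg, neg_zero] at h2
  have e := intervalIntegral.integral_add_adjacent_intervals
    ((hc.mono (Set.Icc_subset_Icc le_rfl (by linarith))).intervalIntegrable_of_Icc (μ := volume)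
      (by linarith : -L ≤ 0))
    ((hc.mono (Set.Icc_subset_Icc (by linarith) le_rfl)).intervalIntegrable_of_Icc (μ := volume)
      (by linarith : 0 ≤ L))
  rw [← e]
  refine (abs_add_le _ _).trans (by linarith)

lemma pv_half {L d t E : ℝ} (hd : 0 < d) (hd1 : d ≤ 1/2) (hL : 1 + d ≤ L) (ht : 0 < t)
    {g : ℝ → ℝ} (hg : Continuous g)
    (hlip : ∀ y z, |g y - g z| ≤ E * |y - z|) (hb : ∀ y, |g y| ≤ E)
    (h0 : ∀ y, 1 + d ≤ y → g y = 0) : |∫ y in (0:ℝ)..L, qf t y * g y| ≤ (E / d) + 5 * E := by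
  have hq := cqf ht
  have hE0 : 0 ≤ E := (abs_nonneg _).trans (hb 0)
  have h1 : |∫ y in (0:ℝ)..(1 - d), qf t y * g y| ≤ E / d := by
    have := intervalIntegral.norm_integral_le_of_norm_le_const (a := 0) (b := 1 - d) (C := E / d)
      (f := fun y => qf t y * g y) (by
      intro y hy
      rw [Set.uIoc_of_le (by linarith)] at hy
      have h2 := abs_qf_le ht hy.1.le
      have h3 : d ≤ |y - 1| := by
        rw [abs_sub_comm]; exact le_trans (by linarith [hy.2]) (le_abs_self _)
      rw [Real.norm_eq_abs, abs_mul, le_div_iff₀ hd]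
      have h4 : |qf t y| * d ≤ 1 := le_trans (by gcongr) h2
      calc |qf t y| * |g y| * d = (|qf t y| * d) * |g y| := by ring
        _ ≤ 1 * E := by gcongr; exact hb y
        _ = E := one_mul _)
    rw [Real.norm_eq_abs, sub_zero, abs_of_nonneg (by linarith : 0 ≤ 1 - d)] at this
    refine this.trans ?_
    have : 0 ≤ E / d := by positivity
    nlinarith
  have h2 := pv_mid ht hd.le hd1 hg (E := E) (fun y hy => by
    refine (hlip y 1).trans ?_
    gcongr
    apply Real.le_sqrt_of_sq_le
    have : |y - 1| ≤ 1 := abs_le.2 ⟨by linarith [hy.1], by linarith [hy.2]⟩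
    nlinarith [abs_nonneg (y - 1)])
  have h3 : ∫ y in (1 + d)..L, qf t y * g y = 0 := by
    have : ∫ y in (1 + d)..L, qf t y * g y = ∫ y in (1 + d)..L, (0:ℝ) := by
      apply intervalIntegral.integral_congr
      intro y hy
      rw [Set.uIcc_of_le hL] at hy
      simp [h0 y hy.1]
    rw [this]; simp
  have hi : ∀ a b, IntervalIntegrable (fun y => qf t y * g y) volume a b := fun a b =>
    Continuous.intervalIntegrable (by fun_prop) _ _
  have e := intervalIntegral.integral_add_adjacent_intervals (hi 0 (1 - d)) (hi (1 - d) (1 + d))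
  have e' := intervalIntegral.integral_add_adjacent_intervals (hi 0 (1 + d)) (hi (1 + d) L)
  rw [← e', ← e, h3, add_zero]
  have h4 : √d ≤ 1 := Real.sqrt_le_one.2 (by linarith)
  have h5 : 4 * E * √d ≤ 4 * E * 1 := by gcongr
  have h6 : |g 1| * d ≤ E * 1 := mul_le_mul (hb 1) (by linarith) hd.le hE0
  refine (abs_add_le _ _).trans (by linarith)

lemma pv_all {L d t E : ℝ} (hd : 0 < d) (hd1 : d ≤ 1/2) (hL : 1 + d ≤ L) (ht : 0 < t)
    {g : ℝ → ℝ} (hg : Continuous g)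
    (hlip : ∀ y z, |g y - g z| ≤ E * |y - z|) (hb : ∀ y, |g y| ≤ E)
    (h0 : ∀ y, 1 + d ≤ |y| → g y = 0) :
    |∫ y in (-L)..L, qf t y * g y| ≤ 2 * ((E / d) + 5 * E) := by
  have hq := cqf ht
  have h1 := pv_half hd hd1 hL ht hg hlip hb (fun y hy => h0 y (hy.trans (le_abs_self _)))
  have h2 := pv_half hd hd1 hL ht (g := fun y => g (-y)) (by fun_prop)
    (fun y z => by
      refine (hlip (-y) (-z)).trans (le_of_eq ?_)
      rw [show -y - -z = -(y - z) by ring, abs_neg])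
    (fun y => hb (-y)) (fun y hy => h0 (-y) (by rw [abs_neg]; exact hy.trans (le_abs_self _)))
  have e2 := intervalIntegral.integral_comp_neg (a := 0) (b := L) (fun y => qf t y * g y)
  simp only [qf_neg, neg_zero] at e2
  rw [e2] at h2
  have hi : ∀ a b, IntervalIntegrable (fun y => qf t y * g y) volume a b := fun a b =>
    Continuous.intervalIntegrable (by fun_prop) _ _
  have e := intervalIntegral.integral_add_adjacent_intervals (hi (-L) 0) (hi 0 L)
  rw [← e]
  refine (abs_add_le _ _).trans (by linarith)

lemma We_pos {t y : ℝ} (ht : 0 < t) (hy : y ∈ Set.Icc (-1:ℝ) 1) : 0 < 1 + t ^ 2 - y ^ 2 := by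
  have : 0 < t ^ 2 := by positivity
  nlinarith [hy.1, hy.2]

lemma We_ne {t : ℝ} (ht : 0 < t) : ∀ y ∈ Set.Icc (-1:ℝ) 1, 1 + t ^ 2 - y ^ 2 ≠ 0 :=
  fun _ hy => (We_pos ht hy).ne'

lemma psi_half {t : ℝ} (ht : 0 < t) {p p1 : ℝ → ℝ} (hp : ∀ y, HasDerivAt p (p1 y) y)
    (hc1 : Continuous p1) {y : ℝ} (hy : y ∈ Set.Icc (0:ℝ) 1) :
    (1 - y + t ^ 2) * (p y / (1 + t ^ 2 - y ^ 2) - p 0 / (1 + t ^ 2)) ^ 2 ≤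
      ∫ z in (0:ℝ)..1, (p1 z + 2 * z * p z / (1 + t ^ 2 - z ^ 2)) ^ 2 := by
  have hcp : Continuous p := continuous_iff_continuousAt.2 fun y => (hp y).continuousAt
  have ht2 : 0 < t ^ 2 := by positivity
  have hne : ∀ z ∈ Set.Icc (0:ℝ) 1, 1 + t ^ 2 - z ^ 2 ≠ 0 := fun z hz =>
    We_ne ht z ⟨by linarith [hz.1], hz.2⟩
  have hne' : ∀ z ∈ Set.Icc (0:ℝ) y, 1 + t ^ 2 - z ^ 2 ≠ 0 := fun z hz =>
    hne z ⟨hz.1, hz.2.trans hy.2⟩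
  have hH : ContinuousOn (fun z => p1 z + 2 * z * p z / (1 + t ^ 2 - z ^ 2)) (Set.Icc 0 1) := by
    fun_prop (disch := assumption)
  have hH' := hH.mono (Set.Icc_subset_Icc_right hy.2)
  have hI : ContinuousOn (fun z : ℝ => 1 / (1 + t ^ 2 - z ^ 2)) (Set.Icc 0 y) := by
    fun_prop (disch := assumption)
  have e1 : ∫ z in (0:ℝ)..y, (1 / (1 + t ^ 2 - z ^ 2)) * (p1 z + 2 * z * p z / (1 + t ^ 2 - z ^ 2)) =
      p y / (1 + t ^ 2 - y ^ 2) - p 0 / (1 + t ^ 2) := by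
    rw [intervalIntegral.integral_eq_sub_of_hasDerivAt (f := fun z => p z / (1 + t ^ 2 - z ^ 2))]
    · simp
    · intro z hz
      rw [Set.uIcc_of_le hy.1] at hz
      have d1 : HasDerivAt (fun y => 1 + t ^ 2 - y ^ 2) (-(2 * z)) z := by
        simpa using (hasDerivAt_pow 2 z).const_sub (1 + t ^ 2)
      have := hne' z hz
      refine ((hp z).fun_div d1 this).congr_deriv ?_
      field_simp
      ring
    · exact (hI.mul hH').intervalIntegrable_of_Icc hy.1
  have h2 := cs_int hy.1 hI hH'
  rw [e1] at h2
  have h3 := sub_int_le le_rfl hy.1 hy.2 (f := fun z => (p1 z + 2 * z * p z / (1 + t ^ 2 - z ^ 2)) ^ 2)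
    (hH.pow 2) (fun z _ => sq_nonneg _)
  have hpos : 0 < 1 - y + t ^ 2 := by linarith [hy.2]
  have h4 : ∫ z in (0:ℝ)..y, (1 / (1 + t ^ 2 - z ^ 2)) ^ 2 ≤ 1 / (1 - y + t ^ 2) := by
    have hne2 : ∀ z ∈ Set.Icc (0:ℝ) y, 1 - z + t ^ 2 ≠ 0 := fun z hz => by linarith [hz.2, hy.2]
    have hI2 : ContinuousOn (fun z : ℝ => (1 / (1 - z + t ^ 2)) ^ 2) (Set.Icc 0 y) := by
      fun_prop (disch := assumption)
    have k1 : ∫ z in (0:ℝ)..y, (1 / (1 + t ^ 2 - z ^ 2)) ^ 2 ≤ ∫ z in (0:ℝ)..y, (1 / (1 - z + t ^ 2)) ^ 2 := by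
      apply intervalIntegral.integral_mono_on hy.1 ((hI.pow 2).intervalIntegrable_of_Icc hy.1)
        (hI2.intervalIntegrable_of_Icc hy.1)
      intro z hz
      have : 0 < 1 - z + t ^ 2 := by linarith [hz.2, hy.2]
      apply pow_le_pow_left₀
      · have : 0 < 1 + t ^ 2 - z ^ 2 := by nlinarith [hz.1, hz.2, hy.2]
        positivity
      · apply one_div_le_one_div_of_le this
        nlinarith [hz.1, hz.2, hy.2]
    have k2 : ∫ z in (0:ℝ)..y, (1 / (1 - z + t ^ 2)) ^ 2 = 1 / (1 - y + t ^ 2) - 1 / (1 - 0 + t ^ 2) := by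
      rw [intervalIntegral.integral_eq_sub_of_hasDerivAt (f := fun z => 1 / (1 - z + t ^ 2))]
      · intro z hz
        rw [Set.uIcc_of_le hy.1] at hz
        have d1 : HasDerivAt (fun y => 1 - y + t ^ 2) (-1) z := by
          simpa using ((hasDerivAt_id z).const_sub 1).add_const (t ^ 2)
        have := hne2 z hz
        refine ((hasDerivAt_const z (1:ℝ)).fun_div d1 this).congr_deriv ?_
        field_simp
        ring
      · exact hI2.intervalIntegrable_of_Icc hy.1
    have : 0 ≤ 1 / (1 - 0 + t ^ 2) := by positivity
    linarith
  have h5 : (p y / (1 + t ^ 2 - y ^ 2) - p 0 / (1 + t ^ 2)) ^ 2 ≤ 1 / (1 - y + t ^ 2) *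
      ∫ z in (0:ℝ)..1, (p1 z + 2 * z * p z / (1 + t ^ 2 - z ^ 2)) ^ 2 := by
    have a1 := sq_int_nonneg hy.1 (fun z => 1 / (1 + t ^ 2 - z ^ 2))
    have a2 := sq_int_nonneg hy.1 (fun z => p1 z + 2 * z * p z / (1 + t ^ 2 - z ^ 2))
    rw [← sq_abs]
    calc _ ≤ _ := pow_le_pow_left₀ (abs_nonneg _) h2 2
      _ = _ := by rw [mul_pow, Real.sq_sqrt a1, Real.sq_sqrt a2]
      _ ≤ _ := mul_le_mul h4 h3 a2 (by positivity)
  calc _ ≤ (1 - y + t ^ 2) * _ := mul_le_mul_of_nonneg_left h5 hpos.le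
    _ = _ := by field_simp

lemma psi_low {t : ℝ} (ht : 0 < t) (ht1 : t ≤ 1/2) :
    1 / 2 ≤ ∫ y in (-1:ℝ)..1, qf t y * (1 + t ^ 2 - y ^ 2) := by
  have hq := cqf ht
  have h6 := sub_int_le (a := -1) (b := 1) (c := -1/2) (d := 1/2) (by norm_num) (by norm_num) (by norm_num)
      (f := fun y => qf t y * (1 + t ^ 2 - y ^ 2)) (by fun_prop) (fun y hy => by
        have hW := We_pos ht hy
        have h1 : y ^ 2 ≤ 1 := by nlinarith [hy.1, hy.2]
        exact mul_nonneg (qf_nonneg ht h1) hW.le)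
  have h7 : ∫ y in (-1/2:ℝ)..(1/2), (1/2 : ℝ) ≤ ∫ y in (-1/2:ℝ)..(1/2), qf t y * (1 + t ^ 2 - y ^ 2) := by
    apply imono (by norm_num) (by fun_prop) (by fun_prop)
    intro y hy
    have h1 : y ^ 2 ≤ 1 / 4 := by nlinarith [hy.1, hy.2]
    have h2 : t ^ 2 ≤ 1 / 4 := by nlinarith
    change 1/2 ≤ qf t y * (1 + t ^ 2 - y ^ 2)
    unfold qf
    rw [div_mul_eq_mul_div, le_div_iff₀ (Wt_pos ht y)]
    nlinarith [sq_nonneg t, mul_nonneg (sq_nonneg t) (by linarith : 0 ≤ 1 - y ^ 2)]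
  rw [intervalIntegral.integral_const] at h7
  refine le_trans ?_ h6
  refine le_trans ?_ h7
  norm_num

lemma psi_arith {DH α I R J : ℝ} (h0 : 0 ≤ DH) (hR : 1 / 2 ≤ R) (hs : |J| ≤ 8 * √DH)
    (e : I = J + α * R) : α ^ 2 ≤ 8 * I ^ 2 + 512 * DH := by
  have h1 : |α| * R ≤ |I| + 8 * √DH := by
    have : α * R = I - J := by rw [e]; ring
    rw [← abs_of_nonneg (by linarith : 0 ≤ R), ← abs_mul, this]
    exact (abs_sub _ _).trans (by linarith)
  have h8 : |α| ≤ 2 * (|I| + 8 * √DH) := by nlinarith [abs_nonneg α]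
  have := Real.sq_sqrt h0
  calc α ^ 2 = |α| ^ 2 := (sq_abs α).symm
    _ ≤ (2 * (|I| + 8 * √DH)) ^ 2 := pow_le_pow_left₀ (abs_nonneg _) h8 2
    _ ≤ 8 * |I| ^ 2 + 512 * (√DH) ^ 2 := by nlinarith [sq_nonneg (|I| - 8 * √DH)]
    _ = _ := by rw [sq_abs, this]

set_option maxHeartbeats 1000000 in
lemma psi_main {t : ℝ} (ht : 0 < t) (ht1 : t ≤ 1/2) {p p1 : ℝ → ℝ} (hp : ∀ y, HasDerivAt p (p1 y) y)
    (hc1 : Continuous p1) (hm : p (-1) = 0) (hpl : p 1 = 0) :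
    ∃ DH : ℝ, 0 ≤ DH ∧ (∫ y in (-1:ℝ)..1, p1 y ^ 2 = DH + 2 * ∫ y in (-1:ℝ)..1, p y ^ 2 / (1 + t ^ 2 - y ^ 2)) ∧
      ∫ y in (-1:ℝ)..1, p1 y ^ 2 ≤ 10000 * (DH + (∫ y in (-1:ℝ)..1, qf t y * p y) ^ 2) := by
  have hcp : Continuous p := continuous_iff_continuousAt.2 fun y => (hp y).continuousAt
  have ht2 : 0 < t ^ 2 := by positivity
  have hne := We_ne ht
  have hne2 : ∀ y ∈ Set.Icc (-1:ℝ) 1, (1 + t ^ 2 - y ^ 2) ^ 2 ≠ 0 := fun y hy => pow_ne_zero 2 (hne y hy)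
  have h11 : (-1:ℝ) ≤ 1 := by norm_num
  set H : ℝ → ℝ := fun z => p1 z + 2 * z * p z / (1 + t ^ 2 - z ^ 2) with hHdef
  have hH : ContinuousOn H (Set.Icc (-1) 1) := by
    rw [hHdef]; fun_prop (disch := assumption)
  set DH := ∫ y in (-1:ℝ)..1, H y ^ 2 with hDH
  have hDH0 : 0 ≤ DH := sq_int_nonneg h11 _
  have hcp2 : ContinuousOn (fun y => p y ^ 2 / (1 + t ^ 2 - y ^ 2)) (Set.Icc (-1) 1) := by
    fun_prop (disch := assumption)
  have hid : ∫ y in (-1:ℝ)..1, p1 y ^ 2 = DH + 2 * ∫ y in (-1:ℝ)..1, p y ^ 2 / (1 + t ^ 2 - y ^ 2) := by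
    have hcd : ContinuousOn (fun y => (4 * (y / (1 + t ^ 2 - y ^ 2)) * (p y * p1 y) +
      2 * ((1 / (1 + t ^ 2 - y ^ 2) + 2 * y ^ 2 / (1 + t ^ 2 - y ^ 2) ^ 2) * p y ^ 2))) (Set.Icc (-1) 1) := by
      fun_prop (disch := assumption)
    have h1 : ∫ y in (-1:ℝ)..1, (4 * (y / (1 + t ^ 2 - y ^ 2)) * (p y * p1 y) +
      2 * ((1 / (1 + t ^ 2 - y ^ 2) + 2 * y ^ 2 / (1 + t ^ 2 - y ^ 2) ^ 2) * p y ^ 2)) = 0 := by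
      rw [intervalIntegral.integral_eq_sub_of_hasDerivAt (f := fun y => 2 * (y / (1 + t ^ 2 - y ^ 2) * p y ^ 2))]
      · simp [hm, hpl]
      · intro y hy
        rw [Set.uIcc_of_le h11] at hy
        have hy0 := hne y hy
        have d1 : HasDerivAt (fun y => 1 + t ^ 2 - y ^ 2) (-(2 * y)) y := by
          simpa using (hasDerivAt_pow 2 y).const_sub (1 + t ^ 2)
        have d2 := (hasDerivAt_id y).fun_div d1 hy0
        have d3 := ((d2.fun_mul ((hp y).fun_pow 2)).const_mul (2 : ℝ))
        refine d3.congr_deriv ?_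
        norm_num
        field_simp
        ring
      · exact hcd.intervalIntegrable_of_Icc h11
    have i1 : IntervalIntegrable (fun y => H y ^ 2) volume (-1) 1 :=
      (hH.pow 2).intervalIntegrable_of_Icc h11
    have i2 : IntervalIntegrable (fun y => 2 * (p y ^ 2 / (1 + t ^ 2 - y ^ 2))) volume (-1) 1 :=
      (continuousOn_const.mul hcp2).intervalIntegrable_of_Icc h11
    have i3 := hcd.intervalIntegrable_of_Icc (μ := volume) h11
    have e1 := intervalIntegral.integral_add i1 i2
    have e2 := intervalIntegral.integral_sub (i1.add i2) i3
    rw [h1, sub_zero] at e2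
    rw [hDH, ← icm, ← e1]
    refine Eq.trans ?_ e2
    apply intervalIntegral.integral_congr
    intro y hy
    rw [Set.uIcc_of_le h11] at hy
    have hy0 := hne y hy
    simp only [hHdef, Pi.add_apply]
    field_simp
    ring
  refine ⟨DH, hDH0, hid, ?_⟩
  set α := p 0 / (1 + t ^ 2) with hα
  have hi0 : IntervalIntegrable (fun y => H y ^ 2) volume (-1) 0 :=
    ((hH.pow 2).mono (Set.Icc_subset_Icc_right (by norm_num))).intervalIntegrable_of_Icc (by norm_num)
  have hi1 : IntervalIntegrable (fun y => H y ^ 2) volume 0 1 :=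
    ((hH.pow 2).mono (Set.Icc_subset_Icc_left (by norm_num))).intervalIntegrable_of_Icc (by norm_num)
  have eD := intervalIntegral.integral_add_adjacent_intervals hi0 hi1
  have k0 := sq_int_nonneg (by norm_num : (-1:ℝ) ≤ 0) H
  have k1 := sq_int_nonneg (by norm_num : (0:ℝ) ≤ 1) H
  have hψ : ∀ y ∈ Set.Icc (-1:ℝ) 1, (1 - |y| + t ^ 2) * (p y / (1 + t ^ 2 - y ^ 2) - α) ^ 2 ≤ DH := by
    intro y hy
    rcases le_total 0 y with h | h
    · have := psi_half ht hp hc1 (y := y) ⟨h, hy.2⟩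
      rw [abs_of_nonneg h]
      change _ ≤ ∫ z in (0:ℝ)..1, H z ^ 2 at this
      linarith
    · have := psi_half ht (p := fun y => p (-y)) (p1 := fun y => -p1 (-y)) (fun y => by
        have := (hp (-y)).scomp y (hasDerivAt_neg y)
        simpa [Function.comp_def] using this) (by fun_prop) (y := -y) ⟨by linarith, by linarith [hy.1]⟩
      rw [abs_of_nonpos h]
      simp only [neg_neg, neg_zero, neg_sq] at this
      have e : ∫ z in (0:ℝ)..1, (-p1 (-z) + 2 * z * p (-z) / (1 + t ^ 2 - z ^ 2)) ^ 2 =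
          ∫ z in (-1:ℝ)..0, H z ^ 2 := by
        have := intervalIntegral.integral_comp_neg (a := 0) (b := 1) (fun y => H y ^ 2)
        rw [neg_zero] at this
        rw [← this]
        congr 1; ext z
        simp only [hHdef, neg_sq]
        ring
      rw [e] at this
      linarith
  have hWle : ∀ y ∈ Set.Icc (-1:ℝ) 1, 1 + t ^ 2 - y ^ 2 ≤ 2 * (1 - |y| + t ^ 2) := by
    intro y hy
    have h1 : |y| ≤ 1 := abs_le.2 hy
    rw [← sq_abs y]; nlinarith [abs_nonneg y, sq_nonneg (1 - |y|)]
  have hcψ : ContinuousOn (fun y => p y / (1 + t ^ 2 - y ^ 2)) (Set.Icc (-1:ℝ) 1) := by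
    fun_prop (disch := assumption)
  -- bound for the energy
  have hen : ∫ y in (-1:ℝ)..1, p y ^ 2 / (1 + t ^ 2 - y ^ 2) ≤ 2 * (4 * DH + 4 * α ^ 2) := by
    have : ∫ y in (-1:ℝ)..1, p y ^ 2 / (1 + t ^ 2 - y ^ 2) ≤ ∫ y in (-1:ℝ)..1, (4 * DH + 4 * α ^ 2) := by
      apply intervalIntegral.integral_mono_on h11 (hcp2.intervalIntegrable_of_Icc h11) (by simp)
      intro y hy
      have hW := We_pos ht hy
      have e : p y ^ 2 / (1 + t ^ 2 - y ^ 2) = (1 + t ^ 2 - y ^ 2) * (p y / (1 + t ^ 2 - y ^ 2)) ^ 2 := by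
        field_simp
      rw [e]
      set ψ := p y / (1 + t ^ 2 - y ^ 2)
      have a1 := hψ y hy
      have a2 := hWle y hy
      have a3 : (1 + t ^ 2 - y ^ 2) * (ψ - α) ^ 2 ≤ 2 * DH := by
        nlinarith [sq_nonneg (ψ - α)]
      have a4 : (1 + t ^ 2 - y ^ 2) * α ^ 2 ≤ 2 * α ^ 2 := by
        apply mul_le_mul_of_nonneg_right _ (sq_nonneg _)
        nlinarith [sq_nonneg y]
      have a5 : ψ ^ 2 ≤ 2 * (ψ - α) ^ 2 + 2 * α ^ 2 := by nlinarith [sq_nonneg (ψ - 2 * α)]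
      nlinarith
    simp at this
    linarith
  -- bound for α
  have hq := cqf ht
  have hom : ∀ y ∈ Set.Icc (-1:ℝ) 1, 0 ≤ qf t y * (1 + t ^ 2 - y ^ 2) ∧ qf t y * (1 + t ^ 2 - y ^ 2) ≤ 1 := by
    intro y hy
    have hW := We_pos ht hy
    have h1 : y ^ 2 ≤ 1 := by nlinarith [hy.1, hy.2]
    refine ⟨mul_nonneg (qf_nonneg ht h1) hW.le, ?_⟩
    unfold qf
    rw [div_mul_eq_mul_div, div_le_one (Wt_pos ht y)]
    nlinarith [sq_nonneg (t * y)]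
  have hhc : ContinuousOn (fun y => qf t y * (1 + t ^ 2 - y ^ 2) * (p y / (1 + t ^ 2 - y ^ 2) - α)) (Set.Icc (-1:ℝ) 1) := by
    apply ContinuousOn.mul (by fun_prop)
    exact hcψ.sub continuousOn_const
  have hs := sing_all (L := 1) (K := √DH) le_rfl hhc (Real.sqrt_nonneg _) (by
    intro y hy
    have h1 : |y| ≤ 1 := abs_le.2 hy
    rw [abs_sub_comm, abs_of_nonneg (by linarith : 0 ≤ 1 - |y|), abs_mul, abs_of_nonneg (hom y hy).1]
    have h2 : |p y / (1 + t ^ 2 - y ^ 2) - α| * √(1 - |y|) ≤ √DH := by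
      apply Real.le_sqrt_of_sq_le
      rw [mul_pow, sq_abs, Real.sq_sqrt (by linarith)]
      nlinarith [hψ y hy, sq_nonneg (t * (p y / (1 + t ^ 2 - y ^ 2) - α))]
    have h3 : 0 ≤ |p y / (1 + t ^ 2 - y ^ 2) - α| * √(1 - |y|) := by positivity
    rw [mul_assoc]
    nlinarith [(hom y hy).1, (hom y hy).2])
    (by
      intro y hy h
      have h1 : |y| ≤ 1 := abs_le.2 hy
      linarith)
  have e2 : ∫ y in (-1:ℝ)..1, qf t y * p y =
      (∫ y in (-1:ℝ)..1, qf t y * (1 + t ^ 2 - y ^ 2) * (p y / (1 + t ^ 2 - y ^ 2) - α)) +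
        α * ∫ y in (-1:ℝ)..1, qf t y * (1 + t ^ 2 - y ^ 2) := by
    rw [← icm, ← intervalIntegral.integral_add (hhc.intervalIntegrable_of_Icc h11)
      (Continuous.intervalIntegrable (by fun_prop) _ _)]
    apply intervalIntegral.integral_congr
    intro y hy
    rw [Set.uIcc_of_le h11] at hy
    have hy0 := hne y hy
    simp only
    field_simp
    ring
  have h5 := psi_low ht ht1
  set I := ∫ y in (-1:ℝ)..1, qf t y * p y with hI
  set J := ∫ y in (-1:ℝ)..1, qf t y * (1 + t ^ 2 - y ^ 2) * (p y / (1 + t ^ 2 - y ^ 2) - α)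
  set R := ∫ y in (-1:ℝ)..1, qf t y * (1 + t ^ 2 - y ^ 2)
  have h9 := psi_arith hDH0 h5 hs e2
  rw [hid]
  linarith [sq_nonneg I]

lemma cutoff {d : ℝ} (hd : 0 < d) (hd1 : d ≤ 1/2) : ∃ (ρ ρ1 : ℝ → ℝ) (C : ℝ), 0 < C ∧
    (∀ y, HasDerivAt ρ (ρ1 y) y) ∧ Continuous ρ1 ∧ (∀ y, 0 ≤ ρ y) ∧ (∀ y, ρ y ≤ 1) ∧
    (∀ y, |y| ≤ 1 → ρ y = 1) ∧ (∀ y, 1 + d ≤ |y| → ρ y = 0) ∧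
    (∀ y, |y| ≤ 1 → ρ1 y = 0) ∧ (∀ y, 1 + d ≤ |y| → ρ1 y = 0) ∧ (∀ y, |ρ1 y| ≤ C) := by
  set ρ : ℝ → ℝ := fun y => Real.smoothTransition (1 - (y ^ 2 - 1) / d) with hρ
  have hcd : ContDiff ℝ 1 ρ := by
    apply Real.smoothTransition.contDiff.comp
    fun_prop
  have h0 : ∀ y, 0 ≤ ρ y := fun y => Real.smoothTransition.nonneg _
  have h1 : ∀ y, ρ y ≤ 1 := fun y => Real.smoothTransition.le_one _
  have hone : ∀ y, |y| ≤ 1 → ρ y = 1 := by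
    intro y hy
    apply Real.smoothTransition.one_of_one_le
    have : y ^ 2 ≤ 1 := by rw [← sq_abs]; nlinarith [abs_nonneg y]
    have : (y ^ 2 - 1) / d ≤ 0 := div_nonpos_of_nonpos_of_nonneg (by linarith) hd.le
    linarith
  have hzero : ∀ y, 1 + d ≤ |y| → ρ y = 0 := by
    intro y hy
    apply Real.smoothTransition.zero_of_nonpos
    have : 1 + d ≤ y ^ 2 := by rw [← sq_abs]; nlinarith [abs_nonneg y]
    have : 1 ≤ (y ^ 2 - 1) / d := by rw [le_div_iff₀ hd]; linarith
    linarith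
  have hder : ∀ y, HasDerivAt ρ (deriv ρ y) y := fun y =>
    ((hcd.differentiable (by norm_num)) y).hasDerivAt
  have hc1 : Continuous (deriv ρ) := hcd.continuous_deriv (by norm_num)
  have hd0 : ∀ y, 1 + d ≤ |y| → deriv ρ y = 0 := by
    intro y hy
    apply IsLocalMin.deriv_eq_zero
    filter_upwards with z
    rw [hzero y hy]; exact h0 z
  have hdo : ∀ y, |y| ≤ 1 → deriv ρ y = 0 := by
    intro y hy
    apply IsLocalMax.deriv_eq_zero
    filter_upwards with z
    rw [hone y hy]; exact h1 z
  obtain ⟨C, hC⟩ := (isCompact_Icc (a := (-2:ℝ)) (b := 2)).exists_bound_of_continuousOn hc1.continuousOn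
  refine ⟨ρ, deriv ρ, |C| + 1, by positivity, hder, hc1, h0, h1, hone, hzero, hdo, hd0, ?_⟩
  intro y
  by_cases h : |y| ≤ 2
  · have := hC y (abs_le.1 h)
    rw [Real.norm_eq_abs] at this
    linarith [le_abs_self C]
  · rw [hd0 y (by linarith), abs_zero]; positivity




lemma supp_int {a b B : ℝ} (hab : a ≤ b) {f : ℝ → ℝ} (hf : Continuous f) (hB : ∀ y, |f y| ≤ B)
    (h0 : ∀ y, 2 ≤ |y| → f y = 0) : ∫ y in a..b, f y ^ 2 ≤ 25 * B ^ 2 := by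
  have hc : Continuous (fun y : ℝ => 1 / ((y - 0) ^ 2 + 1 ^ 2)) := by
    apply Continuous.div continuous_const (by fun_prop)
    intro y; positivity
  have h1 : ∫ y in a..b, f y ^ 2 ≤ ∫ y in a..b, (5 * B ^ 2) * (1 / ((y - 0) ^ 2 + 1 ^ 2)) := by
    apply imono hab (by fun_prop) (by fun_prop)
    intro y _
    change f y ^ 2 ≤ (5 * B ^ 2) * (1 / ((y - 0) ^ 2 + 1 ^ 2))
    rw [mul_one_div, le_div_iff₀ (by positivity)]
    by_cases h : 2 ≤ |y|
    · rw [h0 y h]; simp; positivity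
    · have h2 : y ^ 2 ≤ 4 := by rw [← sq_abs]; nlinarith [abs_nonneg y]
      have h3 : f y ^ 2 ≤ B ^ 2 := by rw [← sq_abs]; exact pow_le_pow_left₀ (abs_nonneg _) (hB y) 2
      nlinarith [sq_nonneg (f y)]
  rw [icm] at h1
  have h2 := int_lorentz a b 0 1 hab one_pos
  have : 0 ≤ B ^ 2 := sq_nonneg _
  nlinarith

lemma supp_cs {a b B : ℝ} (hab : a ≤ b) {f g : ℝ → ℝ} (hf : Continuous f) (hg : Continuous g)
    (hB0 : 0 ≤ B) (hB : ∀ y, |f y| ≤ B)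
    (h0 : ∀ y, 2 ≤ |y| → f y = 0) : |∫ y in a..b, g y * f y| ≤ 5 * B * √(∫ y in a..b, g y ^ 2) := by
  have h1 := cs_int hab hg.continuousOn hf.continuousOn
  have h2 := supp_int hab hf hB h0
  have h3 : √(∫ y in a..b, f y ^ 2) ≤ 5 * B := by
    apply Real.sqrt_le_iff.2 ⟨by positivity, by nlinarith⟩
  refine h1.trans ?_
  rw [mul_comm]
  gcongr

lemma split3 {L : ℝ} {f : ℝ → ℝ} (hf : Continuous f) :
    ∫ y in (-L)..L, f y = (∫ y in (-L)..(-1), f y) + (∫ y in (-1:ℝ)..1, f y) + ∫ y in (1:ℝ)..L, f y := by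
  have hi : ∀ a b, IntervalIntegrable f volume a b := fun a b => hf.intervalIntegrable _ _
  rw [intervalIntegral.integral_add_adjacent_intervals (hi _ _) (hi _ _),
    intervalIntegral.integral_add_adjacent_intervals (hi _ _) (hi _ _)]

lemma outR {L d t : ℝ} (hd : 0 < d) (hd1 : d ≤ 1/2) (hL : 1 + d ≤ L) (ht : 0 < t) {ρ p p1 : ℝ → ℝ}
    (hρ : Continuous ρ) (hr0 : ∀ y, |ρ y| ≤ 1) (hr1 : ∀ y, 1 + d ≤ y → ρ y = 0)
    (hp : ∀ y, HasDerivAt p (p1 y) y) (hc1 : Continuous p1) (hp0 : p 1 = 0) :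
    |∫ y in (1:ℝ)..L, qf t y * (ρ y * p y)| ≤ 2 * √(∫ y in (1:ℝ)..L, p1 y ^ 2) := by
  have hcp : Continuous p := continuous_iff_continuousAt.2 fun y => (hp y).continuousAt
  have hq := cqf ht
  have hi : ∀ a b, IntervalIntegrable (fun y => qf t y * (ρ y * p y)) volume a b := fun a b =>
    Continuous.intervalIntegrable (by fun_prop) _ _
  have h3 : ∫ y in (1 + d)..L, qf t y * (ρ y * p y) = 0 := by
    have : ∫ y in (1 + d)..L, qf t y * (ρ y * p y) = ∫ y in (1 + d)..L, (0:ℝ) := by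
      apply intervalIntegral.integral_congr
      intro y hy
      rw [Set.uIcc_of_le hL] at hy
      simp [hr1 y hy.1]
    rw [this]; simp
  rw [← intervalIntegral.integral_add_adjacent_intervals (hi 1 (1 + d)) (hi (1 + d) L), h3, add_zero]
  set V := ∫ y in (1:ℝ)..L, p1 y ^ 2 with hV
  have h1 := sing_right (c := 1) (e := 1 + d) (K := √V) (by linarith)
    (h := fun y => qf t y * (ρ y * p y)) (by fun_prop) (by
      intro y hy
      have h4 := holder_half hp hc1 (a := 1) (b := L) (x := 1) (y := y) ⟨le_rfl, by linarith⟩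
        ⟨hy.1.le, by linarith [hy.2]⟩
      have hy1 : 0 ≤ y - 1 := by linarith [hy.1]
      rw [hp0, sub_zero, abs_of_nonneg hy1] at h4
      have h5 : |p y| ≤ √(y - 1) * √V := by
        rw [← Real.sqrt_mul hy1]; exact Real.abs_le_sqrt h4
      have h6 := abs_qf_le ht (by linarith : 0 ≤ y)
      rw [abs_of_nonneg hy1] at h6
      rw [abs_mul, abs_mul]
      calc |qf t y| * (|ρ y| * |p y|) * √(y - 1) ≤ |qf t y| * (1 * (√(y - 1) * √V)) * √(y - 1) := by
            gcongr; exact hr0 y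
        _ = (|qf t y| * (√(y - 1) * √(y - 1))) * √V := by ring
        _ ≤ 1 * √V := by rw [Real.mul_self_sqrt hy1]; gcongr
        _ = _ := one_mul _)
  refine h1.trans ?_
  have : √(1 + d - 1) ≤ 1 := Real.sqrt_le_one.2 (by linarith)
  have h0 := Real.sqrt_nonneg V
  nlinarith

lemma outL {L d t : ℝ} (hd : 0 < d) (hd1 : d ≤ 1/2) (hL : 1 + d ≤ L) (ht : 0 < t) {ρ p p1 : ℝ → ℝ}
    (hρ : Continuous ρ) (hr0 : ∀ y, |ρ y| ≤ 1) (hr1 : ∀ y, y ≤ -(1 + d) → ρ y = 0)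
    (hp : ∀ y, HasDerivAt p (p1 y) y) (hc1 : Continuous p1) (hp0 : p (-1) = 0) :
    |∫ y in (-L)..(-1), qf t y * (ρ y * p y)| ≤ 2 * √(∫ y in (-L)..(-1), p1 y ^ 2) := by
  have h := outR hd hd1 hL ht (ρ := fun y => ρ (-y)) (p := fun y => p (-y)) (p1 := fun y => -p1 (-y))
    (by fun_prop) (fun y => hr0 _) (fun y hy => hr1 _ (by linarith)) (fun y => by
        have := (hp (-y)).scomp y (hasDerivAt_neg y)
        simpa [Function.comp_def] using this) (by fun_prop) (by simpa using hp0)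
  have e1 := intervalIntegral.integral_comp_neg (a := 1) (b := L) (fun y => qf t y * (ρ y * p y))
  have e2 := intervalIntegral.integral_comp_neg (a := 1) (b := L) (fun y => p1 y ^ 2)
  simp only [qf_neg] at e1
  simp only [neg_sq] at h
  rw [e1, e2] at h
  exact h

namespace InvS
variable (S : InvS)

lemma S1 {t : ℝ} (ht : 0 < t) (ht1 : t ≤ 1/2) (hG : S.G2 ≤ t ^ 2 * S.N2) (hL : 1 ≤ S.L) :
    S.φ 1 ^ 2 ≤ 5 * (t * S.N2) + 2 * (t * S.U) := by
  have hcG := S.cG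
  have hcw := S.cw
  have h1 : ∫ y in (1 - t)..1, S.φ 1 ^ 2 ≤ ∫ y in (1 - t)..1, (S.G y ^ 2 + 4 * t ^ 2 * S.w y ^ 2 + 2 * t * S.V2) := by
    apply imono (by linarith) (by fun_prop) (by fun_prop)
    intro y hy
    change S.φ 1 ^ 2 ≤ S.G y ^ 2 + 4 * t ^ 2 * S.w y ^ 2 + 2 * t * S.V2
    have h2 := S.hold (x := y) (y := 1) ⟨by linarith [hy.1], by linarith [hy.2]⟩ ⟨by linarith, hL⟩
    rw [abs_of_nonneg (by linarith [hy.2])] at h2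
    have h3 : (1 - y) * S.V2 ≤ t * S.V2 := mul_le_mul_of_nonneg_right (by linarith [hy.1]) S.V2_nn
    have h4 : (1 - y ^ 2) ^ 2 ≤ 4 * t ^ 2 := by
      have a : 0 ≤ 1 - y ^ 2 := by nlinarith [hy.1, hy.2]
      have b : 1 - y ^ 2 ≤ 2 * t := by nlinarith [hy.1, hy.2]
      nlinarith
    have h5 : ((1 - y ^ 2) * S.w y) ^ 2 ≤ 4 * t ^ 2 * S.w y ^ 2 := by
      rw [mul_pow]; exact mul_le_mul_of_nonneg_right h4 (sq_nonneg _)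
    have h6 : S.φ y = (S.G y - (1 - y ^ 2) * S.w y) / 2 := by unfold G; ring
    set x := (1 - y ^ 2) * S.w y
    have h7 : S.φ y ^ 2 ≤ S.G y ^ 2 / 2 + x ^ 2 / 2 := by
      rw [h6]; nlinarith [sq_nonneg (S.G y + x)]
    nlinarith [sq_nonneg (S.φ 1 - 2 * S.φ y)]
  rw [iadd (by fun_prop) (by fun_prop), iadd (by fun_prop) (by fun_prop), icm,
    intervalIntegral.integral_const, intervalIntegral.integral_const] at h1
  have h2 : ∫ y in (1 - t)..1, S.G y ^ 2 ≤ S.G2 :=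
    sub_int_le (by linarith [S.hL]) (by linarith) hL (by fun_prop) (fun y _ => sq_nonneg _)
  have h3 : ∫ y in (1 - t)..1, S.w y ^ 2 ≤ S.N2 :=
    sub_int_le (by linarith [S.hL]) (by linarith) hL (by fun_prop) (fun y _ => sq_nonneg _)
  simp only [smul_eq_mul, sub_sub_cancel] at h1
  have h4 : 4 * t ^ 2 * (∫ y in (1 - t)..1, S.w y ^ 2) ≤ 4 * t ^ 2 * S.N2 := by gcongr
  have h5 : t * (2 * t * S.V2) ≤ t * (2 * t * S.U) := by
    have := S.V2_le
    gcongr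
  have h6 : t * S.φ 1 ^ 2 ≤ t * (5 * (t * S.N2) + 2 * (t * S.U)) := by nlinarith
  exact le_of_mul_le_mul_left h6 ht

lemma S1m {t : ℝ} (ht : 0 < t) (ht1 : t ≤ 1/2) (hG : S.G2 ≤ t ^ 2 * S.N2) (hL : 1 ≤ S.L) :
    S.φ (-1) ^ 2 ≤ 5 * (t * S.N2) + 2 * (t * S.U) := by
  have := S.refl.S1 ht ht1 (by rw [refl_G2, refl_N2]; exact hG) hL
  rw [refl_N2, refl_U] at this
  exact this

end InvS



structure CutD (S : InvS) (d K A : ℝ) (ρ ρ1 ℓ ℓ1 : ℝ → ℝ) : Prop where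
  hd : 0 < d
  hd1 : d ≤ 1/2
  hK : 1 ≤ K
  hA : 0 ≤ A
  hL : 1 + d ≤ S.L
  hκ : S.κ ≤ 200
  dρ : ∀ y, HasDerivAt ρ (ρ1 y) y
  dℓ : ∀ y, HasDerivAt ℓ (ℓ1 y) y
  cρ1 : Continuous ρ1
  cℓ1 : Continuous ℓ1
  bρ : ∀ y, |ρ y| ≤ 1
  bρ1 : ∀ y, |ρ1 y| ≤ K
  bℓ : ∀ y, |ℓ y| ≤ K * A
  bℓ1 : ∀ y, |ℓ1 y| ≤ K * A
  one : ∀ y, |y| ≤ 1 → ρ y = 1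
  one1 : ∀ y, |y| ≤ 1 → ρ1 y = 0
  zρ : ∀ y, 1 + d ≤ |y| → ρ y = 0
  zρ1 : ∀ y, 1 + d ≤ |y| → ρ1 y = 0
  zℓ : ∀ y, 1 + d ≤ |y| → ℓ y = 0
  zℓ1 : ∀ y, 1 + d ≤ |y| → ℓ1 y = 0
  vp : ℓ 1 = S.φ 1
  vm : ℓ (-1) = S.φ (-1)

namespace CutD
variable {S : InvS} {d K A : ℝ} {ρ ρ1 ℓ ℓ1 : ℝ → ℝ} (H : CutD S d K A ρ ρ1 ℓ ℓ1)
include H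

lemma cρ : Continuous ρ := continuous_iff_continuousAt.2 fun y => (H.dρ y).continuousAt
lemma cℓ : Continuous ℓ := continuous_iff_continuousAt.2 fun y => (H.dℓ y).continuousAt
lemma dp (y : ℝ) : HasDerivAt (fun y => S.φ y - ℓ y) (S.φ1 y - ℓ1 y) y := (S.d1 y).sub (H.dℓ y)
lemma cp1 : Continuous (fun y => S.φ1 y - ℓ1 y) := S.c1.sub H.cℓ1
lemma cp : Continuous (fun y => S.φ y - ℓ y) := S.cφ.sub H.cℓ

lemma hp {y : ℝ} (hy : y ∈ Set.Icc (-S.L) S.L) : (S.φ y - ℓ y) ^ 2 ≤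
    |(|y| - 1)| * ∫ y in (-S.L)..S.L, (S.φ1 y - ℓ1 y) ^ 2 := by
  have hL := H.hL
  have hd := H.hd
  rcases le_total 0 y with h | h
  · have := holder_half H.dp H.cp1 (x := 1) (y := y) (a := -S.L) (b := S.L) ⟨by linarith, by linarith⟩ hy
    simp only [H.vp, sub_self, sub_zero] at this
    rwa [abs_of_nonneg h]
  · have := holder_half H.dp H.cp1 (x := -1) (y := y) (a := -S.L) (b := S.L) ⟨by linarith, by linarith⟩ hy
    simp only [H.vm, sub_self, sub_zero] at this
    rw [abs_of_nonpos h]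
    rwa [show -y - 1 = -(y - -1) by ring, abs_neg]

lemma sup2 {f : ℝ → ℝ} (hf : ∀ y, 1 + d ≤ |y| → f y = 0) : ∀ y, 2 ≤ |y| → f y = 0 :=
  fun y hy => hf y (by linarith [H.hd1])

lemma J_le {t : ℝ} (ht : 0 < t) (ht1 : t ≤ 1) (hG : S.G2 ≤ t ^ 2 * S.N2) :
    (∫ y in (-S.L)..S.L, (S.φ1 y - ℓ1 y) ^ 2) + S.κ ^ 2 * (∫ y in (-S.L)..S.L, (S.φ y - ℓ y) ^ 2)
      - 2 * ∫ y in (-S.L)..S.L, qf t y * (S.φ y - ℓ y) ^ 2 ≤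
    (9 * √(t * S.N2) + 1100 * (K * A)) * √((∫ y in (-S.L)..S.L, (S.φ1 y - ℓ1 y) ^ 2) +
      S.κ ^ 2 * (∫ y in (-S.L)..S.L, (S.φ y - ℓ y) ^ 2)) := by
  have hL := H.hL
  have hd := H.hd
  have hκ := H.hκ
  have hκ0 := S.hκ
  have hKA : 0 ≤ K * A := mul_nonneg (by linarith [H.hK]) H.hA
  have hcl := H.cℓ
  have hcl1 := H.cℓ1
  have hcp := S.cφ
  have hcp1 := S.c1
  have hq := cqf ht
  have hzL : ℓ S.L = 0 := H.zℓ _ (by rw [abs_of_pos S.hL]; exact hL)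
  have hzL' : ℓ (-S.L) = 0 := H.zℓ _ (by rw [abs_neg, abs_of_pos S.hL]; exact hL)
  set V0 := ∫ y in (-S.L)..S.L, (S.φ1 y - ℓ1 y) ^ 2 with hV0
  set Q0 := ∫ y in (-S.L)..S.L, (S.φ y - ℓ y) ^ 2 with hQ0
  have hV0n : 0 ≤ V0 := sq_int_nonneg S.LL _
  have hQ0n : 0 ≤ Q0 := sq_int_nonneg S.LL _
  have hT := S.Tf ht ht1 hG H.dp H.cp1 (by simp [S.bm, hzL']) (by simp [S.bp, hzL]) le_rfl hV0n
    (fun y hy => by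
      have := H.hp hy
      have h0 : 0 ≤ |(|y| - 1)| * V0 := by positivity
      linarith)
  have eM : S.M t (fun y => S.φ y - ℓ y) (fun y => S.φ1 y - ℓ1 y) =
      (V0 + S.κ ^ 2 * Q0 - 2 * ∫ y in (-S.L)..S.L, qf t y * (S.φ y - ℓ y) ^ 2) +
      ((∫ y in (-S.L)..S.L, (S.φ1 y - ℓ1 y) * ℓ1 y) + S.κ ^ 2 * (∫ y in (-S.L)..S.L, (S.φ y - ℓ y) * ℓ y)
        - 2 * ∫ y in (-S.L)..S.L, qf t y * ((S.φ y - ℓ y) * ℓ y)) := by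
    have a1 : ∫ y in (-S.L)..S.L, (S.φ1 y - ℓ1 y) * S.φ1 y = V0 + ∫ y in (-S.L)..S.L, (S.φ1 y - ℓ1 y) * ℓ1 y := by
      rw [hV0, ← iadd (by fun_prop) (by fun_prop)]; congr 1; ext y; ring
    have a2 : ∫ y in (-S.L)..S.L, (S.φ y - ℓ y) * S.φ y = Q0 + ∫ y in (-S.L)..S.L, (S.φ y - ℓ y) * ℓ y := by
      rw [hQ0, ← iadd (by fun_prop) (by fun_prop)]; congr 1; ext y; ring
    have a3 : ∫ y in (-S.L)..S.L, qf t y * ((S.φ y - ℓ y) * S.φ y) =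
        (∫ y in (-S.L)..S.L, qf t y * (S.φ y - ℓ y) ^ 2) + ∫ y in (-S.L)..S.L, qf t y * ((S.φ y - ℓ y) * ℓ y) := by
      rw [← iadd (by exact hq.mul (H.cp.pow 2)) (by exact hq.mul (H.cp.mul hcl))]; congr 1; ext y; ring
    unfold InvS.M
    rw [a1, a2, a3]; ring
  have b1 := supp_cs S.LL hcl1 H.cp1 hKA H.bℓ1 (H.sup2 H.zℓ1)
  have b2 := supp_cs S.LL hcl H.cp hKA H.bℓ (H.sup2 H.zℓ)
  have b3 := sing_all (L := S.L) (K := K * A * √V0) (by linarith)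
    (h := fun y => qf t y * ((S.φ y - ℓ y) * ℓ y)) (by exact (hq.mul (H.cp.mul hcl)).continuousOn) (by positivity) (by
      intro y hy
      have h1 : |S.φ y - ℓ y| ≤ √|(|y| - 1)| * √V0 := by
        rw [← Real.sqrt_mul (abs_nonneg _)]; exact Real.abs_le_sqrt (H.hp hy)
      have h2 : |qf t y| * |(|y| - 1)| ≤ 1 := by
        have := abs_qf_le ht (abs_nonneg y)
        rcases abs_choice y with h | h
        · rw [h] at this ⊢; exact this
        · rw [h, qf_neg] at this; rw [h]; exact this
      change |qf t y * ((S.φ y - ℓ y) * ℓ y)| * _ ≤ _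
      rw [abs_mul, abs_mul]
      calc |qf t y| * (|S.φ y - ℓ y| * |ℓ y|) * √|(|y| - 1)| ≤
          |qf t y| * ((√|(|y| - 1)| * √V0) * (K * A)) * √|(|y| - 1)| := by
            gcongr; exact H.bℓ y
        _ = (|qf t y| * (√|(|y| - 1)| * √|(|y| - 1)|)) * (K * A * √V0) := by ring
        _ ≤ 1 * (K * A * √V0) := by
            rw [Real.mul_self_sqrt (abs_nonneg _)]; gcongr
        _ = _ := one_mul _) (by
      intro y _ h2
      simp [H.sup2 H.zℓ y h2])
  set U0 := V0 + S.κ ^ 2 * Q0 with hU0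
  have hκQ : 0 ≤ S.κ ^ 2 * Q0 := by positivity
  have c1 : √V0 ≤ √U0 := Real.sqrt_le_sqrt (by linarith)
  have c2 : S.κ * √Q0 ≤ √U0 := by
    apply Real.le_sqrt_of_sq_le
    rw [mul_pow, Real.sq_sqrt hQ0n]; linarith
  have hN := S.N2_nn
  have hP : 0 ≤ t * S.N2 := by positivity
  have hM : |S.M t (fun y => S.φ y - ℓ y) (fun y => S.φ1 y - ℓ1 y)| ≤ 9 * √(t * S.N2) * √U0 := by
    apply abs_le_of_sq_le_sq _ (by positivity)
    rw [mul_pow, mul_pow, Real.sq_sqrt hP, Real.sq_sqrt (by positivity)]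
    nlinarith
  rw [eM] at hM
  have b2' : |S.κ ^ 2 * ∫ y in (-S.L)..S.L, (S.φ y - ℓ y) * ℓ y| ≤ 1000 * (K * A) * √U0 := by
    rw [abs_mul, abs_of_nonneg (sq_nonneg S.κ)]
    calc S.κ ^ 2 * |∫ y in (-S.L)..S.L, (S.φ y - ℓ y) * ℓ y| ≤ S.κ ^ 2 * (5 * (K * A) * √Q0) := by gcongr
      _ = S.κ * (5 * (K * A) * (S.κ * √Q0)) := by ring
      _ ≤ 200 * (5 * (K * A) * √U0) := by gcongr
      _ = _ := by ring
  have b1' : 5 * (K * A) * √V0 ≤ 5 * (K * A) * √U0 := by gcongr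
  have b3' : 8 * (K * A * √V0) ≤ 8 * (K * A * √U0) := by gcongr
  have := abs_le.1 hM
  have := abs_le.1 b1
  have := abs_le.1 b2'
  have := abs_le.1 b3
  have : 0 ≤ K * A * √U0 := by positivity
  linarith

lemma I_le {t : ℝ} (ht : 0 < t) (ht1 : t ≤ 1) (hG : S.G2 ≤ t ^ 2 * S.N2) {D : ℝ}
    (hD1 : ∫ y in (-S.L)..(-1), (S.φ1 y - ℓ1 y) ^ 2 ≤ D)
    (hD2 : ∫ y in (1:ℝ)..S.L, (S.φ1 y - ℓ1 y) ^ 2 ≤ D)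
    (hD3 : S.κ ^ 2 * (∫ y in (-S.L)..S.L, (S.φ y - ℓ y) ^ 2) ≤ D) :
    |∫ y in (-1:ℝ)..1, qf t y * (S.φ y - ℓ y)| ≤
      (4 + 5 * K + 500) * √D + (8 * (1 / d + 5) * (K * (K * A)) + 20 * (K * (K * A)) + 1000000 * (K * A))
        + 5 * √(t * S.N2) := by
  have hL := H.hL
  have hd := H.hd
  have hκ := H.hκ
  have hκ0 := S.hκ
  have hK0 : 0 ≤ K := by linarith [H.hK]
  have hKA : 0 ≤ K * A := mul_nonneg hK0 H.hA
  have hcr := H.cρ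
  have hcr1 := H.cρ1
  have hcl := H.cℓ
  have hcl1 := H.cℓ1
  have hcp := S.cφ
  have hcp1 := S.c1
  have hq := cqf ht
  have hN := S.N2_nn
  have hP : 0 ≤ t * S.N2 := by positivity
  have hzL : ρ S.L = 0 := H.zρ _ (by rw [abs_of_pos S.hL]; exact hL)
  have hzL' : ρ (-S.L) = 0 := H.zρ _ (by rw [abs_neg, abs_of_pos S.hL]; exact hL)
  have hT := S.Tf ht ht1 hG H.dρ H.cρ1 hzL' hzL zero_le_one le_rfl (fun y hy => by
    have h1 := H.bρ y
    have h2 : ρ y ^ 2 ≤ 1 := by rw [← sq_abs]; nlinarith [abs_nonneg (ρ y)]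
    linarith)
  have hM : |S.M t ρ ρ1| ≤ 9 * √(t * S.N2) := by
    apply abs_le_of_sq_le_sq _ (by positivity)
    rw [mul_pow, Real.sq_sqrt hP]; linarith
  -- decomposition of `M`
  have e1 : ∫ y in (-S.L)..S.L, ρ1 y * S.φ1 y =
      ((∫ y in (-S.L)..(-1), (S.φ1 y - ℓ1 y) * ρ1 y) + ∫ y in (1:ℝ)..S.L, (S.φ1 y - ℓ1 y) * ρ1 y) +
        ∫ y in (-S.L)..S.L, ℓ1 y * ρ1 y := by
    have a1 : ∫ y in (-S.L)..S.L, ρ1 y * S.φ1 y =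
      (∫ y in (-S.L)..S.L, (S.φ1 y - ℓ1 y) * ρ1 y) + ∫ y in (-S.L)..S.L, ℓ1 y * ρ1 y := by
      rw [← iadd (by fun_prop) (by fun_prop)]; congr 1; ext y; ring
    have a2 : ∫ y in (-1:ℝ)..1, (S.φ1 y - ℓ1 y) * ρ1 y = 0 := by
      have : ∫ y in (-1:ℝ)..1, (S.φ1 y - ℓ1 y) * ρ1 y = ∫ y in (-1:ℝ)..1, (0:ℝ) := by
        apply intervalIntegral.integral_congr
        intro y hy
        rw [Set.uIcc_of_le (by norm_num)] at hy
        simp [H.one1 y (abs_le.2 hy)]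
      rw [this]; simp
    rw [a1, split3 (f := fun y => (S.φ1 y - ℓ1 y) * ρ1 y) (by fun_prop), a2]; ring
  have e2 : ∫ y in (-S.L)..S.L, ρ y * S.φ y =
      (∫ y in (-S.L)..S.L, (S.φ y - ℓ y) * ρ y) + ∫ y in (-S.L)..S.L, ℓ y * ρ y := by
    rw [← iadd (by fun_prop) (by fun_prop)]; congr 1; ext y; ring
  have e3 : ∫ y in (-S.L)..S.L, qf t y * (ρ y * S.φ y) =
      ((∫ y in (-S.L)..(-1), qf t y * (ρ y * (S.φ y - ℓ y))) + (∫ y in (-1:ℝ)..1, qf t y * (S.φ y - ℓ y)) +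
        ∫ y in (1:ℝ)..S.L, qf t y * (ρ y * (S.φ y - ℓ y))) +
      ∫ y in (-S.L)..S.L, qf t y * (ρ y * ℓ y) := by
    have a1 : ∫ y in (-S.L)..S.L, qf t y * (ρ y * S.φ y) =
      (∫ y in (-S.L)..S.L, qf t y * (ρ y * (S.φ y - ℓ y))) + ∫ y in (-S.L)..S.L, qf t y * (ρ y * ℓ y) := by
      rw [← iadd (by exact hq.mul (hcr.mul H.cp)) (by exact hq.mul (hcr.mul hcl))]; congr 1; ext y; ring
    have a2 : ∫ y in (-1:ℝ)..1, qf t y * (ρ y * (S.φ y - ℓ y)) = ∫ y in (-1:ℝ)..1, qf t y * (S.φ y - ℓ y) := by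
      apply intervalIntegral.integral_congr
      intro y hy
      rw [Set.uIcc_of_le (by norm_num)] at hy
      simp [H.one y (abs_le.2 hy)]
    rw [a1, split3 (f := fun y => qf t y * (ρ y * (S.φ y - ℓ y))) (by exact hq.mul (hcr.mul H.cp)), a2]
  -- bounds
  have hL1 : -S.L ≤ -1 := by linarith
  have hL2 : 1 ≤ S.L := by linarith
  have b1 := supp_cs hL1 hcr1 H.cp1 hK0 H.bρ1 (H.sup2 H.zρ1)
  have b2 := supp_cs hL2 hcr1 H.cp1 hK0 H.bρ1 (H.sup2 H.zρ1)
  have b3 := supp_cs S.LL hcr1 hcl1 hK0 H.bρ1 (H.sup2 H.zρ1)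
  have b3' : √(∫ y in (-S.L)..S.L, ℓ1 y ^ 2) ≤ 5 * (K * A) :=
    Real.sqrt_le_iff.2 ⟨by positivity, by have := supp_int S.LL hcl1 H.bℓ1 (H.sup2 H.zℓ1); nlinarith⟩
  have b4 := supp_cs S.LL hcr H.cp zero_le_one H.bρ (H.sup2 H.zρ)
  have b5 := supp_cs S.LL hcr hcl zero_le_one H.bρ (H.sup2 H.zρ)
  have b5' : √(∫ y in (-S.L)..S.L, ℓ y ^ 2) ≤ 5 * (K * A) :=
    Real.sqrt_le_iff.2 ⟨by positivity, by have := supp_int S.LL hcl H.bℓ (H.sup2 H.zℓ); nlinarith⟩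
  have b6 := outL H.hd H.hd1 H.hL ht hcr H.bρ (fun y hy => H.zρ y (by
    rw [← abs_neg]; exact le_trans (by linarith) (le_abs_self _))) H.dp H.cp1 (by simp [H.vm])
  have b7 := outR H.hd H.hd1 H.hL ht hcr H.bρ (fun y hy => H.zρ y (hy.trans (le_abs_self _)))
    H.dp H.cp1 (by simp [H.vp])
  have b8 := pv_all (E := 2 * (K * (K * A))) H.hd H.hd1 H.hL ht (g := fun y => ρ y * ℓ y) (by exact hcr.mul hcl)
    (by
      intro y z
      have := Convex.norm_image_sub_le_of_norm_hasDerivWithin_le (s := Set.univ)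
        (f := fun y => ρ y * ℓ y) (f' := fun y => ρ1 y * ℓ y + ρ y * ℓ1 y) (C := 2 * (K * (K * A)))
        (x := z) (y := y)
        (fun x _ => ((H.dρ x).mul (H.dℓ x)).hasDerivWithinAt) (fun x _ => by
          rw [Real.norm_eq_abs]
          refine (abs_add_le _ _).trans ?_
          rw [abs_mul, abs_mul]
          have k1 : |ρ1 x| * |ℓ x| ≤ K * (K * A) :=
            mul_le_mul (H.bρ1 x) (H.bℓ x) (abs_nonneg _) hK0
          have k2 : |ρ x| * |ℓ1 x| ≤ 1 * (K * A) :=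
            mul_le_mul (H.bρ x) (H.bℓ1 x) (abs_nonneg _) zero_le_one
          have k3 : 1 * (K * A) ≤ K * (K * A) := mul_le_mul_of_nonneg_right H.hK hKA
          linarith) convex_univ trivial trivial
      simpa [Real.norm_eq_abs] using this)
    (by
      intro y
      rw [abs_mul]
      have k2 : |ρ y| * |ℓ y| ≤ 1 * (K * A) :=
        mul_le_mul (H.bρ y) (H.bℓ y) (abs_nonneg _) zero_le_one
      have k3 : 1 * (K * A) ≤ K * (K * A) := mul_le_mul_of_nonneg_right H.hK hKA
      have : 0 ≤ K * (K * A) := by positivity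
      linarith)
    (fun y hy => by simp [H.zρ y hy])
  have c1 := Real.sqrt_le_sqrt hD1
  have c2 := Real.sqrt_le_sqrt hD2
  have c3 : S.κ * √(∫ y in (-S.L)..S.L, (S.φ y - ℓ y) ^ 2) ≤ √D := by
    apply Real.le_sqrt_of_sq_le
    rw [mul_pow, Real.sq_sqrt (sq_int_nonneg S.LL _)]; exact hD3
  have b4' : |S.κ ^ 2 * ∫ y in (-S.L)..S.L, (S.φ y - ℓ y) * ρ y| ≤ 1000 * √D := by
    rw [abs_mul, abs_of_nonneg (sq_nonneg S.κ)]
    calc _ ≤ S.κ ^ 2 * (5 * 1 * √(∫ y in (-S.L)..S.L, (S.φ y - ℓ y) ^ 2)) := by gcongr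
      _ = S.κ * (5 * (S.κ * √(∫ y in (-S.L)..S.L, (S.φ y - ℓ y) ^ 2))) := by ring
      _ ≤ 200 * (5 * √D) := by gcongr
      _ = _ := by ring
  have b5'' : |S.κ ^ 2 * ∫ y in (-S.L)..S.L, ℓ y * ρ y| ≤ 1000000 * (K * A) := by
    rw [abs_mul, abs_of_nonneg (sq_nonneg S.κ)]
    calc _ ≤ 200 ^ 2 * (5 * 1 * (5 * (K * A))) := by
          gcongr
          exact b5.trans (by gcongr)
      _ = _ := by ring
  have b1' : 5 * K * √(∫ y in (-S.L)..(-1), (S.φ1 y - ℓ1 y) ^ 2) ≤ 5 * K * √D := by gcongr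
  have b2' : 5 * K * √(∫ y in (1:ℝ)..S.L, (S.φ1 y - ℓ1 y) ^ 2) ≤ 5 * K * √D := by gcongr
  have b3'' : 5 * K * √(∫ y in (-S.L)..S.L, ℓ1 y ^ 2) ≤ 5 * K * (5 * (K * A)) := by gcongr
  have hMe : S.M t ρ ρ1 = (∫ y in (-S.L)..S.L, ρ1 y * S.φ1 y) +
      S.κ ^ 2 * (∫ y in (-S.L)..S.L, ρ y * S.φ y) - 2 * ∫ y in (-S.L)..S.L, qf t y * (ρ y * S.φ y) := rfl
  rw [e1, e2, e3] at hMe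
  have b8' : 2 * (2 * (K * (K * A)) / d + 5 * (2 * (K * (K * A)))) = 4 * (1 / d + 5) * (K * (K * A)) := by
    ring
  rw [b8'] at b8
  have g1 := abs_le.1 hM
  have g2 := abs_le.1 (b1.trans b1')
  have g3 := abs_le.1 (b2.trans b2')
  have g4 := abs_le.1 (b3.trans b3'')
  have g5 := abs_le.1 b4'
  have g6 := abs_le.1 b5''
  have g7 := abs_le.1 b6
  have g8 := abs_le.1 b7
  have g9 := abs_le.1 b8
  have p1 : 0 ≤ (1 / d + 5) * (K * (K * A)) := by positivity
  have p2 : 0 ≤ √D := Real.sqrt_nonneg _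
  have p3 : 0 ≤ √(t * S.N2) := Real.sqrt_nonneg _
  have p4 : 0 ≤ K * (K * A) := by positivity
  rw [mul_add] at hMe
  rw [abs_le]
  constructor <;> linarith
end CutD



lemma ar1 {u s R : ℝ} (hu : 0 ≤ u) (hs : 0 ≤ s) (hR : 1 ≤ R) (h : u ^ 2 ≤ R * s * u + R * s ^ 2) :
    u ≤ 2 * R * s := by
  by_contra hc
  push Not at hc
  have h0 : 0 ≤ R * s := by positivity
  have h1 : R * s * u ≤ u / 2 * u := by gcongr; linarith
  have h2 : R * s ^ 2 ≤ (R * s) * (R * s) := by nlinarith [mul_nonneg (mul_nonneg (by linarith : 0 ≤ R) (sq_nonneg s)) (by linarith : 0 ≤ R - 1)]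
  have hu0 : 0 < u := by nlinarith
  have h3 : (R * s) * (R * s) ≤ u / 2 * (u / 2) := by gcongr <;> linarith
  nlinarith

lemma inonpos {a b : ℝ} (hab : a ≤ b) {f : ℝ → ℝ} (h : ∀ y ∈ Set.Icc a b, f y ≤ 0) :
    ∫ y in a..b, f y ≤ 0 := by
  have := intervalIntegral.integral_nonneg (f := fun y => -f y) hab (μ := volume)
    (fun y hy => neg_nonneg.2 (h y hy))
  rw [intervalIntegral.integral_neg] at this
  linarith

def coreB (d K : ℝ) : ℝ :=
  504 + 5 * K + (8 * (1 / d + 5) * (K * K) + 20 * (K * K) + 1000000 * K) + 5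
def coreC (d K : ℝ) : ℝ :=
  16 * (1100 * K * (10001 + 30000 * coreB d K ^ 2)) ^ 2 + 2100000 * K ^ 2

set_option maxHeartbeats 1000000 in
lemma core_arith {d K A T D U0 U I : ℝ} (hK : 1 ≤ K) (hd : 0 < d) (hA : 0 ≤ A) (hT : 0 ≤ T)
    (hD0 : 0 ≤ D) (hU0 : 0 ≤ U0)
    (hI2 : |I| ≤ (4 + 5 * K + 500) * √D + (8 * (1 / d + 5) * (K * (K * A)) + 20 * (K * (K * A)) + 1000000 * (K * A))
        + 5 * √T)
    (hJ : D ≤ (9 * √T + 1100 * (K * A)) * √U0) (hDu0 : U0 ≤ 10001 * D + 10000 * I ^ 2)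
    (hUU : U ≤ 2 * U0 + 2100000 * (K * A) ^ 2) : U ≤ coreC d K * (T + A ^ 2) := by
  unfold coreC
  set B := coreB d K with hB
  have hB0 : 0 < B := by rw [hB]; unfold coreB; positivity
  set R := 10001 + 30000 * B ^ 2 with hR
  have hR0 : 10001 ≤ R := by nlinarith [sq_nonneg B]
  set R' := 1100 * K * R with hR'
  have hR'R : R ≤ R' := by nlinarith
  set P := √(T) with hPd
  have hP2 : P ^ 2 = T := Real.sq_sqrt hT
  have hP0 : 0 ≤ P := Real.sqrt_nonneg _
  set r := √D with hr
  have hr0 : 0 ≤ r := Real.sqrt_nonneg _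
  have hr2 : r ^ 2 = D := Real.sq_sqrt hD0
  have hI3 : |I| ≤ B * (r + A + P) := by
    have e : B * (r + A + P) = ((4 + 5 * K + 500) * r + (8 * (1 / d + 5) * (K * (K * A)) + 20 * (K * (K * A)) + 1000000 * (K * A))
        + 5 * P) + ((B - (504 + 5 * K)) * r + (509 + 5 * K) * A + (B - 5) * P) := by
      rw [hB]; unfold coreB; ring
    have h1 : 0 ≤ B - (504 + 5 * K) := by
      rw [hB]; unfold coreB
      have : 0 ≤ (8 * (1 / d + 5) * (K * K) + 20 * (K * K) + 1000000 * K) := by positivity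
      linarith
    have h2 : 0 ≤ B - 5 := by linarith
    rw [e]
    have : 0 ≤ (B - (504 + 5 * K)) * r + (509 + 5 * K) * A + (B - 5) * P := by positivity
    linarith
  have hI4 : I ^ 2 ≤ B ^ 2 * (3 * (D + A ^ 2 + P ^ 2)) := by
    calc I ^ 2 = |I| ^ 2 := (sq_abs I).symm
      _ ≤ (B * (r + A + P)) ^ 2 := pow_le_pow_left₀ (abs_nonneg _) hI3 2
      _ = B ^ 2 * (r + A + P) ^ 2 := by ring
      _ ≤ B ^ 2 * (3 * (D + A ^ 2 + P ^ 2)) := by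
          gcongr
          rw [← hr2]
          nlinarith [sq_nonneg (r - A), sq_nonneg (r - P), sq_nonneg (A - P)]
  set u := √(U0) with hu
  have hu2 : u ^ 2 = U0 := Real.sq_sqrt hU0
  have hu0 : 0 ≤ u := Real.sqrt_nonneg _
  have hDu : D ≤ 1100 * K * (P + A) * u := by
    have h1 : D ≤ (9 * P + 1100 * (K * A)) * u := by
      exact hJ
    refine h1.trans ?_
    gcongr
    nlinarith
  have hmain : u ^ 2 ≤ R * (D + (A ^ 2 + P ^ 2)) := by
    rw [hR, hu2]
    have : 0 ≤ A ^ 2 + P ^ 2 := by positivity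
    nlinarith
  have hmain2 : u ^ 2 ≤ R' * (P + A) * u + R' * (P + A) ^ 2 := by
    refine hmain.trans ?_
    have h1 : R * D ≤ R * (1100 * K * (P + A) * u) := by gcongr
    have h2 : R * (A ^ 2 + P ^ 2) ≤ R' * (P + A) ^ 2 := by
      gcongr
      nlinarith
    rw [hR'] at *
    linarith
  have h3 := ar1 hu0 (by positivity) (by linarith) hmain2
  have h4 : u ^ 2 ≤ 8 * R' ^ 2 * (P ^ 2 + A ^ 2) := by
    calc u ^ 2 ≤ (2 * R' * (P + A)) ^ 2 := pow_le_pow_left₀ hu0 h3 2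
      _ = 4 * R' ^ 2 * (P + A) ^ 2 := by ring
      _ ≤ 4 * R' ^ 2 * (2 * (P ^ 2 + A ^ 2)) := by
        gcongr; nlinarith [sq_nonneg (P - A)]
      _ = _ := by ring
  rw [← hu2] at hUU
  rw [← hP2]
  have : 0 ≤ 2100000 * K ^ 2 * P ^ 2 := by positivity
  nlinarith

set_option maxHeartbeats 1000000 in
lemma CutD.core (d K : ℝ) (hK : 1 ≤ K) (hd : 0 < d) : ∃ Cc : ℝ, 0 < Cc ∧
    ∀ (S : InvS) (A : ℝ) (ρ ρ1 ℓ ℓ1 : ℝ → ℝ), CutD S d K A ρ ρ1 ℓ ℓ1 → ∀ t : ℝ, 0 < t → t ≤ 1/2 →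
      S.G2 ≤ t ^ 2 * S.N2 → S.U ≤ Cc * (t * S.N2 + A ^ 2) := by
  refine ⟨coreC d K, by unfold coreC; positivity, ?_⟩
  intro S A ρ ρ1 ℓ ℓ1 H t ht ht1 hG
  have hJ := H.J_le ht (by linarith) hG
  obtain ⟨DH, hDH, hE, hI⟩ := psi_main ht ht1 H.dp H.cp1 (by simp [H.vm]) (by simp [H.vp])
  have hcl := H.cℓ
  have hcl1 := H.cℓ1
  have hcp := S.cφ
  have hcp1 := S.c1
  have hq := cqf ht
  have hL := H.hL
  have hL1 : -S.L ≤ -1 := by linarith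
  have hL2 : 1 ≤ S.L := by linarith
  have hA := H.hA
  have hV3 := split3 (L := S.L) (f := fun y => (S.φ1 y - ℓ1 y) ^ 2) (by fun_prop)
  have hq3 := split3 (L := S.L) (f := fun y => qf t y * (S.φ y - ℓ y) ^ 2) (by exact hq.mul (H.cp.pow 2))
  have q1 : ∫ y in (-S.L)..(-1), qf t y * (S.φ y - ℓ y) ^ 2 ≤ 0 := by
    apply inonpos hL1
    intro y hy
    exact mul_nonpos_of_nonpos_of_nonneg (qf_nonpos ht (by nlinarith [hy.2])) (sq_nonneg _)
  have q2 : ∫ y in (1:ℝ)..S.L, qf t y * (S.φ y - ℓ y) ^ 2 ≤ 0 := by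
    apply inonpos hL2
    intro y hy
    exact mul_nonpos_of_nonpos_of_nonneg (qf_nonpos ht (by nlinarith [hy.1])) (sq_nonneg _)
  have q3 : ∫ y in (-1:ℝ)..1, qf t y * (S.φ y - ℓ y) ^ 2 ≤ ∫ y in (-1:ℝ)..1, (S.φ y - ℓ y) ^ 2 / (1 + t ^ 2 - y ^ 2) := by
    have hne := We_ne ht
    apply intervalIntegral.integral_mono_on (by norm_num) (Continuous.intervalIntegrable (hq.mul (H.cp.pow 2)) _ _)
      (ContinuousOn.intervalIntegrable_of_Icc (by norm_num) (by fun_prop (disch := assumption)))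
    intro y hy
    have hW := We_pos ht hy
    have h1 : qf t y ≤ 1 / (1 + t ^ 2 - y ^ 2) := by
      unfold qf
      rw [div_le_div_iff₀ (Wt_pos ht y) hW]
      nlinarith [sq_nonneg (t * y)]
    calc _ ≤ 1 / (1 + t ^ 2 - y ^ 2) * (S.φ y - ℓ y) ^ 2 := mul_le_mul_of_nonneg_right h1 (sq_nonneg _)
      _ = _ := by ring
  have hVL := sq_int_nonneg hL1 (fun y => S.φ1 y - ℓ1 y)
  have hVR := sq_int_nonneg hL2 (fun y => S.φ1 y - ℓ1 y)
  have hQ := sq_int_nonneg S.LL (fun y => S.φ y - ℓ y)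
  have hVn := sq_int_nonneg S.LL (fun y => S.φ1 y - ℓ1 y)
  -- final comparison of U and U0
  have hUU : S.U ≤ 2 * ((∫ y in (-S.L)..S.L, (S.φ1 y - ℓ1 y) ^ 2) + S.κ ^ 2 * ∫ y in (-S.L)..S.L, (S.φ y - ℓ y) ^ 2) +
      2100000 * (K * A) ^ 2 := by
    have a1 : S.V2 ≤ 2 * (∫ y in (-S.L)..S.L, (S.φ1 y - ℓ1 y) ^ 2) + 2 * ∫ y in (-S.L)..S.L, ℓ1 y ^ 2 := by
      unfold InvS.V2
      rw [← icm, ← icm, ← iadd (by fun_prop) (by fun_prop)]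
      apply imono S.LL (by fun_prop) (by fun_prop)
      intro y _
      nlinarith [sq_nonneg (S.φ1 y - 2 * ℓ1 y)]
    have a2 : S.Q2 ≤ 2 * (∫ y in (-S.L)..S.L, (S.φ y - ℓ y) ^ 2) + 2 * ∫ y in (-S.L)..S.L, ℓ y ^ 2 := by
      unfold InvS.Q2
      rw [← icm, ← icm, ← iadd (by fun_prop) (by fun_prop)]
      apply imono S.LL (by fun_prop) (by fun_prop)
      intro y _
      nlinarith [sq_nonneg (S.φ y - 2 * ℓ y)]
    have a3 := supp_int S.LL hcl1 H.bℓ1 (H.sup2 H.zℓ1)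
    have a4 := supp_int S.LL hcl H.bℓ (H.sup2 H.zℓ)
    have a5 : S.κ ^ 2 ≤ 40000 := by have := H.hκ; have := S.hκ; nlinarith
    have a6 : S.κ ^ 2 * S.Q2 ≤ S.κ ^ 2 * (2 * (∫ y in (-S.L)..S.L, (S.φ y - ℓ y) ^ 2) + 2 * (25 * (K * A) ^ 2)) := by
      gcongr; linarith
    have a7 : S.κ ^ 2 * (K * A) ^ 2 ≤ 40000 * (K * A) ^ 2 := by gcongr
    have : 0 ≤ (K * A) ^ 2 := sq_nonneg _
    unfold InvS.U
    linarith
  set VL := ∫ y in (-S.L)..(-1), (S.φ1 y - ℓ1 y) ^ 2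
  set VR := ∫ y in (1:ℝ)..S.L, (S.φ1 y - ℓ1 y) ^ 2
  set Q := ∫ y in (-S.L)..S.L, (S.φ y - ℓ y) ^ 2
  set V0 := ∫ y in (-S.L)..S.L, (S.φ1 y - ℓ1 y) ^ 2
  have hκQ : 0 ≤ S.κ ^ 2 * Q := by positivity
  set D := VL + VR + S.κ ^ 2 * Q + DH with hD
  have hD0 : 0 ≤ D := by positivity
  have hI2 := H.I_le ht (by linarith) hG (D := D) (by linarith) (by linarith) (by linarith)
  set I := ∫ y in (-1:ℝ)..1, qf t y * (S.φ y - ℓ y)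
  have hDJ : D ≤ (9 * √(t * S.N2) + 1100 * (K * A)) * √(V0 + S.κ ^ 2 * Q) := by
    refine le_trans ?_ hJ
    linarith
  have hDu0 : V0 + S.κ ^ 2 * Q ≤ 10001 * D + 10000 * I ^ 2 := by linarith
  exact core_arith hK hd hA (mul_nonneg ht.le S.N2_nn) hD0 (by positivity) hI2 hDJ hDu0 hUU

lemma regS {d : ℝ} (hd : 0 < d) (hd1 : d ≤ 1/2) : ∃ C η : ℝ, 0 < C ∧ 0 < η ∧ η ≤ 1/2 ∧
    ∀ (S : InvS), 1 + d ≤ S.L → S.κ ≤ 200 → ∀ t : ℝ, 0 < t → t ≤ η →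
      S.G2 ≤ t ^ 2 * S.N2 → S.U ≤ C * (t * S.N2) := by
  obtain ⟨ρ, ρ1, C, hC, dρ, cρ1, ρ0, ρle, one, zρ, one1, zρ1, bρ1⟩ := cutoff hd hd1
  obtain ⟨Cc, hCc, hcore⟩ := CutD.core d (2 * (1 + C)) (by linarith) hd
  refine ⟨42 * Cc, min (1/2) (1 / (16 * Cc)), by positivity, by positivity, min_le_left _ _, ?_⟩
  intro S hL hκ t ht htη hG
  have ht1 : t ≤ 1/2 := htη.trans (min_le_left _ _)
  have ht2 : t * (16 * Cc) ≤ 1 := by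
    have := htη.trans (min_le_right _ _)
    rwa [le_div_iff₀ (by positivity)] at this
  set A := |S.φ 1| + |S.φ (-1)| with hA
  set a := (S.φ 1 + S.φ (-1)) / 2 with ha
  set b := (S.φ 1 - S.φ (-1)) / 2 with hb
  have hA0 : 0 ≤ A := by positivity
  have hal : |a| ≤ A / 2 := by
    rw [ha, abs_div, abs_two]; gcongr; exact abs_add_le _ _
  have hbl : |b| ≤ A / 2 := by
    rw [hb, abs_div, abs_two]; gcongr; exact abs_sub _ _
  have hlin : ∀ y, |y| ≤ 2 → |a + b * y| ≤ 3 / 2 * A := by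
    intro y hy
    refine (abs_add_le _ _).trans ?_
    rw [abs_mul]
    nlinarith [abs_nonneg b, abs_nonneg y]
  have bρ : ∀ y, |ρ y| ≤ 1 := fun y => by rw [abs_of_nonneg (ρ0 y)]; exact ρle y
  have H : CutD S d (2 * (1 + C)) A ρ ρ1 (fun y => (a + b * y) * ρ y)
      (fun y => b * ρ y + (a + b * y) * ρ1 y) := by
    refine ⟨hd, hd1, by linarith, hA0, hL, hκ, dρ, ?_, cρ1, ?_, bρ, fun y => (bρ1 y).trans (by linarith), ?_, ?_, one, one1,
      zρ, zρ1, fun y hy => by simp [zρ y hy], fun y hy => by simp [zρ y hy, zρ1 y hy], ?_, ?_⟩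
    · intro y
      have h1 : HasDerivAt (fun y => a + b * y) b y := by
        simpa using ((hasDerivAt_id y).const_mul b).const_add a
      exact h1.fun_mul (dρ y)
    · have : Continuous ρ := continuous_iff_continuousAt.2 fun y => (dρ y).continuousAt
      fun_prop
    · intro y
      by_cases h : |y| ≤ 2
      · rw [abs_mul]
        have h1 : |a + b * y| * |ρ y| ≤ (3 / 2 * A) * 1 :=
          mul_le_mul (hlin y h) (bρ y) (abs_nonneg _) (by positivity)
        nlinarith
      · rw [zρ y (by linarith)]; simp; positivity
    · intro y
      by_cases h : |y| ≤ 2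
      · refine (abs_add_le _ _).trans ?_
        rw [abs_mul, abs_mul]
        have h1 : |a + b * y| * |ρ1 y| ≤ (3 / 2 * A) * C :=
          mul_le_mul (hlin y h) (bρ1 y) (abs_nonneg _) (by positivity)
        have h2 : |b| * |ρ y| ≤ (A / 2) * 1 :=
          mul_le_mul hbl (bρ y) (abs_nonneg _) (by positivity)
        nlinarith [mul_nonneg hA0 hC.le]
      · rw [zρ y (by linarith), zρ1 y (by linarith)]; simp; positivity
    · simp [one 1 (by simp), ha, hb]; ring
    · simp [one (-1) (by simp), ha, hb]; ring
  have h := hcore S A _ _ _ _ H t ht ht1 hG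
  have h1 := S.S1 ht ht1 hG (by linarith)
  have h2 := S.S1m ht ht1 hG (by linarith)
  have h3 : A ^ 2 ≤ 20 * (t * S.N2) + 8 * (t * S.U) := by
    have := sq_abs (S.φ 1)
    have := sq_abs (S.φ (-1))
    nlinarith [sq_nonneg (|S.φ 1| - |S.φ (-1)|)]
  have h4 : Cc * (t * S.N2 + A ^ 2) ≤ Cc * (21 * (t * S.N2) + 8 * (t * S.U)) := by
    exact mul_le_mul_of_nonneg_left (by linarith) hCc.le
  have h5 : t * (16 * Cc) * S.U ≤ 1 * S.U := mul_le_mul_of_nonneg_right ht2 S.U_nn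
  nlinarith



lemma small_le {x c e : ℝ} (he : 0 < e) (h : ∀ t, 0 < t → t ≤ e → x ≤ t * c) : x ≤ 0 := by
  by_contra hx
  push Not at hx
  have h1 := h e he le_rfl
  have hc : 0 < c := by
    by_contra hc
    push Not at hc
    nlinarith
  have h2 := h (min e (x / (2 * c))) (by positivity) (min_le_left _ _)
  have h3 : min e (x / (2 * c)) * c ≤ x / (2 * c) * c := by gcongr; exact min_le_right _ _
  have h4 : x / (2 * c) * c = x / 2 := by field_simp
  linarith

namespace InvS
variable (S : InvS)

lemma phiw : ∫ y in (-S.L)..S.L, S.φ y * S.w y = -S.U := by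
  rw [S.parts S.d1 S.c1 S.bm S.bp]
  simp only [U, V2, Q2, sq]

lemma en_id {t : ℝ} (ht : 0 < t) (hG : S.G2 ≤ t ^ 2 * S.N2) : 2 * S.U ≤ (1 + t) * S.N2 := by
  have hcw := S.cw
  have hcφ := S.cφ
  have hcG := S.cG
  have e : 2 * S.U = ∫ y in (-S.L)..S.L, ((1 - y ^ 2) * S.w y ^ 2 - S.G y * S.w y) := by
    have h := S.phiw
    have : ∫ y in (-S.L)..S.L, ((1 - y ^ 2) * S.w y ^ 2 - S.G y * S.w y) =
        ∫ y in (-S.L)..S.L, (-2) * (S.φ y * S.w y) := by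
      congr 1; ext y; unfold G; ring
    rw [this, icm, h]; ring
  have h2 : 2 * S.U ≤ ∫ y in (-S.L)..S.L, ((1 + t / 2) * S.w y ^ 2 + (1 / (2 * t)) * S.G y ^ 2) := by
    rw [e]
    apply imono S.LL (by fun_prop) (by fun_prop)
    intro y _
    have h3 : -(S.G y * S.w y) ≤ t / 2 * S.w y ^ 2 + (1 / (2 * t)) * S.G y ^ 2 := by
      have : 0 ≤ (1 / (2 * t)) * (S.G y + t * S.w y) ^ 2 := by positivity
      have e2 : (1 / (2 * t)) * (S.G y + t * S.w y) ^ 2 = t / 2 * S.w y ^ 2 + (1 / (2 * t)) * S.G y ^ 2 + S.G y * S.w y := by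
        field_simp
        ring
      linarith
    nlinarith [mul_nonneg (sq_nonneg y) (sq_nonneg (S.w y))]
  rw [iadd (by fun_prop) (by fun_prop), icm, icm] at h2
  change _ ≤ (1 + t / 2) * S.N2 + 1 / (2 * t) * S.G2 at h2
  have h4 : 1 / (2 * t) * S.G2 ≤ 1 / (2 * t) * (t ^ 2 * S.N2) := by gcongr
  have h5 : 1 / (2 * t) * (t ^ 2 * S.N2) = t / 2 * S.N2 := by field_simp
  linarith

end InvS

lemma L1t : ∃ C : ℝ, 0 < C ∧ ∀ (S : InvS) (t : ℝ), 0 < t → S.G2 ≤ t ^ 2 * S.N2 → S.U ≤ C * (t * S.N2) := by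
  obtain ⟨C, η, hC, hη, hη1, h⟩ := regS (d := 1 / 1600000) (by norm_num) (by norm_num)
  refine ⟨C + 64000 + (1 / η + 1), by positivity, ?_⟩
  intro S t ht hG
  have hN : 0 ≤ t * S.N2 := mul_nonneg ht.le S.N2_nn
  have hη2 : 0 < 1 / η := by positivity
  have key : ∀ c, c ≤ C + 64000 + (1 / η + 1) → S.U ≤ c * (t * S.N2) →
      S.U ≤ (C + 64000 + (1 / η + 1)) * (t * S.N2) := fun c hc hu =>
    hu.trans (mul_le_mul_of_nonneg_right hc hN)
  rcases le_total t η with h1 | h1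
  · have ht1 : t ≤ 1 := by linarith
    rcases le_or_gt S.L 1 with hL | hL
    · exact key 6480 (by linarith) (S.regR3a ht ht1 hG hL)
    rcases le_total S.L (1 + 1 / 1600000) with hL1 | hL1
    · exact key 64000 (by linarith) (S.regR3b ht ht1 hG hL hL1)
    rcases le_total 200 S.κ with hκ | hκ
    · exact key 640 (by linarith) (S.regR ht ht1 hG hL hκ)
    · exact key C (by linarith) (h S hL1 hκ t ht h1 hG)
  · apply key (1 / η + 1) (by linarith)
    have h2 := S.en_id ht hG
    have h3 : S.N2 ≤ 1 / η * (t * S.N2) := by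
      rw [← mul_assoc]
      have : 1 ≤ 1 / η * t := by rw [one_div, inv_mul_eq_div, le_div_iff₀ hη]; linarith
      have := S.N2_nn
      nlinarith
    have := S.U_nn
    linarith

lemma L1 : ∃ C : ℝ, 0 < C ∧ ∀ S : InvS, S.U ≤ C * (√S.G2 * √S.N2) := by
  obtain ⟨C, hC, h⟩ := L1t
  refine ⟨C, hC, ?_⟩
  intro S
  have hN := S.N2_nn
  have hG := S.G2_nn
  rcases hG.eq_or_lt with hG0 | hG0
  · have : S.U ≤ 0 := small_le (c := C * S.N2) one_pos (fun t ht _ => by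
      have := h S t ht (by rw [← hG0]; positivity)
      linarith)
    refine this.trans (by positivity)
  rcases hN.eq_or_lt with hN0 | hN0
  · have h1 := cs_int S.LL S.cφ.continuousOn S.cw.continuousOn
    rw [S.phiw] at h1
    change _ ≤ _ * √S.N2 at h1
    rw [← hN0] at h1 ⊢
    simp at h1 ⊢
    rw [h1]
  · have h1 : 0 < √S.G2 := Real.sqrt_pos.2 hG0
    have h2 : 0 < √S.N2 := Real.sqrt_pos.2 hN0
    have h3 := h S (√S.G2 / √S.N2) (by positivity) (by
      rw [div_pow, Real.sq_sqrt hG, Real.sq_sqrt hN]; field_simp; rfl)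
    have e : √S.G2 / √S.N2 * S.N2 = √S.G2 * √S.N2 := by
      nth_rw 2 [← Real.mul_self_sqrt hN]
      field_simp
    rwa [e] at h3

namespace InvS
variable (S : InvS)

lemma phi1 (hL : 1 ≤ S.L) (hg : √S.G2 ≤ √S.N2 / 2) :
    S.φ 1 ^ 2 ≤ 5 * (√S.G2 * √S.N2) + S.U ∧ S.φ (-1) ^ 2 ≤ 5 * (√S.G2 * √S.N2) + S.U := by
  have hN := S.N2_nn
  have hG := S.G2_nn
  have hU := S.U_nn
  rcases hG.eq_or_lt with hG0 | hG0
  · constructor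
    · have : S.φ 1 ^ 2 ≤ 0 := small_le (e := 1/2) (c := 5 * S.N2 + 2 * S.U) (by norm_num) (fun t ht ht1 => by
        have := S.S1 ht ht1 (by rw [← hG0]; positivity) hL
        linarith)
      refine this.trans (by positivity)
    · have : S.φ (-1) ^ 2 ≤ 0 := small_le (e := 1/2) (c := 5 * S.N2 + 2 * S.U) (by norm_num) (fun t ht ht1 => by
        have := S.S1m ht ht1 (by rw [← hG0]; positivity) hL
        linarith)
      refine this.trans (by positivity)
  · have h1 : 0 < √S.G2 := Real.sqrt_pos.2 hG0
    have h2 : 0 < √S.N2 := by linarith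
    have ht : 0 < √S.G2 / √S.N2 := by positivity
    have ht1 : √S.G2 / √S.N2 ≤ 1 / 2 := by rw [div_le_iff₀ h2]; linarith
    have hN0 : 0 < S.N2 := Real.sqrt_pos.1 h2
    have hc : S.G2 ≤ (√S.G2 / √S.N2) ^ 2 * S.N2 := by
      rw [div_pow, Real.sq_sqrt hG, Real.sq_sqrt hN]; field_simp; rfl
    have e : √S.G2 / √S.N2 * S.N2 = √S.G2 * √S.N2 := by
      nth_rw 2 [← Real.mul_self_sqrt hN]
      field_simp
    have k1 := S.S1 ht ht1 hc hL
    have k2 := S.S1m ht ht1 hc hL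
    rw [e] at k1 k2
    have : √S.G2 / √S.N2 * S.U ≤ 1 / 2 * S.U := by gcongr
    constructor <;> linarith

end InvS

set_option maxHeartbeats 2000000 in
lemma L2 : ∃ C : ℝ, 0 < C ∧ ∀ (S : InvS) (T : ℝ) (v v1 : ℝ → ℝ), 0 < T → T ≤ 1 →
    (∀ y, HasDerivAt v (v1 y) y) → Continuous v1 → (∀ y ∈ Set.Icc (-S.L) S.L, v y = S.w y) →
    v (-S.L) = 0 →
    S.N2 ≤ C * (S.G2 / T ^ 2 + √S.G2 * √S.N2 / T + √S.N2 * √(∫ y in (-S.L)..S.L, v1 y ^ 2) * T) := by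
  obtain ⟨C, hC, h⟩ := L1
  refine ⟨2000 + 640 * C, by positivity, ?_⟩
  intro S T v v1 hT hT1 hv hv1 hvw hv0
  have hU := h S
  have hUn := S.U_nn
  have hN := S.N2_nn
  have hG := S.G2_nn
  have hcv : Continuous v := continuous_iff_continuousAt.2 fun y => (hv y).continuousAt
  set g := √S.G2 with hg
  set n := √S.N2 with hn
  have hg2 : g ^ 2 = S.G2 := Real.sq_sqrt hG
  have hn2 : n ^ 2 = S.N2 := Real.sq_sqrt hN
  have hg0 : 0 ≤ g := Real.sqrt_nonneg _
  have hn0 : 0 ≤ n := Real.sqrt_nonneg _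
  set δ := √(∫ y in (-S.L)..S.L, v1 y ^ 2) with hδ
  have hδ0 : 0 ≤ δ := Real.sqrt_nonneg _
  have p1 : 0 ≤ S.G2 / T ^ 2 := by positivity
  have p2 : 0 ≤ g * n / T := by positivity
  have p3 : 0 ≤ n * δ * T := by positivity
  rcases le_total (n / 2) g with hc | hc
  · have h1 : S.N2 ≤ 4 * S.G2 := by rw [← hg2, ← hn2]; nlinarith
    have h2 : S.G2 ≤ S.G2 / T ^ 2 := by
      rw [le_div_iff₀ (by positivity)]
      have : T ^ 2 ≤ 1 := by nlinarith
      nlinarith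
    have h3 : 0 ≤ C * (S.G2 / T ^ 2 + g * n / T + n * δ * T) := by positivity
    nlinarith
  have hcw := S.cw
  have hcφ := S.cφ
  have hcG := S.cG
  have hcW : ∀ (f : ℝ → ℝ), Continuous f → Continuous (fun y => f y / ((1 - y ^ 2) ^ 2 + T ^ 2)) := by
    intro f hf
    exact hf.div (by fun_prop) (fun y => (Wt_pos hT y).ne')
  have hX : ∫ y in (-S.L)..S.L, S.φ y ^ 2 / ((1 - y ^ 2) ^ 2 + T ^ 2) ≤ 40 * ((5 * (g * n) + S.U) + S.V2) / T := by
    apply Xf S.hL hT hT1 hcφ _ (by positivity) S.V2_nn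
    intro y hy
    have hVn := S.V2_nn
    have pp : 0 ≤ 5 * (g * n) + S.U := by positivity
    rcases le_total S.L 1 with hL | hL
    · have h1 := S.abs_hold hy
      have h2 : S.L - |y| ≤ |(|y| - 1)| := by
        rw [abs_sub_comm]; exact le_trans (by linarith) (le_abs_self _)
      have h3 : (S.L - |y|) * S.V2 ≤ |(|y| - 1)| * S.V2 := by gcongr
      have : 0 ≤ |(|y| - 1)| * S.V2 := by positivity
      nlinarith
    · obtain ⟨k1, k2⟩ := S.phi1 hL hc
      rcases le_total 0 y with hy0 | hy0
      · have h1 := S.hold (x := 1) (y := y) ⟨by linarith, by linarith⟩ hy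
        rw [abs_of_nonneg hy0]
        nlinarith [sq_nonneg (S.φ y - 2 * S.φ 1)]
      · have h1 := S.hold (x := -1) (y := y) ⟨by linarith, by linarith⟩ hy
        rw [abs_of_nonpos hy0]
        rw [show y - -1 = -(-y - 1) by ring, abs_neg] at h1
        nlinarith [sq_nonneg (S.φ y - 2 * S.φ (-1))]
  have h1X : ∫ y in (-S.L)..S.L, (1:ℝ) ^ 2 / ((1 - y ^ 2) ^ 2 + T ^ 2) ≤ 40 * (1/2 + 0) / T := by
    apply Xf (f := fun _ => 1) S.hL hT hT1 continuous_const _ (by norm_num) le_rfl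
    intro y _; norm_num
  have hvN : ∫ y in (-S.L)..S.L, v y ^ 2 = S.N2 := by
    apply intervalIntegral.integral_congr
    intro y hy
    rw [Set.uIcc_of_le S.LL] at hy
    simp [hvw y hy]
  have hmain : S.N2 ≤ ∫ y in (-S.L)..S.L, ((2 / T ^ 2) * S.G y ^ 2 +
      8 * (S.φ y ^ 2 / ((1 - y ^ 2) ^ 2 + T ^ 2)) + (T ^ 2 * (2 * (n * δ))) * ((1:ℝ) ^ 2 / ((1 - y ^ 2) ^ 2 + T ^ 2))) := by
    have c1 := hcW (fun y => S.φ y ^ 2) (by fun_prop)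
    have c2 := hcW (fun y => (1:ℝ) ^ 2) (by fun_prop)
    apply imono S.LL (by fun_prop) (by fun_prop)
    intro y hy
    change S.w y ^ 2 ≤ (2 / T ^ 2) * S.G y ^ 2 +
      8 * (S.φ y ^ 2 / ((1 - y ^ 2) ^ 2 + T ^ 2)) + (T ^ 2 * (2 * (n * δ))) * ((1:ℝ) ^ 2 / ((1 - y ^ 2) ^ 2 + T ^ 2))
    have hp := Wt_pos hT y
    have hs := sup_sq hv hv1 hv0 hy
    rw [hvN, hvw y hy] at hs
    change _ ≤ 2 * (n * δ) at hs
    set Z := (1 - y ^ 2) ^ 2 + T ^ 2 with hZ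
    have hx : ((1 - y ^ 2) * S.w y) ^ 2 ≤ 2 * S.G y ^ 2 + 8 * S.φ y ^ 2 := by
      have : (1 - y ^ 2) * S.w y = S.G y - 2 * S.φ y := by unfold InvS.G; ring
      rw [this]; nlinarith [sq_nonneg (S.G y + 2 * S.φ y)]
    have e : S.w y ^ 2 = ((1 - y ^ 2) * S.w y) ^ 2 / Z + T ^ 2 * S.w y ^ 2 / Z := by
      rw [← add_div, eq_div_iff hp.ne', hZ]; ring
    rw [e]
    have k1 : ((1 - y ^ 2) * S.w y) ^ 2 / Z ≤ (2 * S.G y ^ 2 + 8 * S.φ y ^ 2) / Z := by gcongr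
    have k2 : T ^ 2 * S.w y ^ 2 / Z ≤ T ^ 2 * (2 * (n * δ)) / Z := by gcongr
    have k3 : 2 * S.G y ^ 2 / Z ≤ 2 * S.G y ^ 2 / T ^ 2 := by
      gcongr; rw [hZ]; exact le_add_of_nonneg_left (sq_nonneg _)
    calc _ ≤ (2 * S.G y ^ 2 + 8 * S.φ y ^ 2) / Z + T ^ 2 * (2 * (n * δ)) / Z := add_le_add k1 k2
      _ = 2 * S.G y ^ 2 / Z + 8 * (S.φ y ^ 2 / Z) + T ^ 2 * (2 * (n * δ)) * (1 ^ 2 / Z) := by ring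
      _ ≤ 2 * S.G y ^ 2 / T ^ 2 + 8 * (S.φ y ^ 2 / Z) + T ^ 2 * (2 * (n * δ)) * (1 ^ 2 / Z) := by linarith
      _ = _ := by ring
  have c1 := hcW (fun y => S.φ y ^ 2) (by fun_prop)
  have c2 := hcW (fun y => (1:ℝ) ^ 2) (by fun_prop)
  rw [iadd (by fun_prop) (by fun_prop), iadd (by fun_prop) (by fun_prop), icm, icm, icm] at hmain
  change _ ≤ (2 / T ^ 2) * S.G2 + _ + _ at hmain
  have f1 : 8 * (∫ y in (-S.L)..S.L, S.φ y ^ 2 / ((1 - y ^ 2) ^ 2 + T ^ 2)) ≤ 8 * (40 * ((5 + 2 * C) * (g * n)) / T) := by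
    have : S.V2 ≤ S.U := S.V2_le
    refine mul_le_mul_of_nonneg_left (hX.trans ?_) (by norm_num)
    gcongr
    linarith
  have f2 : T ^ 2 * (2 * (n * δ)) * (∫ y in (-S.L)..S.L, (1:ℝ) ^ 2 / ((1 - y ^ 2) ^ 2 + T ^ 2)) ≤
      T ^ 2 * (2 * (n * δ)) * (40 * (1/2 + 0) / T) := by gcongr
  have e1 : T ^ 2 * (2 * (n * δ)) * (40 * (1/2 + 0) / T) = 40 * (n * δ * T) := by field_simp; ring
  have e2 : 8 * (40 * ((5 + 2 * C) * (g * n)) / T) = (1600 + 640 * C) * (g * n / T) := by ring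
  have e3 : (2 / T ^ 2) * S.G2 = 2 * (S.G2 / T ^ 2) := by ring
  rw [e1] at f2
  rw [e2] at f1
  rw [e3] at hmain
  have q1 : 0 ≤ C * (S.G2 / T ^ 2) := by positivity
  have q3 : 0 ≤ C * (n * δ * T) := by positivity
  have r : (2000 + 640 * C) * (S.G2 / T ^ 2 + g * n / T + n * δ * T) =
      2000 * (S.G2 / T ^ 2) + 640 * (C * (S.G2 / T ^ 2)) + (2000 + 640 * C) * (g * n / T) + 2000 * (n * δ * T) + 640 * (C * (n * δ * T)) := by ring
  rw [r]
  have r2 : (2000 + 640 * C) * (g * n / T) = (1600 + 640 * C) * (g * n / T) + 400 * (g * n / T) := by ring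
  rw [r2]
  linarith



lemma int_scale {b : ℝ} (hb : 0 < b) (f : ℝ → ℝ) :
    ∫ z in (-(1 / b))..(1 / b), f (b * z) = (1 / b) * ∫ y in (-1:ℝ)..1, f y := by
  rw [intervalIntegral.integral_comp_mul_left f hb.ne']
  rw [show b * -(1 / b) = -1 by field_simp, show b * (1 / b) = 1 by field_simp]
  simp

lemma der_scale {f f1 : ℝ → ℝ} (b : ℝ) (h : ∀ y, HasDerivAt f (f1 y) y) (z : ℝ) :
    HasDerivAt (fun z => f (b * z)) (b * f1 (b * z)) z := by
  have h1 : HasDerivAt (fun z : ℝ => b * z) b z := by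
    simpa using (hasDerivAt_id z).const_mul b
  have := (h (b * z)).scomp z h1
  simpa [Function.comp_def] using this

/-- real data on the unit interval -/
structure RD where
  κ : ℝ
  φ : ℝ → ℝ
  φ1 : ℝ → ℝ
  φ2 : ℝ → ℝ
  hκ : 1 ≤ κ
  d1 : ∀ y, HasDerivAt φ (φ1 y) y
  d2 : ∀ y, HasDerivAt φ1 (φ2 y) y
  c2 : Continuous φ2
  bm : φ (-1) = 0
  bp : φ 1 = 0

namespace RD
variable (R : RD)
def w (y : ℝ) : ℝ := R.φ2 y - R.κ ^ 2 * R.φ y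
def G (a y : ℝ) : ℝ := (a - y ^ 2) * R.w y + 2 * R.φ y

lemma cφ : Continuous R.φ := continuous_iff_continuousAt.2 fun y => (R.d1 y).continuousAt
lemma c1 : Continuous R.φ1 := continuous_iff_continuousAt.2 fun y => (R.d2 y).continuousAt
lemma cw : Continuous R.w := by
  have := R.c2; have := R.cφ; unfold w; fun_prop
lemma cG (a : ℝ) : Continuous (R.G a) := by
  have := R.cw; have := R.cφ; unfold G; fun_prop

/-- rescaled data -/
def toInv {b : ℝ} (hb : 0 < b) : InvS where
  L := 1 / b
  κ := R.κ * b
  φ := fun z => R.φ (b * z)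
  φ1 := fun z => b * R.φ1 (b * z)
  φ2 := fun z => b * (b * R.φ2 (b * z))
  hL := by positivity
  hκ := mul_pos (by linarith [R.hκ]) hb
  hκL := by
    rw [show R.κ * b * (1 / b) = R.κ by field_simp]; exact R.hκ
  d1 := der_scale b R.d1
  d2 := fun z => (der_scale b R.d2 z).const_mul b
  c2 := by have := R.c2; fun_prop
  bm := by
    change R.φ (b * -(1 / b)) = 0
    rw [show b * -(1 / b) = -1 by field_simp]; exact R.bm
  bp := by
    change R.φ (b * (1 / b)) = 0
    rw [show b * (1 / b) = 1 by field_simp]; exact R.bp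

variable {b : ℝ} (hb : 0 < b)

lemma tw (z : ℝ) : (R.toInv hb).w z = b ^ 2 * R.w (b * z) := by
  unfold InvS.w w; simp only [toInv]; ring

lemma tG (z : ℝ) : (R.toInv hb).G z = R.G (b ^ 2) (b * z) := by
  unfold InvS.G; rw [tw]; unfold G; simp only [toInv]; ring

lemma tN2 : (R.toInv hb).N2 = b ^ 3 * ∫ y in (-1:ℝ)..1, R.w y ^ 2 := by
  unfold InvS.N2
  simp only [tw]
  have := int_scale hb (fun y => (b ^ 2 * R.w y) ^ 2)
  change ∫ z in (-(1 / b))..(1 / b), (b ^ 2 * R.w (b * z)) ^ 2 = _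
  rw [this]
  rw [show (fun y => (b ^ 2 * R.w y) ^ 2) = fun y => b ^ 4 * R.w y ^ 2 by ext y; ring, icm]
  field_simp

lemma tG2 : (R.toInv hb).G2 = (1 / b) * ∫ y in (-1:ℝ)..1, R.G (b ^ 2) y ^ 2 := by
  unfold InvS.G2
  simp only [tG]
  exact int_scale hb (fun y => (R.G (b ^ 2) y) ^ 2)

lemma tU : (R.toInv hb).U = b * ((∫ y in (-1:ℝ)..1, R.φ1 y ^ 2) + R.κ ^ 2 * ∫ y in (-1:ℝ)..1, R.φ y ^ 2) := by
  unfold InvS.U InvS.V2 InvS.Q2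
  have h1 := int_scale hb (fun y => (b * R.φ1 y) ^ 2)
  have h2 := int_scale hb (fun y => (R.φ y) ^ 2)
  change (∫ z in (-(1 / b))..(1 / b), (b * R.φ1 (b * z)) ^ 2) + (R.κ * b) ^ 2 * (∫ z in (-(1 / b))..(1 / b), R.φ (b * z) ^ 2) = _
  rw [h1, h2]
  rw [show (fun y => (b * R.φ1 y) ^ 2) = fun y => b ^ 2 * R.φ1 y ^ 2 by ext y; ring, icm]
  field_simp
end RD

lemma L1s : ∃ C : ℝ, 0 < C ∧ ∀ (R : RD) (a : ℝ), 0 < a →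
    (∫ y in (-1:ℝ)..1, R.φ1 y ^ 2) + R.κ ^ 2 * (∫ y in (-1:ℝ)..1, R.φ y ^ 2) ≤
      C * (√(∫ y in (-1:ℝ)..1, R.G a y ^ 2) * √(∫ y in (-1:ℝ)..1, R.w y ^ 2)) := by
  obtain ⟨C, hC, h⟩ := L1
  refine ⟨C, hC, ?_⟩
  intro R a ha
  have hb : 0 < √a := Real.sqrt_pos.2 ha
  have hb2 : √a ^ 2 = a := Real.sq_sqrt ha.le
  have := h (R.toInv hb)
  rw [R.tU, R.tG2, R.tN2, hb2] at this
  rw [Real.sqrt_mul (by positivity), Real.sqrt_mul (by positivity)] at this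
  have e : √(1 / √a) * √(√a ^ 3) = √a := by
    rw [← Real.sqrt_mul (by positivity), show 1 / √a * √a ^ 3 = √a ^ 2 by field_simp, Real.sqrt_sq hb.le]
  set X := √(∫ y in (-1:ℝ)..1, R.G a y ^ 2)
  set Y := √(∫ y in (-1:ℝ)..1, R.w y ^ 2)
  have e2 : C * (√(1 / √a) * X * (√(√a ^ 3) * Y)) = √a * (C * (X * Y)) := by
    rw [show C * (√(1 / √a) * X * (√(√a ^ 3) * Y)) = (√(1 / √a) * √(√a ^ 3)) * (C * (X * Y)) by ring, e]
  rw [e2] at this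
  exact le_of_mul_le_mul_left this hb

lemma L2s : ∃ C : ℝ, 0 < C ∧ ∀ (R : RD) (a T : ℝ) (v v1 : ℝ → ℝ), 0 < a → 0 < T → T ≤ a →
    (∀ y, HasDerivAt v (v1 y) y) → Continuous v1 → (∀ y ∈ Set.Icc (-1:ℝ) 1, v y = R.w y) →
    v (-1) = 0 →
    (∫ y in (-1:ℝ)..1, R.w y ^ 2) ≤ C * ((∫ y in (-1:ℝ)..1, R.G a y ^ 2) / T ^ 2 +
      √(∫ y in (-1:ℝ)..1, R.G a y ^ 2) * √(∫ y in (-1:ℝ)..1, R.w y ^ 2) / T +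
      √(∫ y in (-1:ℝ)..1, R.w y ^ 2) * √(∫ y in (-1:ℝ)..1, v1 y ^ 2) * (T / √a)) := by
  obtain ⟨C, hC, h⟩ := L2
  refine ⟨C, hC, ?_⟩
  intro R a T v v1 ha hT hTa hv hv1 hvw hv0
  have hb : 0 < √a := Real.sqrt_pos.2 ha
  have hb2 : √a ^ 2 = a := Real.sq_sqrt ha.le
  set b := √a with hbd
  have hint : ∫ y in (-(1 / b))..(1 / b), (b ^ 2 * (b * v1 (b * y))) ^ 2 = b ^ 5 * ∫ y in (-1:ℝ)..1, v1 y ^ 2 := by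
    have := int_scale hb (fun y => (b ^ 2 * (b * v1 y)) ^ 2)
    rw [this]
    rw [show (fun y => (b ^ 2 * (b * v1 y)) ^ 2) = fun y => b ^ 6 * v1 y ^ 2 by ext y; ring, icm]
    field_simp
  have := h (R.toInv hb) (T / a) (fun z => b ^ 2 * v (b * z)) (fun z => b ^ 2 * (b * v1 (b * z))) (by positivity)
    ((div_le_one ha).2 hTa) (fun z => (der_scale b hv z).const_mul _) (by fun_prop) ?_ ?_
  · change _ ≤ C * (_ + _ + _ * √(∫ y in (-(1 / b))..(1 / b), (b ^ 2 * (b * v1 (b * y))) ^ 2) * _) at this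
    rw [hint, R.tG2, R.tN2, hb2] at this
    rw [Real.sqrt_mul (by positivity), Real.sqrt_mul (by positivity), Real.sqrt_mul (by positivity)] at this
    have e : √(1 / b) * √(b ^ 3) = b := by
      rw [← Real.sqrt_mul (by positivity), show 1 / b * b ^ 3 = b ^ 2 by field_simp, Real.sqrt_sq hb.le]
    have e' : √(b ^ 3) * √(b ^ 5) = b ^ 4 := by
      rw [← Real.sqrt_mul (by positivity), show b ^ 3 * b ^ 5 = (b ^ 4) ^ 2 by ring, Real.sqrt_sq (by positivity)]
    set X2 := ∫ y in (-1:ℝ)..1, R.G a y ^ 2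
    set Y2 := ∫ y in (-1:ℝ)..1, R.w y ^ 2
    set Z := √(∫ y in (-1:ℝ)..1, v1 y ^ 2)
    have e2 : C * (1 / b * X2 / (T / a) ^ 2 + √(1 / b) * √X2 * (√(b ^ 3) * √Y2) / (T / a) +
       √(b ^ 3) * √Y2 * (√(b ^ 5) * Z) * (T / a)) = b ^ 3 * (C * (X2 / T ^ 2 + √X2 * √Y2 / T + √Y2 * Z * (T / b))) := by
      rw [show √(1 / b) * √X2 * (√(b ^ 3) * √Y2) = (√(1 / b) * √(b ^ 3)) * (√X2 * √Y2) by ring, e,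
        show √(b ^ 3) * √Y2 * (√(b ^ 5) * Z) = (√(b ^ 3) * √(b ^ 5)) * (√Y2 * Z) by ring, e', ← hb2]
      field_simp
    rw [e2] at this
    exact le_of_mul_le_mul_left this (by positivity)
  · intro y hy
    rw [R.tw]
    change y ∈ Set.Icc (-(1 / b)) (1 / b) at hy
    have : b * y ∈ Set.Icc (-1:ℝ) 1 := by
      constructor
      · have := mul_le_mul_of_nonneg_left hy.1 hb.le
        rwa [show b * -(1 / b) = -1 by field_simp] at this
      · have := mul_le_mul_of_nonneg_left hy.2 hb.le
        rwa [show b * (1 / b) = 1 by field_simp] at this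
    simp only [hvw _ this]
  · change b ^ 2 * v (b * -(1 / b)) = 0
    rw [show b * -(1 / b) = -1 by field_simp, hv0, mul_zero]



lemma le_two {Y T : ℝ} (hT : 0 ≤ T) (h : Y ^ 3 ≤ 2 * T ^ 3) : Y ≤ 2 * T := by
  by_contra hc
  push Not at hc
  have h1 : (2 * T) ^ 3 < Y ^ 3 := by gcongr
  nlinarith [pow_nonneg hT 3]

/-- closing step for the main case -/
lemma close_x {x f g P q ε θ C : ℝ} (hx : 0 ≤ x) (hf : 0 ≤ f) (hg : 0 ≤ g) (hP : 0 ≤ P) (hq : 0 ≤ q)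
    (hε : 0 ≤ ε) (hC : 0 < C) (hθ : 0 < θ) (hθ1 : θ ≤ 1) (hθC : 60 * C * θ < 1) (hεθ : ε ≤ θ ^ 4)
    (p : P ^ 2 ≤ x ^ 2 * ((x + f) * (f + ε * x)))
    (hg2 : g ^ 2 ≤ 3 * (2 * f ^ 2 + 4 * P + 2 * ε * x * f + 3 * ε ^ 2 * x ^ 2))
    (hq2 : q ^ 2 ≤ x * (f + ε * x)) (hm : x ^ 2 ≤ C * (g ^ 2 + g * x + x * q)) :
    x * θ ^ 4 ≤ f := by
  by_contra hc
  push Not at hc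
  have hx0 : 0 < x := by
    rcases hx.eq_or_lt with h | h
    · rw [← h] at hc; linarith
    · exact h
  have t1 : θ ^ 4 ≤ 1 := pow_le_one₀ hθ.le hθ1
  have t2 : θ ^ 4 ≤ θ ^ 2 := pow_le_pow_of_le_one hθ.le hθ1 (by norm_num)
  have hfx : f ≤ x := by nlinarith
  have hεx : ε * x ≤ θ ^ 4 * x := by gcongr
  have hs : f + ε * x ≤ 2 * θ ^ 4 * x := by linarith
  have hs0 : 0 ≤ f + ε * x := by positivity
  have q1 : q ≤ 2 * θ ^ 2 * x := by
    apply le_of_sq_le_sq _ (by positivity)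
    have : x * (f + ε * x) ≤ x * (2 * θ ^ 4 * x) := by gcongr
    nlinarith [mul_nonneg (pow_nonneg hθ.le 4) (sq_nonneg x)]
  have p1 : P ≤ 2 * θ ^ 2 * x ^ 2 := by
    apply le_of_sq_le_sq _ (by positivity)
    have : x ^ 2 * ((x + f) * (f + ε * x)) ≤ x ^ 2 * ((x + x) * (2 * θ ^ 4 * x)) := by gcongr
    nlinarith
  have g1 : g ≤ 7 * θ * x := by
    apply le_of_sq_le_sq _ (by positivity)
    have f1 : f ^ 2 ≤ θ ^ 2 * x ^ 2 := by
      have : f * f ≤ (x * θ ^ 4) * x := by gcongr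
      nlinarith [mul_le_mul_of_nonneg_right t2 (sq_nonneg x)]
    have f2 : ε * x * f ≤ θ ^ 2 * x ^ 2 := by
      have : ε * x * f ≤ (θ ^ 4 * x) * x := by gcongr
      nlinarith [mul_le_mul_of_nonneg_right t2 (sq_nonneg x)]
    have f3 : ε ^ 2 * x ^ 2 ≤ θ ^ 2 * x ^ 2 := by
      have h1 : ε ^ 2 ≤ ε * 1 := by rw [sq]; gcongr; linarith
      exact mul_le_mul_of_nonneg_right (by linarith) (sq_nonneg x)
    nlinarith
  have hfin : g ^ 2 + g * x + x * q ≤ 60 * θ * x ^ 2 := by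
    have a1 : g ^ 2 ≤ (7 * θ * x) ^ 2 := by gcongr
    have a2 : g * x ≤ 7 * θ * x * x := by gcongr
    have a3 : x * q ≤ x * (2 * θ ^ 2 * x) := by gcongr
    have a4 : θ ^ 2 * x ^ 2 ≤ θ * x ^ 2 := by
      gcongr; nlinarith
    nlinarith [mul_nonneg hθ.le (sq_nonneg x)]
  have : C * (g ^ 2 + g * x + x * q) ≤ C * (60 * θ * x ^ 2) := by gcongr
  have h3 : 60 * C * θ * x ^ 2 < 1 * x ^ 2 := by gcongr
  nlinarith




set_option maxHeartbeats 1000000 in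
lemma caseA {r ε a f N D E y l g U T C1 C2 θ : ℝ} (hr : 0 < r) (hε : 0 ≤ ε)
    (hf : 0 ≤ f) (hN : 0 ≤ N) (hD : 0 ≤ D) (hy : 0 ≤ y) (hl : 0 ≤ l) (hg : 0 ≤ g) (hU : 0 ≤ U)
    (hC1 : 0 < C1) (hC2 : 0 < C2) (hθ : 0 < θ) (hθ1 : θ ≤ 1) (hθC : 60 * C2 * θ < 1) (hεθ : ε ≤ θ ^ 4)
    (hDE : D ^ 2 ≤ E)
    (h1 : r ^ 2 * E ≤ f * N + ε * r * N ^ 2)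
    (h2 : y ^ 2 ≤ a * N ^ 2 + f * N)
    (h3 : r ^ 2 * l ^ 2 ≤ f * l + 2 * (y * D) + ε * r * E)
    (h4 : g ^ 2 ≤ 3 * (f ^ 2 + (r ^ 2 * l) ^ 2 + (ε * r * N) ^ 2))
    (h6 : U ≤ C1 * (g * N)) (hT : 0 < T) (hT3 : T ^ 3 = r ^ 2 * a) (hrT : r ≤ T) (ha : 0 < a)
    (h7 : N ^ 2 ≤ C2 * (g ^ 2 / T ^ 2 + g * N / T + N * D * (T / √a))) :
    T * U ≤ 7 * C1 / θ ^ 8 * f ^ 2 := by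
  have hb : 0 < √a := Real.sqrt_pos.2 ha
  have hb2 : √a ^ 2 = a := Real.sq_sqrt ha.le
  obtain ⟨x, hx⟩ : ∃ x, x = T * N := ⟨_, rfl⟩
  have hx0 : 0 ≤ x := by rw [hx]; positivity
  have hrN : r * N ≤ x := by rw [hx]; gcongr
  have hrN0 : 0 ≤ r * N := by positivity
  have hr2 : r ^ 2 ≤ T ^ 2 := by gcongr
  -- E bound
  have hE : r ^ 2 * D ^ 2 ≤ N * (f + ε * (r * N)) := by
    have := mul_le_mul_of_nonneg_left hDE (sq_nonneg r)
    linarith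
  have hεx : ε * (r * N) ≤ ε * x := by gcongr
  have hS0 : 0 ≤ f + ε * (r * N) := by positivity
  have hS1 : 0 ≤ f + ε * x := by positivity
  -- P
  have p : (r ^ 2 * (y * D)) ^ 2 ≤ x ^ 2 * ((x + f) * (f + ε * x)) := by
    have e : (r ^ 2 * (y * D)) ^ 2 = (r ^ 2 * y ^ 2) * (r ^ 2 * D ^ 2) := by ring
    rw [e]
    have k1 : (r ^ 2 * y ^ 2) * (r ^ 2 * D ^ 2) ≤ (r ^ 2 * (a * N ^ 2 + f * N)) * (N * (f + ε * x)) := by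
      apply mul_le_mul
      · gcongr
      · exact hE.trans (by gcongr)
      · positivity
      · positivity
    have k2 : (r ^ 2 * (a * N ^ 2 + f * N)) * N ≤ x ^ 2 * (x + f) := by
      have : r ^ 2 * (f * N ^ 2) ≤ T ^ 2 * (f * N ^ 2) := by gcongr
      calc (r ^ 2 * (a * N ^ 2 + f * N)) * N = (r ^ 2 * a) * N ^ 3 + r ^ 2 * (f * N ^ 2) := by ring
        _ ≤ T ^ 3 * N ^ 3 + T ^ 2 * (f * N ^ 2) := by rw [hT3]; linarith
        _ = _ := by rw [hx]; ring
    calc _ ≤ _ := k1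
      _ = (r ^ 2 * (a * N ^ 2 + f * N)) * N * (f + ε * x) := by ring
      _ ≤ x ^ 2 * (x + f) * (f + ε * x) := by gcongr
      _ = _ := by ring
  have hg2 : g ^ 2 ≤ 3 * (2 * f ^ 2 + 4 * (r ^ 2 * (y * D)) + 2 * ε * x * f + 3 * ε ^ 2 * x ^ 2) := by
    have k1 : (r ^ 2 * l) ^ 2 ≤ f * (r ^ 2 * l) + 2 * (r ^ 2 * (y * D)) + ε * r * (r ^ 2 * E) := by
      have := mul_le_mul_of_nonneg_left h3 (sq_nonneg r)
      linarith
    have k2 : ε * r * (r ^ 2 * E) ≤ ε * x * f + ε ^ 2 * x ^ 2 := by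
      have m1 : ε * r * (r ^ 2 * E) ≤ ε * r * (f * N + ε * r * N ^ 2) := by gcongr
      have m2 : ε * r * (f * N + ε * r * N ^ 2) = ε * f * (r * N) + ε ^ 2 * (r * N) ^ 2 := by ring
      have m3 : ε * f * (r * N) ≤ ε * f * x := by gcongr
      have m4 : ε ^ 2 * (r * N) ^ 2 ≤ ε ^ 2 * x ^ 2 := by gcongr
      linarith
    have k3 : (ε * r * N) ^ 2 ≤ ε ^ 2 * x ^ 2 := by
      have m4 : ε ^ 2 * (r * N) ^ 2 ≤ ε ^ 2 * x ^ 2 := by gcongr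
      calc _ = ε ^ 2 * (r * N) ^ 2 := by ring
        _ ≤ _ := m4
    have k4 := two_mul_le_add_sq f (r ^ 2 * l)
    linarith
  -- q
  obtain ⟨q, hq⟩ : ∃ q, q = D * (T ^ 2 / √a) := ⟨_, rfl⟩
  have hq0 : 0 ≤ q := by rw [hq]; positivity
  have hq2 : q ^ 2 ≤ x * (f + ε * x) := by
    have e : q ^ 2 = T * (r ^ 2 * D ^ 2) := by
      rw [hq, mul_pow, div_pow, hb2]
      have : (T ^ 2) ^ 2 = T * (r ^ 2 * a) := by rw [← hT3]; ring
      rw [this]; field_simp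
    rw [e]
    calc T * (r ^ 2 * D ^ 2) ≤ T * (N * (f + ε * x)) := by
          apply mul_le_mul_of_nonneg_left (hE.trans _) hT.le
          gcongr
      _ = _ := by rw [hx]; ring
  have hm : x ^ 2 ≤ C2 * (g ^ 2 + g * x + x * q) := by
    have := mul_le_mul_of_nonneg_left h7 (sq_nonneg T)
    calc x ^ 2 = T ^ 2 * N ^ 2 := by rw [hx]; ring
      _ ≤ _ := this
      _ = _ := by rw [hq, hx]; field_simp
  have hP0 : 0 ≤ r ^ 2 * (y * D) := by positivity
  have key := close_x hx0 hf hg hP0 hq0 hε hC2 hθ hθ1 hθC hεθ p hg2 hq2 hm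
  have ht1 : θ ^ 4 ≤ 1 := pow_le_one₀ hθ.le hθ1
  have hε1 : ε ≤ 1 := hεθ.trans ht1
  have ht4 : 0 < θ ^ 4 := by positivity
  obtain ⟨B, hB⟩ : ∃ B, B = f / θ ^ 4 := ⟨_, rfl⟩
  have hxB : x ≤ B := by rw [hB, le_div_iff₀ ht4]; exact key
  have hfB : f ≤ B := by rw [hB, le_div_iff₀ ht4]; exact mul_le_of_le_one_right hf ht1
  have hB0 : 0 ≤ B := hf.trans hfB
  have hPB : r ^ 2 * (y * D) ≤ 2 * B ^ 2 := by
    apply le_of_sq_le_sq _ (by positivity)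
    have : x ^ 2 * ((x + f) * (f + ε * x)) ≤ B ^ 2 * ((B + B) * (B + 1 * B)) := by gcongr
    linarith
  have hgB : g ≤ 7 * B := by
    apply le_of_sq_le_sq _ (by positivity)
    have a1 : f ^ 2 ≤ B ^ 2 := by gcongr
    have a2 : ε * x * f ≤ 1 * B * B := by gcongr
    have a3 : ε ^ 2 * x ^ 2 ≤ 1 ^ 2 * B ^ 2 := by gcongr
    linarith
  calc T * U ≤ T * (C1 * (g * N)) := by gcongr
    _ = C1 * (g * x) := by rw [hx]; ring
    _ ≤ C1 * (7 * B * B) := by gcongr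
    _ = _ := by rw [hB]; field_simp

lemma caseB {r ε a f N D y U E : ℝ} (hr : 0 < r) (hε : 0 ≤ ε) (hε1 : ε ≤ 1 / 16) (ha : a ≤ r)
    (hf : 0 ≤ f) (hN : 0 ≤ N) (hD : 0 ≤ D) (hy : 0 ≤ y) (hU : 0 ≤ U)
    (hDE : D ^ 2 ≤ E)
    (h1 : r ^ 2 * E ≤ f * N + ε * r * N ^ 2)
    (h2 : y ^ 2 + 2 * U ≤ a * N ^ 2 + f * N) (h5 : N ^ 2 ≤ 2 * (y * D)) :
    r * U ≤ 55 * f ^ 2 := by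
  obtain ⟨X, hX⟩ : ∃ X, X = r * N := ⟨_, rfl⟩
  have hX0 : 0 ≤ X := by rw [hX]; positivity
  have haN : a * N ^ 2 ≤ r * N ^ 2 := by gcongr
  have hXf : X ≤ 10 * f := by
    have k1 : r * y ^ 2 ≤ X * (X + f) := by
      have h : y ^ 2 ≤ r * N ^ 2 + f * N := by linarith
      calc r * y ^ 2 ≤ r * (r * N ^ 2 + f * N) := by gcongr
        _ = _ := by rw [hX]; ring
    have k2 : r * (r ^ 2 * D ^ 2) ≤ X * (f + ε * X) := by
      have h := (mul_le_mul_of_nonneg_left hDE (sq_nonneg r)).trans h1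
      calc r * (r ^ 2 * D ^ 2) ≤ r * (f * N + ε * r * N ^ 2) := by gcongr
        _ = _ := by rw [hX]; ring
    by_contra hc
    push Not at hc
    have hXp : 0 < X := by linarith
    have k3 : X ^ 4 ≤ 4 * ((X * (X + f)) * (X * (f + ε * X))) := by
      have h6 : (N ^ 2) ^ 2 ≤ (2 * (y * D)) ^ 2 := by gcongr
      have h7 : (r * y ^ 2) * (r * (r ^ 2 * D ^ 2)) ≤ (X * (X + f)) * (X * (f + ε * X)) := by
        apply mul_le_mul k1 k2 (by positivity) (by positivity)
      calc X ^ 4 = r ^ 4 * (N ^ 2) ^ 2 := by rw [hX]; ring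
        _ ≤ r ^ 4 * (2 * (y * D)) ^ 2 := by gcongr
        _ = 4 * ((r * y ^ 2) * (r * (r ^ 2 * D ^ 2))) := by ring
        _ ≤ _ := by linarith
    have h8 : (X * (X + f)) * (X * (f + ε * X)) ≤ (X * (X + X / 10)) * (X * (X / 10 + 1 / 16 * X)) := by
      gcongr <;> linarith
    have h9 : 0 < X ^ 4 := by positivity
    linarith
  have : r * U ≤ (X ^ 2 + f * X) / 2 := by
    rw [hX]; nlinarith
  nlinarith

lemma caseC {a f N U : ℝ} (ha : a < 0)
    (hf : 0 ≤ f) (hN : 0 ≤ N) (hU : 0 ≤ U) (h2 : 2 * U ≤ a * N ^ 2 + f * N) :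
    -a * U ≤ f ^ 2 := by
  have h1 : -a * N ≤ f := by
    by_contra hc
    push Not at hc
    have : 0 < N := by
      rcases hN.eq_or_lt with h | h
      · rw [← h] at hc; linarith
      · exact h
    nlinarith
  nlinarith [mul_nonneg (neg_pos.2 ha).le (sq_nonneg N), mul_le_mul_of_nonneg_left h1 hf]



lemma arith_all {C1 C2 : ℝ} (hC1 : 0 < C1) (hC2 : 0 < C2) : ∃ ε₀ C : ℝ, 0 < ε₀ ∧ ε₀ < 1 ∧ 0 < C ∧
    ∀ r ε a f N D E y l g U Y : ℝ, 0 < r → 0 ≤ ε → ε ≤ ε₀ →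
    0 ≤ f → 0 ≤ N → 0 ≤ D → 0 ≤ y → 0 ≤ l → 0 ≤ g → 0 ≤ U →
    D ^ 2 ≤ E → r ^ 2 * E ≤ f * N + ε * r * N ^ 2 →
    |y ^ 2 + 2 * U - a * N ^ 2| ≤ f * N →
    r ^ 2 * l ^ 2 ≤ f * l + 2 * (y * D) + ε * r * E →
    g ^ 2 ≤ 3 * (f ^ 2 + (r ^ 2 * l) ^ 2 + (ε * r * N) ^ 2) →
    N ^ 2 ≤ 2 * (y * D) →
    (0 < a → U ≤ C1 * (g * N)) →
    (∀ T, 0 < a → 0 < T → T ≤ a → N ^ 2 ≤ C2 * (g ^ 2 / T ^ 2 + g * N / T + N * D * (T / √a))) →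
    Y ^ 3 = r ^ 2 * (|a| + r) → Y * U ≤ C * f ^ 2 := by
  obtain ⟨θ, hθd⟩ : ∃ θ, θ = 1 / (61 * (C2 + 1)) := ⟨_, rfl⟩
  have hθ : 0 < θ := by rw [hθd]; positivity
  have hθ61 : θ ≤ 1 / 2 := by
    rw [hθd]; apply one_div_le_one_div_of_le (by norm_num); linarith
  have hθC : 60 * C2 * θ < 1 := by
    rw [hθd, mul_one_div, div_lt_one (by positivity)]; linarith
  have ht4 : θ ^ 4 ≤ (1 / 2) ^ 4 := by gcongr
  refine ⟨θ ^ 4, 14 * C1 / θ ^ 8 + 110, by positivity, by norm_num at ht4; linarith, by positivity, ?_⟩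
  intro r ε a f N D E y l g U Y hr hε hεθ hf hN hD hy hl hg hU hDE h1 h2 h3 h4 h5 h6 h7 hY
  have h2' := (abs_le.1 h2).2
  have hq : 0 ≤ 14 * C1 / θ ^ 8 * f ^ 2 := by positivity
  have fin : ∀ T c : ℝ, 0 ≤ T → Y ^ 3 ≤ 2 * T ^ 3 → T * U ≤ c → Y * U ≤ 2 * c := by
    intro T c hT hYT hc
    have := le_two hT hYT
    have := mul_le_mul_of_nonneg_right this hU
    linarith
  rcases le_or_gt r a with har | har
  · have ha : 0 < a := by linarith
    obtain ⟨T, hTd⟩ : ∃ T : ℝ, T = (r ^ 2 * a) ^ ((1:ℝ) / 3) := ⟨_, rfl⟩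
    have hT : 0 < T := by rw [hTd]; positivity
    have hT3 : T ^ 3 = r ^ 2 * a := by
      rw [hTd, ← Real.rpow_natCast, ← Real.rpow_mul (by positivity)]; norm_num
    have hrT : r ≤ T := by
      rw [← pow_le_pow_iff_left₀ hr.le hT.le (n := 3) (by norm_num), hT3]
      have := mul_le_mul_of_nonneg_left har (sq_nonneg r)
      linarith
    have hTa : T ≤ a := by
      rw [← pow_le_pow_iff_left₀ hT.le ha.le (n := 3) (by norm_num), hT3]
      have : r ^ 2 ≤ a ^ 2 := by gcongr
      have := mul_le_mul_of_nonneg_right this ha.le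
      linarith
    have := caseA hr hε hf hN hD hy hl hg hU hC1 hC2 hθ (by linarith) hθC hεθ hDE h1 (by linarith) h3 h4
      (h6 ha) hT hT3 hrT ha (h7 T ha hT hTa)
    have h8 := fin T _ hT.le (by
      rw [hT3, hY, abs_of_pos ha]; linarith [mul_le_mul_of_nonneg_left har (sq_nonneg r)]) this
    have e : 2 * (7 * C1 / θ ^ 8 * f ^ 2) = 14 * C1 / θ ^ 8 * f ^ 2 := by ring
    rw [e] at h8
    rw [add_mul]; linarith [sq_nonneg f]
  · rcases le_or_gt (-r) a with ha2 | ha2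
    · have := caseB hr hε (hεθ.trans (ht4.trans (by norm_num))) har.le hf hN hD hy hU hDE h1 (by linarith) h5
      have h8 := fin r _ hr.le (by
        have : |a| ≤ r := abs_le.2 ⟨ha2, har.le⟩
        rw [hY]; linarith [mul_le_mul_of_nonneg_left this (sq_nonneg r)]) this
      rw [add_mul]; linarith [sq_nonneg f]
    · have ha : a < 0 := by linarith
      have := caseC ha hf hN hU (by linarith [sq_nonneg y])
      have h8 := fin (-a) _ (by linarith) (by
        rw [hY, abs_of_neg ha]
        have h1 : r ^ 2 ≤ (-a) ^ 2 := by gcongr; linarith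
        have h2 : r ^ 2 * (-a + r) ≤ (-a) ^ 2 * (-a + -a) := by
          apply mul_le_mul h1 (by linarith) (by linarith) (sq_nonneg _)
        linarith) this
      rw [add_mul]; linarith [sq_nonneg f]



lemma ibp0 {H H' f g : ℝ → ℝ} (hd : ∀ y, HasDerivAt H (H' y) y) (hc : Continuous H') (h0 : H (-1) = H 1)
    (hg : Continuous g) (h : ∀ y ∈ Set.Icc (-1:ℝ) 1, f y = g y + H' y) :
    ∫ y in (-1:ℝ)..1, f y = ∫ y in (-1:ℝ)..1, g y := by
  have e : ∫ y in (-1:ℝ)..1, f y = ∫ y in (-1:ℝ)..1, (g y + H' y) := by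
    apply intervalIntegral.integral_congr
    intro y hy
    rw [Set.uIcc_of_le (by norm_num)] at hy
    exact h y hy
  rw [e, iadd hg hc, intervalIntegral.integral_eq_sub_of_hasDerivAt (fun y _ => hd y) (hc.intervalIntegrable _ _), h0]
  ring

lemma sqrt_add_cs {a b c d : ℝ} (ha : 0 ≤ a) (hb : 0 ≤ b) (hc : 0 ≤ c) (hd : 0 ≤ d) :
    √a * √b + √c * √d ≤ √(a + c) * √(b + d) := by
  rw [← Real.sqrt_mul (show 0 ≤ a + c by positivity)]
  apply Real.le_sqrt_of_sq_le
  have e1 := Real.sq_sqrt ha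
  have e2 := Real.sq_sqrt hb
  have e3 := Real.sq_sqrt hc
  have e4 := Real.sq_sqrt hd
  have e : (a + c) * (b + d) = (√a ^ 2 + √c ^ 2) * (√b ^ 2 + √d ^ 2) := by rw [e1, e2, e3, e4]
  rw [e]
  linarith [sq_nonneg (√a * √d - √c * √b)]

lemma cs2 {f1 f2 g1 g2 : ℝ → ℝ} (h1 : Continuous f1) (h2 : Continuous f2) (h3 : Continuous g1) (h4 : Continuous g2) :
    |∫ y in (-1:ℝ)..1, (f1 y * g1 y + f2 y * g2 y)| ≤
      √(∫ y in (-1:ℝ)..1, (f1 y ^ 2 + f2 y ^ 2)) * √(∫ y in (-1:ℝ)..1, (g1 y ^ 2 + g2 y ^ 2)) := by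
  rw [iadd (by fun_prop) (by fun_prop), iadd (by fun_prop) (by fun_prop), iadd (by fun_prop) (by fun_prop)]
  have k1 := cs_int (a := -1) (b := 1) (by norm_num) h1.continuousOn h3.continuousOn
  have k2 := cs_int (a := -1) (b := 1) (by norm_num) h2.continuousOn h4.continuousOn
  have hn : ∀ f : ℝ → ℝ, 0 ≤ ∫ y in (-1:ℝ)..1, f y ^ 2 := fun f => sq_int_nonneg (by norm_num) f
  exact (abs_add_le _ _).trans ((add_le_add k1 k2).trans (sqrt_add_cs (hn _) (hn _) (hn _) (hn _)))

/-- the viscous problem in real form -/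
structure VD where
  ν : ℝ
  μ : ℝ
  a : ℝ
  s : ℝ
  κ : ℝ
  hν : 0 < ν
  hμ : 0 ≤ μ
  hs : s = 1 ∨ s = -1
  R : RD
  Q : RD
  hR : R.κ = κ
  hQ : Q.κ = κ
  p : ℝ → ℝ
  p1 : ℝ → ℝ
  p2 : ℝ → ℝ
  q : ℝ → ℝ
  q1 : ℝ → ℝ
  q2 : ℝ → ℝ
  dp : ∀ y, HasDerivAt p (p1 y) y
  dp1 : ∀ y, HasDerivAt p1 (p2 y) y
  cp2 : Continuous p2
  dq : ∀ y, HasDerivAt q (q1 y) y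
  dq1 : ∀ y, HasDerivAt q1 (q2 y) y
  cq2 : Continuous q2
  hp : ∀ y ∈ Set.Icc (-1:ℝ) 1, p y = R.w y
  hq : ∀ y ∈ Set.Icc (-1:ℝ) 1, q y = Q.w y
  pm : p (-1) = 0
  pp : p 1 = 0
  qm : q (-1) = 0
  qp : q 1 = 0

namespace VD
variable (V : VD)

lemma cp : Continuous V.p := continuous_iff_continuousAt.2 fun y => (V.dp y).continuousAt
lemma cp1 : Continuous V.p1 := continuous_iff_continuousAt.2 fun y => (V.dp1 y).continuousAt
lemma cq : Continuous V.q := continuous_iff_continuousAt.2 fun y => (V.dq y).continuousAt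
lemma cq1 : Continuous V.q1 := continuous_iff_continuousAt.2 fun y => (V.dq1 y).continuousAt

def Lp (y : ℝ) : ℝ := V.p2 y - V.κ ^ 2 * V.p y
def Lq (y : ℝ) : ℝ := V.q2 y - V.κ ^ 2 * V.q y
def G1 (y : ℝ) : ℝ := (V.a - y ^ 2) * V.p y + 2 * V.R.φ y
def G2 (y : ℝ) : ℝ := (V.a - y ^ 2) * V.q y + 2 * V.Q.φ y
def F1 (y : ℝ) : ℝ := -V.ν * V.Lp y - V.s * V.G2 y - V.s * V.μ * V.p y
def F2 (y : ℝ) : ℝ := -V.ν * V.Lq y + V.s * V.G1 y - V.s * V.μ * V.q y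

def f2 : ℝ := ∫ y in (-1:ℝ)..1, (V.F1 y ^ 2 + V.F2 y ^ 2)
def g2 : ℝ := ∫ y in (-1:ℝ)..1, (V.G1 y ^ 2 + V.G2 y ^ 2)
def n2 : ℝ := ∫ y in (-1:ℝ)..1, (V.p y ^ 2 + V.q y ^ 2)
def d2 : ℝ := ∫ y in (-1:ℝ)..1, (V.p1 y ^ 2 + V.q1 y ^ 2)
def y2 : ℝ := ∫ y in (-1:ℝ)..1, ((y * V.p y) ^ 2 + (y * V.q y) ^ 2)
def ll2 : ℝ := ∫ y in (-1:ℝ)..1, (V.Lp y ^ 2 + V.Lq y ^ 2)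
def v2 : ℝ := ∫ y in (-1:ℝ)..1, (V.R.φ1 y ^ 2 + V.Q.φ1 y ^ 2)
def z2 : ℝ := ∫ y in (-1:ℝ)..1, (V.R.φ y ^ 2 + V.Q.φ y ^ 2)

lemma cLp : Continuous V.Lp := by have := V.cp; have := V.cp2; unfold Lp; fun_prop
lemma cLq : Continuous V.Lq := by have := V.cq; have := V.cq2; unfold Lq; fun_prop
lemma cG1 : Continuous V.G1 := by have := V.cp; have := V.R.cφ; unfold G1; fun_prop
lemma cG2 : Continuous V.G2 := by have := V.cq; have := V.Q.cφ; unfold G2; fun_prop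
lemma cF1 : Continuous V.F1 := by
  have := V.cp; have := V.cLp; have := V.cG2; unfold F1; fun_prop
lemma cF2 : Continuous V.F2 := by
  have := V.cq; have := V.cLq; have := V.cG1; unfold F2; fun_prop

lemma pe {y : ℝ} (hy : y ∈ Set.Icc (-1:ℝ) 1) : V.R.φ2 y = V.p y + V.κ ^ 2 * V.R.φ y := by
  rw [V.hp y hy]; unfold RD.w; rw [V.hR]; ring
lemma qe {y : ℝ} (hy : y ∈ Set.Icc (-1:ℝ) 1) : V.Q.φ2 y = V.q y + V.κ ^ 2 * V.Q.φ y := by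
  rw [V.hq y hy]; unfold RD.w; rw [V.hQ]; ring

lemma cont_all : Continuous V.p ∧ Continuous V.p1 ∧ Continuous V.p2 ∧ Continuous V.q ∧ Continuous V.q1 ∧
    Continuous V.q2 ∧ Continuous V.R.φ ∧ Continuous V.R.φ1 ∧ Continuous V.R.φ2 ∧ Continuous V.Q.φ ∧
    Continuous V.Q.φ1 ∧ Continuous V.Q.φ2 :=
  ⟨V.cp, V.cp1, V.cp2, V.cq, V.cq1, V.cq2, V.R.cφ, V.R.c1, V.R.c2, V.Q.cφ, V.Q.c1, V.Q.c2⟩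

lemma id1 : ∫ y in (-1:ℝ)..1, (V.F1 y * V.p y + V.F2 y * V.q y) =
    V.ν * (V.d2 + V.κ ^ 2 * V.n2) - V.s * V.μ * V.n2 := by
  obtain ⟨c1, c2, c3, c4, c5, c6, c7, c8, c9, c10, c11, c12⟩ := V.cont_all
  have e := ibp0 (H := fun y => -V.ν * (V.p y * V.p1 y + V.q y * V.q1 y) +
      2 * V.s * (V.R.φ y * V.Q.φ1 y - V.Q.φ y * V.R.φ1 y))
    (H' := fun y => -V.ν * (V.p1 y ^ 2 + V.q1 y ^ 2 + V.p y * V.p2 y + V.q y * V.q2 y) +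
      2 * V.s * (V.R.φ y * V.Q.φ2 y - V.Q.φ y * V.R.φ2 y))
    (f := fun y => V.F1 y * V.p y + V.F2 y * V.q y)
    (g := fun y => V.ν * (V.p1 y ^ 2 + V.q1 y ^ 2) + (V.ν * V.κ ^ 2 - V.s * V.μ) * (V.p y ^ 2 + V.q y ^ 2))
    ?_ (by fun_prop) ?_ (by fun_prop) ?_
  · rw [e, iadd (by fun_prop) (by fun_prop), icm, icm]
    change V.ν * V.d2 + _ * V.n2 = _
    ring
  · intro y
    refine (((((V.dp y).fun_mul (V.dp1 y)).fun_add ((V.dq y).fun_mul (V.dq1 y))).const_mul (-V.ν)).fun_add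
      ((((V.R.d1 y).fun_mul (V.Q.d2 y)).fun_sub ((V.Q.d1 y).fun_mul (V.R.d2 y))).const_mul (2 * V.s))).congr_deriv ?_
    ring
  · simp [V.pm, V.pp, V.qm, V.qp, V.R.bm, V.R.bp, V.Q.bm, V.Q.bp]
  · intro y hy
    simp only [V.pe hy, V.qe hy, F1, F2, Lp, Lq, G1, G2]
    ring

lemma id2 : ∫ y in (-1:ℝ)..1, (V.F2 y * V.p y + (-V.F1 y) * V.q y) =
    V.s * (V.a * V.n2 - V.y2 - 2 * (V.v2 + V.κ ^ 2 * V.z2)) := by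
  obtain ⟨c1, c2, c3, c4, c5, c6, c7, c8, c9, c10, c11, c12⟩ := V.cont_all
  have e := ibp0 (H := fun y => -V.ν * (V.q1 y * V.p y - V.p1 y * V.q y) +
      2 * V.s * (V.R.φ y * V.R.φ1 y + V.Q.φ y * V.Q.φ1 y))
    (H' := fun y => -V.ν * (V.q2 y * V.p y - V.p2 y * V.q y) +
      2 * V.s * (V.R.φ1 y ^ 2 + V.Q.φ1 y ^ 2 + V.R.φ y * V.R.φ2 y + V.Q.φ y * V.Q.φ2 y))
    (f := fun y => V.F2 y * V.p y + (-V.F1 y) * V.q y)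
    (g := fun y => (V.s * V.a) * (V.p y ^ 2 + V.q y ^ 2) + (-V.s) * ((y * V.p y) ^ 2 + (y * V.q y) ^ 2)
      + (-2 * V.s) * (V.R.φ1 y ^ 2 + V.Q.φ1 y ^ 2) + (-2 * V.s * V.κ ^ 2) * (V.R.φ y ^ 2 + V.Q.φ y ^ 2))
    ?_ (by fun_prop) ?_ (by fun_prop) ?_
  · rw [e, iadd (by fun_prop) (by fun_prop), iadd (by fun_prop) (by fun_prop), iadd (by fun_prop) (by fun_prop),
      icm, icm, icm, icm]
    change _ * V.n2 + _ * V.y2 + _ * V.v2 + _ * V.z2 = _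
    ring
  · intro y
    refine (((((V.dq1 y).fun_mul (V.dp y)).fun_sub ((V.dp1 y).fun_mul (V.dq y))).const_mul (-V.ν)).fun_add
      ((((V.R.d1 y).fun_mul (V.R.d2 y)).fun_add ((V.Q.d1 y).fun_mul (V.Q.d2 y))).const_mul (2 * V.s))).congr_deriv ?_
    ring
  · simp [V.pm, V.pp, V.qm, V.qp, V.R.bm, V.R.bp, V.Q.bm, V.Q.bp]
  · intro y hy
    simp only [V.pe hy, V.qe hy, F1, F2, Lp, Lq, G1, G2]
    ring

lemma id3 : ∫ y in (-1:ℝ)..1, ((-V.F1 y) * V.Lp y + (-V.F2 y) * V.Lq y) =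
    V.ν * V.ll2 + 2 * V.s * (∫ y in (-1:ℝ)..1, ((y * V.q y) * V.p1 y + (y * V.p y) * (-V.q1 y)))
      - V.s * V.μ * (V.d2 + V.κ ^ 2 * V.n2) := by
  obtain ⟨c1, c2, c3, c4, c5, c6, c7, c8, c9, c10, c11, c12⟩ := V.cont_all
  have cL1 := V.cLp
  have cL2 := V.cLq
  have e := ibp0 (H := fun y => V.s * ((V.a - y ^ 2) * (V.q y * V.p1 y - V.p y * V.q1 y) +
      2 * ((V.Q.φ y * V.p1 y - V.Q.φ1 y * V.p y) - (V.R.φ y * V.q1 y - V.R.φ1 y * V.q y))) +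
      V.s * V.μ * (V.p y * V.p1 y + V.q y * V.q1 y))
    (H' := fun y => V.s * ((V.a - y ^ 2) * (V.q y * V.p2 y - V.p y * V.q2 y) - 2 * y * (V.q y * V.p1 y - V.p y * V.q1 y) +
      2 * ((V.Q.φ y * V.p2 y - V.Q.φ2 y * V.p y) - (V.R.φ y * V.q2 y - V.R.φ2 y * V.q y))) +
      V.s * V.μ * (V.p1 y ^ 2 + V.q1 y ^ 2 + V.p y * V.p2 y + V.q y * V.q2 y))
    (f := fun y => (-V.F1 y) * V.Lp y + (-V.F2 y) * V.Lq y)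
    (g := fun y => V.ν * (V.Lp y ^ 2 + V.Lq y ^ 2) + (2 * V.s) * ((y * V.q y) * V.p1 y + (y * V.p y) * (-V.q1 y))
      + (-V.s * V.μ) * (V.p1 y ^ 2 + V.q1 y ^ 2) + (-V.s * V.μ * V.κ ^ 2) * (V.p y ^ 2 + V.q y ^ 2))
    ?_ (by fun_prop) ?_ (by fun_prop) ?_
  · rw [e, iadd (by fun_prop) (by fun_prop), iadd (by fun_prop) (by fun_prop), iadd (by fun_prop) (by fun_prop),
      icm, icm, icm, icm]
    change _ * V.ll2 + _ * _ + _ * V.d2 + _ * V.n2 = _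
    ring
  · intro y
    have hW : HasDerivAt (fun y : ℝ => V.a - y ^ 2) (-(2 * y)) y := by
      simpa using ((hasDerivAt_id y).fun_pow 2).const_sub V.a
    refine ((((hW.fun_mul (((V.dq y).fun_mul (V.dp1 y)).fun_sub ((V.dp y).fun_mul (V.dq1 y)))).fun_add
      (((((V.Q.d1 y).fun_mul (V.dp1 y)).fun_sub ((V.Q.d2 y).fun_mul (V.dp y))).fun_sub
        (((V.R.d1 y).fun_mul (V.dq1 y)).fun_sub ((V.R.d2 y).fun_mul (V.dq y)))).const_mul 2)).const_mul V.s).fun_add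
      ((((V.dp y).fun_mul (V.dp1 y)).fun_add ((V.dq y).fun_mul (V.dq1 y))).const_mul (V.s * V.μ))).congr_deriv ?_
    ring
  · simp [V.pm, V.pp, V.qm, V.qp, V.R.bm, V.R.bp, V.Q.bm, V.Q.bp]
  · intro y hy
    simp only [V.pe hy, V.qe hy, F1, F2, Lp, Lq, G1, G2]
    ring

lemma id5 : V.n2 = -2 * ∫ y in (-1:ℝ)..1, ((y * V.p y) * V.p1 y + (y * V.q y) * V.q1 y) := by
  obtain ⟨c1, c2, c3, c4, c5, c6, c7, c8, c9, c10, c11, c12⟩ := V.cont_all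
  rw [← icm]
  refine ibp0 (H := fun y => y * (V.p y ^ 2 + V.q y ^ 2)) (H' := fun y => V.p y ^ 2 + V.q y ^ 2 +
    2 * ((y * V.p y) * V.p1 y + (y * V.q y) * V.q1 y)) ?_ (by fun_prop) ?_ (by fun_prop) ?_
  · intro y
    refine ((hasDerivAt_id y).fun_mul (((V.dp y).fun_pow 2).fun_add ((V.dq y).fun_pow 2))).congr_deriv ?_
    simp; ring
  · simp [V.pm, V.pp, V.qm, V.qp]
  · intro y hy
    ring
end VD



lemma nn2 (f g : ℝ → ℝ) : 0 ≤ ∫ y in (-1:ℝ)..1, (f y ^ 2 + g y ^ 2) :=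
  intervalIntegral.integral_nonneg (by norm_num) (fun y _ => by positivity)

lemma icongr {f g : ℝ → ℝ} (h : ∀ y ∈ Set.Icc (-1:ℝ) 1, f y = g y) :
    ∫ y in (-1:ℝ)..1, f y = ∫ y in (-1:ℝ)..1, g y := by
  apply intervalIntegral.integral_congr
  intro y hy
  rw [Set.uIcc_of_le (by norm_num)] at hy
  exact h y hy

namespace VD
variable (V : VD)

lemma s_abs : |V.s| = 1 := by rcases V.hs with h | h <;> simp [h]
lemma s_sq : V.s ^ 2 = 1 := by rcases V.hs with h | h <;> simp [h]

lemma b1 : V.ν * (V.d2 + V.κ ^ 2 * V.n2) ≤ √V.f2 * √V.n2 + V.μ * V.n2 := by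
  have h := V.id1
  have k := (abs_le.1 (cs2 V.cF1 V.cF2 V.cp V.cq)).2
  rw [h] at k
  change _ ≤ √V.f2 * √V.n2 at k
  have hn : 0 ≤ V.μ * V.n2 := mul_nonneg V.hμ (nn2 _ _)
  rcases V.hs with hs | hs <;> rw [hs] at k <;> linarith

lemma b2 : |V.y2 + 2 * (V.v2 + V.κ ^ 2 * V.z2) - V.a * V.n2| ≤ √V.f2 * √V.n2 := by
  have k := cs2 V.cF2 V.cF1.neg V.cp V.cq
  have e : (∫ y in (-1:ℝ)..1, (V.F2 y ^ 2 + (-V.F1) y ^ 2)) = V.f2 := by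
    unfold f2; congr 1; ext y; simp; ring
  rw [e] at k
  have h := V.id2
  simp only [Pi.neg_apply] at k
  rw [h, abs_mul, V.s_abs, one_mul] at k
  rw [abs_sub_comm]
  have e2 : V.a * V.n2 - (V.y2 + 2 * (V.v2 + V.κ ^ 2 * V.z2)) = V.a * V.n2 - V.y2 - 2 * (V.v2 + V.κ ^ 2 * V.z2) := by ring
  rw [e2]
  exact k

lemma b3 : V.ν * V.ll2 ≤ √V.f2 * √V.ll2 + 2 * (√V.y2 * √V.d2) + V.μ * (V.d2 + V.κ ^ 2 * V.n2) := by
  have cy : Continuous fun y => y * V.q y := by have := V.cq; fun_prop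
  have cy' : Continuous fun y => y * V.p y := by have := V.cp; fun_prop
  have k := cs2 V.cF1.neg V.cF2.neg V.cLp V.cLq
  have e : (∫ y in (-1:ℝ)..1, ((-V.F1) y ^ 2 + (-V.F2) y ^ 2)) = V.f2 := by
    unfold f2; congr 1; ext y; simp
  rw [e] at k
  have h := V.id3
  simp only [Pi.neg_apply] at k
  rw [h] at k
  change _ ≤ √V.f2 * √V.ll2 at k
  have k2 := cs2 cy cy' V.cp1 V.cq1.neg
  have e2 : (∫ y in (-1:ℝ)..1, (V.p1 y ^ 2 + (-V.q1) y ^ 2)) = V.d2 := by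
    unfold d2; congr 1; ext y; simp
  have e3 : (∫ y in (-1:ℝ)..1, ((y * V.q y) ^ 2 + (y * V.p y) ^ 2)) = V.y2 := by
    unfold y2; congr 1; ext y; ring
  rw [e2, e3] at k2
  simp only [Pi.neg_apply] at k2
  set J := ∫ y in (-1:ℝ)..1, ((y * V.q y) * V.p1 y + (y * V.p y) * (-V.q1 y))
  have k3 := (abs_le.1 k).2
  have k4 := abs_le.1 k2
  have hn : 0 ≤ V.μ * (V.d2 + V.κ ^ 2 * V.n2) :=
    mul_nonneg V.hμ (add_nonneg (nn2 _ _) (mul_nonneg (sq_nonneg _) (nn2 _ _)))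
  rcases V.hs with hs | hs <;> rw [hs] at k3 <;> linarith [k4.1, k4.2]

lemma b4 : V.g2 ≤ 3 * (V.f2 + V.ν ^ 2 * V.ll2 + V.μ ^ 2 * V.n2) := by
  have c1 := V.cF1
  have c2 := V.cF2
  have c3 := V.cLp
  have c4 := V.cLq
  have c5 := V.cp
  have c6 := V.cq
  have c7 := V.cG1
  have c8 := V.cG2
  have e : 3 * (V.f2 + V.ν ^ 2 * V.ll2 + V.μ ^ 2 * V.n2) = ∫ y in (-1:ℝ)..1, (3 * (V.F1 y ^ 2 + V.F2 y ^ 2) +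
      (3 * V.ν ^ 2) * (V.Lp y ^ 2 + V.Lq y ^ 2) + (3 * V.μ ^ 2) * (V.p y ^ 2 + V.q y ^ 2)) := by
    rw [iadd (by fun_prop) (by fun_prop), iadd (by fun_prop) (by fun_prop), icm, icm, icm]
    unfold f2 ll2 n2; ring
  rw [e]
  apply imono (by norm_num) (by fun_prop) (by fun_prop)
  intro y _
  have h3 : ∀ a b c : ℝ, (a + b + c) ^ 2 ≤ 3 * (a ^ 2 + b ^ 2 + c ^ 2) := by
    intro a b c; nlinarith [sq_nonneg (a - b), sq_nonneg (a - c), sq_nonneg (b - c)]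
  have k1 : V.G1 y ^ 2 ≤ 3 * (V.F2 y ^ 2 + (V.ν * V.Lq y) ^ 2 + (V.s * V.μ * V.q y) ^ 2) := by
    have : V.G1 y ^ 2 = (V.F2 y + V.ν * V.Lq y + V.s * V.μ * V.q y) ^ 2 := by
      unfold F2
      calc V.G1 y ^ 2 = V.s ^ 2 * V.G1 y ^ 2 := by rw [V.s_sq, one_mul]
        _ = _ := by ring
    rw [this]; exact h3 _ _ _
  have k2 : V.G2 y ^ 2 ≤ 3 * (V.F1 y ^ 2 + (V.ν * V.Lp y) ^ 2 + (V.s * V.μ * V.p y) ^ 2) := by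
    have : V.G2 y ^ 2 = (V.F1 y + V.ν * V.Lp y + V.s * V.μ * V.p y) ^ 2 := by
      unfold F1
      calc V.G2 y ^ 2 = V.s ^ 2 * V.G2 y ^ 2 := by rw [V.s_sq, one_mul]
        _ = _ := by ring
    rw [this]; exact h3 _ _ _
  have e1 : ∀ x, (V.s * V.μ * x) ^ 2 = V.μ ^ 2 * x ^ 2 := by
    intro x; rw [mul_pow, mul_pow, V.s_sq, one_mul]
  rw [e1] at k1 k2
  linarith

lemma b5 : V.n2 ≤ 2 * (√V.y2 * √V.d2) := by
  have cy : Continuous fun y => y * V.q y := by have := V.cq; fun_prop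
  have cy' : Continuous fun y => y * V.p y := by have := V.cp; fun_prop
  have k := (abs_le.1 (cs2 cy' cy V.cp1 V.cq1)).1
  have := V.id5
  unfold y2 d2
  linarith

lemma split_n : V.n2 = (∫ y in (-1:ℝ)..1, V.R.w y ^ 2) + ∫ y in (-1:ℝ)..1, V.Q.w y ^ 2 := by
  have c1 := V.R.cw
  have c2 := V.Q.cw
  rw [← iadd (by fun_prop) (by fun_prop)]
  exact icongr (fun y hy => by rw [V.hp y hy, V.hq y hy])

lemma split_g : V.g2 = (∫ y in (-1:ℝ)..1, V.R.G V.a y ^ 2) + ∫ y in (-1:ℝ)..1, V.Q.G V.a y ^ 2 := by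
  have c1 := V.R.cG V.a
  have c2 := V.Q.cG V.a
  rw [← iadd (by fun_prop) (by fun_prop)]
  exact icongr (fun y hy => by unfold G1 G2 RD.G; rw [V.hp y hy, V.hq y hy])

lemma split_d : V.d2 = (∫ y in (-1:ℝ)..1, V.p1 y ^ 2) + ∫ y in (-1:ℝ)..1, V.q1 y ^ 2 := by
  have c1 := V.cp1
  have c2 := V.cq1
  rw [← iadd (by fun_prop) (by fun_prop)]; rfl

lemma split_v : V.v2 = (∫ y in (-1:ℝ)..1, V.R.φ1 y ^ 2) + ∫ y in (-1:ℝ)..1, V.Q.φ1 y ^ 2 := by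
  have c1 := V.R.c1
  have c2 := V.Q.c1
  rw [← iadd (by fun_prop) (by fun_prop)]; rfl

lemma split_z : V.z2 = (∫ y in (-1:ℝ)..1, V.R.φ y ^ 2) + ∫ y in (-1:ℝ)..1, V.Q.φ y ^ 2 := by
  have c1 := V.R.cφ
  have c2 := V.Q.cφ
  rw [← iadd (by fun_prop) (by fun_prop)]; rfl
end VD

lemma L1v : ∃ C : ℝ, 0 < C ∧ ∀ V : VD, 0 < V.a → V.v2 + V.κ ^ 2 * V.z2 ≤ C * (√V.g2 * √V.n2) := by
  obtain ⟨C, hC, h⟩ := L1s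
  refine ⟨C, hC, ?_⟩
  intro V ha
  have h1 := h V.R V.a ha
  have h2 := h V.Q V.a ha
  rw [V.hR] at h1
  rw [V.hQ] at h2
  rw [V.split_n, V.split_g, V.split_v, V.split_z]
  have hn : ∀ f : ℝ → ℝ, 0 ≤ ∫ y in (-1:ℝ)..1, f y ^ 2 := fun f => sq_int_nonneg (by norm_num) f
  have h3 := mul_le_mul_of_nonneg_left (sqrt_add_cs (hn (V.R.G V.a)) (hn V.R.w) (hn (V.Q.G V.a)) (hn V.Q.w)) hC.le
  linarith

lemma L2v : ∃ C : ℝ, 0 < C ∧ ∀ (V : VD) (T : ℝ), 0 < V.a → 0 < T → T ≤ V.a →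
    V.n2 ≤ C * (V.g2 / T ^ 2 + √V.g2 * √V.n2 / T + √V.n2 * √V.d2 * (T / √V.a)) := by
  obtain ⟨C, hC, h⟩ := L2s
  refine ⟨C, hC, ?_⟩
  intro V T ha hT hTa
  have h1 := h V.R V.a T V.p V.p1 ha hT hTa V.dp V.cp1 V.hp V.pm
  have h2 := h V.Q V.a T V.q V.q1 ha hT hTa V.dq V.cq1 V.hq V.qm
  rw [V.split_n, V.split_g, V.split_d]
  have hn : ∀ f : ℝ → ℝ, 0 ≤ ∫ y in (-1:ℝ)..1, f y ^ 2 := fun f => sq_int_nonneg (by norm_num) f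
  have h3 := sqrt_add_cs (hn (V.R.G V.a)) (hn V.R.w) (hn (V.Q.G V.a)) (hn V.Q.w)
  have h4 := sqrt_add_cs (hn V.R.w) (hn V.p1) (hn V.Q.w) (hn V.q1)
  have h5 := div_le_div_of_nonneg_right h3 hT.le
  have h6 := mul_le_mul_of_nonneg_right h4 (show 0 ≤ T / √V.a by positivity)
  have h7 := mul_le_mul_of_nonneg_left (add_le_add h5 h6) hC.le
  refine (add_le_add h1 h2).trans ?_
  rw [add_div, add_mul] at h7
  rw [add_div]
  linarith

lemma VDmain : ∃ ε₀ C : ℝ, 0 < ε₀ ∧ ε₀ < 1 ∧ 0 < C ∧ ∀ (V : VD) (ε Y : ℝ), 0 ≤ ε → ε ≤ ε₀ →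
    V.μ = ε * √V.ν → Y ^ 3 = V.ν * (|V.a| + √V.ν) → Y * (V.v2 + V.κ ^ 2 * V.z2) ≤ C * V.f2 := by
  obtain ⟨C1, hC1, H1⟩ := L1v
  obtain ⟨C2, hC2, H2⟩ := L2v
  obtain ⟨ε₀, C, h0, h1, hC, h⟩ := arith_all hC1 hC2
  refine ⟨ε₀, C, h0, h1, hC, ?_⟩
  intro V ε Y hε hε0 hμ hY
  have hr : 0 < √V.ν := Real.sqrt_pos.2 V.hν
  have hr2 : √V.ν ^ 2 = V.ν := Real.sq_sqrt V.hν.le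
  have sf : √V.f2 ^ 2 = V.f2 := Real.sq_sqrt (nn2 _ _)
  have sn : √V.n2 ^ 2 = V.n2 := Real.sq_sqrt (nn2 _ _)
  have sd : √V.d2 ^ 2 = V.d2 := Real.sq_sqrt (nn2 _ _)
  have sy : √V.y2 ^ 2 = V.y2 := Real.sq_sqrt (nn2 _ _)
  have sl : √V.ll2 ^ 2 = V.ll2 := Real.sq_sqrt (nn2 _ _)
  have sg : √V.g2 ^ 2 = V.g2 := Real.sq_sqrt (nn2 _ _)
  have hkn : 0 ≤ V.κ ^ 2 * V.n2 := mul_nonneg (sq_nonneg _) (nn2 _ _)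
  have := h (√V.ν) ε V.a (√V.f2) (√V.n2) (√V.d2) (V.d2 + V.κ ^ 2 * V.n2) (√V.y2) (√V.ll2) (√V.g2)
    (V.v2 + V.κ ^ 2 * V.z2) Y hr hε hε0 (Real.sqrt_nonneg _) (Real.sqrt_nonneg _) (Real.sqrt_nonneg _)
    (Real.sqrt_nonneg _) (Real.sqrt_nonneg _) (Real.sqrt_nonneg _)
    (add_nonneg (nn2 _ _) (mul_nonneg (sq_nonneg _) (nn2 _ _)))
    (by rw [sd]; linarith)
    (by rw [hr2, sn, ← hμ]; exact V.b1)
    (by rw [sy, sn]; exact V.b2)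
    (by rw [hr2, sl, ← hμ]; exact V.b3)
    (by
      have := V.b4
      rw [mul_pow (√V.ν ^ 2), mul_pow (ε * √V.ν), hr2, sl, sg, sf, sn, ← hμ]; exact this)
    (by rw [sn]; exact V.b5)
    (H1 V)
    (by intro T ha hT hTa; rw [sn, sg]; exact H2 V T ha hT hTa)
    (by rw [hr2]; exact hY)
  rwa [sf] at this



lemma re_der {f : ℝ → ℂ} {f' : ℂ} {y : ℝ} (h : HasDerivAt f f' y) : HasDerivAt (fun y => (f y).re) f'.re y :=
  Complex.reCLM.hasFDerivAt.comp_hasDerivAt y h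
lemma im_der {f : ℝ → ℂ} {f' : ℂ} {y : ℝ} (h : HasDerivAt f f' y) : HasDerivAt (fun y => (f y).im) f'.im y :=
  Complex.imCLM.hasFDerivAt.comp_hasDerivAt y h

lemma c2_facts {f : ℝ → ℂ} (h : ContDiff ℝ 2 f) : (∀ y, HasDerivAt f (deriv f y) y) ∧
    (∀ y, HasDerivAt (deriv f) (deriv (deriv f) y) y) ∧ Continuous (deriv (deriv f)) := by
  have h2 : ContDiff ℝ (1 + 1) f := by norm_num; exact h
  have h1 : ContDiff ℝ 1 (deriv f) := (contDiff_succ_iff_deriv.1 h2).2.2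
  exact ⟨fun y => (h.differentiable (by norm_num) y).hasDerivAt,
    fun y => (h1.differentiable (by norm_num) y).hasDerivAt, h1.continuous_deriv le_rfl⟩

lemma kabs_ge {k₁ k₃ : ℤ} (h : 1 ≤ |k₁|) : 1 ≤ kabs k₁ k₃ := by
  unfold kabs
  rw [Real.one_le_sqrt]
  have h1 : (1:ℝ) ≤ |(k₁:ℝ)| := by exact_mod_cast h
  nlinarith [sq_abs (k₁:ℝ), sq_nonneg (k₃:ℝ)]

/-- real/imag data for the stream function -/
def mkRe (κ : ℝ) (hκ : 1 ≤ κ) (φ : ℝ → ℂ) (h : ContDiff ℝ 2 φ) (hm : φ (-1) = 0) (hp : φ 1 = 0) : RD where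
  κ := κ
  φ := fun y => (φ y).re
  φ1 := fun y => (deriv φ y).re
  φ2 := fun y => (deriv (deriv φ) y).re
  hκ := hκ
  d1 := fun y => re_der ((c2_facts h).1 y)
  d2 := fun y => re_der ((c2_facts h).2.1 y)
  c2 := Complex.continuous_re.comp (c2_facts h).2.2
  bm := by rw [hm]; rfl
  bp := by rw [hp]; rfl

/-- imaginary part -/
def mkIm (κ : ℝ) (hκ : 1 ≤ κ) (φ : ℝ → ℂ) (h : ContDiff ℝ 2 φ) (hm : φ (-1) = 0) (hp : φ 1 = 0) : RD where
  κ := κ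
  φ := fun y => (φ y).im
  φ1 := fun y => (deriv φ y).im
  φ2 := fun y => (deriv (deriv φ) y).im
  hκ := hκ
  d1 := fun y => im_der ((c2_facts h).1 y)
  d2 := fun y => im_der ((c2_facts h).2.1 y)
  c2 := Complex.continuous_im.comp (c2_facts h).2.2
  bm := by rw [hm]; rfl
  bp := by rw [hp]; rfl

lemma nsq (z : ℂ) : ‖z‖ ^ 2 = z.re ^ 2 + z.im ^ 2 := by
  rw [← Complex.normSq_eq_norm_sq, Complex.normSq_apply]; ring

lemma pow_arith {ν K B Y c : ℝ} (hν : 0 < ν) (hK : 0 < K) (hB : 0 ≤ B) (hY : 0 ≤ Y)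
    (hY3 : Y ^ 3 = ν / K * c) (hBc : B ^ 2 ≤ 4 * c) :
    (ν ^ ((1:ℝ)/6) * K ^ ((5:ℝ)/6) * B ^ ((1:ℝ)/3)) ^ 2 ≤ 2 * K ^ 2 * Y := by
  have e1 : (ν ^ ((1:ℝ)/6)) ^ 6 = ν := by
    rw [← Real.rpow_natCast, ← Real.rpow_mul hν.le]; norm_num
  have e2 : (K ^ ((5:ℝ)/6)) ^ 6 = K ^ 5 := by
    rw [← Real.rpow_natCast, ← Real.rpow_mul hK.le, ← Real.rpow_natCast]; norm_num
  have e3 : (B ^ ((1:ℝ)/3)) ^ 3 = B := by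
    rw [← Real.rpow_natCast, ← Real.rpow_mul hB]; norm_num
  set A1 := ν ^ ((1:ℝ)/6)
  set A2 := K ^ ((5:ℝ)/6)
  set A3 := B ^ ((1:ℝ)/3)
  rw [← pow_le_pow_iff_left₀ (by positivity) (by positivity) (n := 3) (by norm_num)]
  have l : ((A1 * A2 * A3) ^ 2) ^ 3 = ν * K ^ 5 * B ^ 2 := by
    calc _ = A1 ^ 6 * A2 ^ 6 * (A3 ^ 3) ^ 2 := by ring
      _ = _ := by rw [e1, e2, e3]
  have r : (2 * K ^ 2 * Y) ^ 3 = 8 * (ν * K ^ 5 * c) := by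
    calc _ = 8 * K ^ 6 * Y ^ 3 := by ring
      _ = _ := by rw [hY3]; field_simp
  rw [l, r]
  have hc : 0 ≤ c := by nlinarith [sq_nonneg B]
  have h5 : 0 ≤ ν * K ^ 5 * c := by positivity
  have : ν * K ^ 5 * B ^ 2 ≤ ν * K ^ 5 * (4 * c) := by gcongr
  linarith

lemma B_bound {lam : ℂ} {lamr ε r x : ℝ} (hε : 0 ≤ ε) (hε1 : ε ≤ 1) (hr : 0 ≤ r) (hx : 0 ≤ x)
    (hl : lam = (lamr : ℂ) - Complex.I * ((ε * r : ℝ) : ℂ)) (hxr : x ^ 2 = r) :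
    (√‖lam - 1‖ + x) ^ 2 ≤ 4 * (|1 - lamr| + r) := by
  have h1 : ‖lam - 1‖ ≤ |1 - lamr| + r := by
    have e : lam - 1 = ((lamr - 1 : ℝ) : ℂ) - Complex.I * ((ε * r : ℝ) : ℂ) := by
      rw [hl]; push_cast; ring
    rw [e]
    refine (norm_sub_le _ _).trans ?_
    rw [norm_mul, Complex.norm_I, one_mul, Complex.norm_real, Complex.norm_real, Real.norm_eq_abs, Real.norm_eq_abs,
      abs_sub_comm, abs_of_nonneg (by positivity : 0 ≤ ε * r)]
    have := mul_le_mul_of_nonneg_right hε1 hr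
    linarith
  have h2 := Real.sq_sqrt (norm_nonneg (lam - 1))
  have h3 := abs_nonneg (1 - lamr)
  nlinarith [sq_nonneg (√‖lam - 1‖ - x)]

lemma build (ν ε lamr : ℝ) (lam : ℂ) (k₁ k₃ : ℤ) (w φ F : ℝ → ℂ) (hν : 0 < ν) (hε : 0 ≤ ε) (hk1 : 1 ≤ |k₁|)
    (hl : lam = (lamr : ℂ) - Complex.I * ((ε * Real.sqrt ν / Real.sqrt |(k₁ : ℝ)| : ℝ) : ℂ))
    (H : OSslip ν k₁ k₃ lam w φ F) :
    ∃ V : VD, V.ν = ν / |(k₁:ℝ)| ∧ V.μ = ε * √ν / √|(k₁:ℝ)| ∧ V.a = 1 - lamr ∧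
      V.v2 + V.κ ^ 2 * V.z2 = hk k₁ k₃ φ ^ 2 ∧ l2 F ^ 2 = |(k₁:ℝ)| ^ 2 * V.f2 := by
  obtain ⟨hw, hφ, h1, h2, hm, hp, hm2, hp2⟩ := H
  have hκ := kabs_ge (k₃ := k₃) hk1
  have hK : (1:ℝ) ≤ |(k₁:ℝ)| := by exact_mod_cast hk1
  have hK0 : 0 < |(k₁:ℝ)| := by linarith
  obtain ⟨w1, w2, w3⟩ := c2_facts hw
  obtain ⟨s, hs, hsk⟩ : ∃ s : ℝ, (s = 1 ∨ s = -1) ∧ (k₁:ℝ) = s * |(k₁:ℝ)| := by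
    rcases abs_choice (k₁:ℝ) with h | h
    · exact ⟨1, Or.inl rfl, by rw [one_mul, h]⟩
    · exact ⟨-1, Or.inr rfl, by rw [h]; ring⟩
  have wm : w (-1) = 0 := by rw [← h2 (-1) (by norm_num), hm2, hm]; simp
  have wp : w 1 = 0 := by rw [← h2 1 (by norm_num), hp2, hp]; simp
  have hmu0 : 0 ≤ ε * √ν / √|(k₁:ℝ)| := by positivity
  set κ := kabs k₁ k₃ with hκd
  set μ := ε * √ν / √|(k₁:ℝ)| with hμd
  set K := |(k₁:ℝ)| with hKd
  let V : VD := {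
    ν := ν / K
    μ := μ
    a := 1 - lamr
    s := s
    κ := κ
    hν := by positivity
    hμ := hmu0
    hs := hs
    R := mkRe κ hκ φ hφ hm hp
    Q := mkIm κ hκ φ hφ hm hp
    hR := rfl
    hQ := rfl
    p := fun y => (w y).re
    p1 := fun y => (deriv w y).re
    p2 := fun y => (deriv (deriv w) y).re
    q := fun y => (w y).im
    q1 := fun y => (deriv w y).im
    q2 := fun y => (deriv (deriv w) y).im
    dp := fun y => re_der (w1 y)
    dp1 := fun y => re_der (w2 y)
    cp2 := Complex.continuous_re.comp w3
    dq := fun y => im_der (w1 y)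
    dq1 := fun y => im_der (w2 y)
    cq2 := Complex.continuous_im.comp w3
    hp := by
      intro y hy
      have := congrArg Complex.re (h2 y hy)
      simp only [← Complex.ofReal_pow, Complex.sub_re, Complex.re_ofReal_mul] at this
      exact this.symm
    hq := by
      intro y hy
      have := congrArg Complex.im (h2 y hy)
      simp only [← Complex.ofReal_pow, Complex.sub_im, Complex.im_ofReal_mul] at this
      exact this.symm
    pm := by simp only [wm]; rfl
    pp := by simp only [wp]; rfl
    qm := by simp only [wm]; rfl
    qp := by simp only [wp]; rfl }
  refine ⟨V, rfl, rfl, rfl, ?_, ?_⟩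
  · unfold hk
    rw [Real.sq_sqrt]
    · have e1 : V.v2 = ∫ y in (-1:ℝ)..1, ‖deriv φ y‖ ^ 2 := by
        simp only [nsq]; rfl
      have e2 : V.z2 = ∫ y in (-1:ℝ)..1, ‖φ y‖ ^ 2 := by
        simp only [nsq]; rfl
      rw [e1, e2]
    · have : ∀ f : ℝ → ℂ, 0 ≤ ∫ y in (-1:ℝ)..1, ‖f y‖ ^ 2 := fun f =>
        intervalIntegral.integral_nonneg (by norm_num) (fun y _ => by positivity)
      exact add_nonneg (this _) (mul_nonneg (sq_nonneg _) (this _))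
  · unfold l2
    rw [Real.sq_sqrt (intervalIntegral.integral_nonneg (by norm_num) (fun y _ => by positivity))]
    unfold VD.f2
    rw [← icm]
    apply icongr
    intro y hy
    have e := h1 y hy
    have hkc : (k₁:ℂ) = ((s * K : ℝ) : ℂ) := by rw [← hsk]; norm_cast
    have e' : F y = (K : ℂ) * ((V.F1 y : ℝ) + (V.F2 y : ℝ) * Complex.I) := by
      rw [← e, hl, hkc]
      have hKc : (K:ℂ) ≠ 0 := by exact_mod_cast hK0.ne'
      have ew : w y = ((w y).re : ℂ) + ((w y).im : ℂ) * Complex.I := (Complex.re_add_im _).symm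
      have ew2 : deriv (deriv w) y = ((deriv (deriv w) y).re : ℂ) + ((deriv (deriv w) y).im : ℂ) * Complex.I :=
        (Complex.re_add_im _).symm
      have eφ : φ y = ((φ y).re : ℂ) + ((φ y).im : ℂ) * Complex.I := (Complex.re_add_im _).symm
      have f1 : V.F1 y = -(ν / K) * ((deriv (deriv w) y).re - κ ^ 2 * (w y).re) -
        s * ((1 - lamr - y ^ 2) * (w y).im + 2 * (φ y).im) - s * μ * (w y).re := rfl
      have f2 : V.F2 y = -(ν / K) * ((deriv (deriv w) y).im - κ ^ 2 * (w y).im) +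
        s * ((1 - lamr - y ^ 2) * (w y).re + 2 * (φ y).re) - s * μ * (w y).im := rfl
      rw [f1, f2]
      conv_lhs => rw [ew, ew2, eφ]
      push_cast
      field_simp
      ring_nf
      simp only [Complex.I_sq, show Complex.I ^ 3 = -Complex.I from Complex.I_pow_three]
      ring
    rw [e', nsq]
    simp only [Complex.re_ofReal_mul, Complex.im_ofReal_mul]
    simp
    ring

/-- **Weak-type resolvent estimate for the velocity with Navier-slip
boundary condition** (Proposition 2.8): for `λ = λ_r - iεν^{1/2}|k₁|^{-1/2}`,
`ν^{1/6}|k₁|^{5/6}(|λ-1|^{1/2}+|ν/k₁|^{1/4})^{1/3}‖u‖_{L²} ≤ C‖F‖_{L²}`,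
where `u = (∂_yφ, -i|k|φ)`. -/
theorem OS_slip_weak_type_velocity :
    ∃ ε₀ ν₀ C : ℝ, 0 < ε₀ ∧ ε₀ < 1 ∧ 0 < ν₀ ∧ ν₀ < 1 ∧ 0 < C ∧
      ∀ (ν ε lamr : ℝ) (lam : ℂ) (k₁ k₃ : ℤ) (w φ F : ℝ → ℂ),
        0 < ν → ν ≤ ν₀ → 0 ≤ ε → ε ≤ ε₀ → 1 ≤ |k₁| →
        lam = (lamr : ℂ) -
          Complex.I * ((ε * Real.sqrt ν / Real.sqrt |(k₁ : ℝ)| : ℝ) : ℂ) →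
        IntervalIntegrable (fun y => ‖F y‖ ^ 2) MeasureTheory.volume (-1) 1 →
        OSslip ν k₁ k₃ lam w φ F →
        ν ^ ((1:ℝ)/6) * |(k₁ : ℝ)| ^ ((5:ℝ)/6) *
            (Real.sqrt ‖lam - 1‖ + (ν / |(k₁ : ℝ)|) ^ ((1:ℝ)/4)) ^ ((1:ℝ)/3) *
            hk k₁ k₃ φ
          ≤ C * l2 F := by
  obtain ⟨ε₀, C, h0, h1, hC, h⟩ := VDmain
  refine ⟨ε₀, 1 / 2, C + 1, h0, h1, by norm_num, by norm_num, by positivity, ?_⟩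
  intro ν ε lamr lam k₁ k₃ w φ F hν _ hε hε0 hk1 hl _ H
  obtain ⟨V, v1, v2, v3, v4, v5⟩ := build ν ε lamr lam k₁ k₃ w φ F hν hε hk1 hl H
  have hK : (1:ℝ) ≤ |(k₁:ℝ)| := by exact_mod_cast hk1
  have hK0 : 0 < |(k₁:ℝ)| := by linarith
  set K := |(k₁:ℝ)| with hKd
  have hr : √(ν / K) = √ν / √K := Real.sqrt_div hν.le _
  have hmu : ε * √ν / √K = ε * √(ν / K) := by rw [hr]; ring
  have hνK : 0 < ν / K := by positivity
  obtain ⟨Y, hYd⟩ : ∃ Y : ℝ, Y = (ν / K * (|1 - lamr| + √(ν / K))) ^ ((1:ℝ) / 3) := ⟨_, rfl⟩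
  have hY : 0 ≤ Y := by rw [hYd]; positivity
  have hY3 : Y ^ 3 = ν / K * (|1 - lamr| + √(ν / K)) := by
    rw [hYd, ← Real.rpow_natCast, ← Real.rpow_mul (by positivity)]; norm_num
  have key := h V ε Y hε hε0 (by rw [v2, v1, hmu]) (by rw [v1, v3, hY3])
  rw [v4] at key
  have hx2 : ((ν / K) ^ ((1:ℝ)/4)) ^ 2 = √(ν / K) := by
    rw [Real.sqrt_eq_rpow, ← Real.rpow_natCast, ← Real.rpow_mul hνK.le]; norm_num
  rw [hmu] at hl
  have hB := B_bound hε (by linarith) (Real.sqrt_nonneg _) (by positivity : 0 ≤ (ν / K) ^ ((1:ℝ)/4)) hl hx2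
  have hA := pow_arith hν hK0 (by positivity : 0 ≤ √‖lam - 1‖ + (ν / K) ^ ((1:ℝ)/4)) hY hY3 hB
  set A := ν ^ ((1:ℝ)/6) * K ^ ((5:ℝ)/6) * (√‖lam - 1‖ + (ν / K) ^ ((1:ℝ)/4)) ^ ((1:ℝ)/3) with hAd
  have hl0 : 0 ≤ l2 F := Real.sqrt_nonneg _
  apply le_of_sq_le_sq _ (by positivity)
  calc (A * hk k₁ k₃ φ) ^ 2 = A ^ 2 * hk k₁ k₃ φ ^ 2 := by ring
    _ ≤ 2 * K ^ 2 * Y * hk k₁ k₃ φ ^ 2 := by gcongr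
    _ = 2 * K ^ 2 * (Y * hk k₁ k₃ φ ^ 2) := by ring
    _ ≤ 2 * K ^ 2 * (C * V.f2) := by gcongr
    _ = 2 * C * (K ^ 2 * V.f2) := by ring
    _ = 2 * C * l2 F ^ 2 := by rw [v5]
    _ ≤ (C + 1) ^ 2 * l2 F ^ 2 := by gcongr; nlinarith
    _ = _ := by ring
end
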